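/- Let r_n^forw denote the maximal number of forward alternating associative monomials in the expansion of a commutator monomial on n variables. Then r_1^forw = 1, r_2^forw = 1, r_3^forw = 2, and for every natural number k: r_{4+4k}^forw = 3·6^k, r_{5+4k}^forw = 6·6^k, r_{6+4k}^forw = 7·6^k, and r_{7+4k}^forw = 14·6^k. -/

import Mathlib

open scoped Classical

/-- Full plane binary trees with leaves labeled by natural numbers
(representing the variables `X_i`). -/
inductive BTree : Type where
  | leaf : ℕ → BTree
  | node : BTree → BTree → BTree

namespace BTree

/-- The list of leaf labels, from left to right. -/
def leaves : BTree → List ℕ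
  | leaf a => [a]
  | node l r => l.leaves ++ r.leaves

/-- The expansion set `W(T, ℓ)` of the commutator monomial modeled by `T`. -/
def words : BTree → Finset (List ℕ)
  | leaf a => {[a]}
  | node l r =>
      ((l.words ×ˢ r.words).image fun p => p.1 ++ p.2) ∪
      ((l.words ×ˢ r.words).image fun p => p.2 ++ p.1)

end BTree

/-- A word (list of labels) is alternating: consecutive entries differ, and no entry
lies strictly between its two neighbours. -/
def IsAlternating (w : List ℕ) : Prop :=
  (∀ i, i + 1 < w.length → w.getD i 0 ≠ w.getD (i + 1) 0) ∧
  (∀ i, i + 2 < w.length →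
    ¬ (w.getD i 0 < w.getD (i + 1) 0 ∧ w.getD (i + 1) 0 < w.getD (i + 2) 0) ∧
    ¬ (w.getD (i + 2) 0 < w.getD (i + 1) 0 ∧ w.getD (i + 1) 0 < w.getD i 0))

/-- A word is forward alternating: alternating, and it does not start with an ascent. -/
def IsForwardAlternating (w : List ℕ) : Prop :=
  IsAlternating w ∧ (w.length ≤ 1 ∨ w.getD 1 0 < w.getD 0 0)

/-- Number of alternating words in the expansion of `t`. -/
noncomputable def altCount (t : BTree) : ℕ :=
  (t.words.filter fun w => IsAlternating w).card

/-- Number of forward alternating words in the expansion of `t`. -/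
noncomputable def faltCount (t : BTree) : ℕ :=
  (t.words.filter fun w => IsForwardAlternating w).card

/-- `rAlt n` : the maximal number of alternating associative monomials in a commutator
monomial whose leaves are labeled bijectively by `{1, …, n}`. -/
noncomputable def rAlt (n : ℕ) : ℕ :=
  sSup {m | ∃ t : BTree, t.leaves.Perm (List.range' 1 n) ∧ m = altCount t}

/-- `rFAlt n` : the forward-alternating analogue of `rAlt n`. -/
noncomputable def rFAlt (n : ℕ) : ℕ :=
  sSup {m | ∃ t : BTree, t.leaves.Perm (List.range' 1 n) ∧ m = faltCount t}

/-- The number of alternating permutations of `{1, …, n}` (denoted `Ẽ_n`). -/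
noncomputable def altPerms (n : ℕ) : ℕ :=
  Nat.card {σ : Equiv.Perm (Fin n) // IsAlternating (List.ofFn fun i => (σ i : ℕ))}

/-- The number of forward alternating permutations of `{1, …, n}` (denoted `E_n`). -/
noncomputable def faltPerms (n : ℕ) : ℕ :=
  Nat.card {σ : Equiv.Perm (Fin n) // IsForwardAlternating (List.ofFn fun i => (σ i : ℕ))}

namespace Profile

/-- A typed end of a word: `(true, x)` is a peak of height `x`, `(false, x)` a valley. -/
abbrev End := Bool × ℤ

/-- `ind p` is `1` if `p` holds and `0` otherwise. -/
def ind (p : Bool) : ℤ := if p then 1 else 0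

/-- The join of two typed words is possible at the ends `a`, `b`. -/
def compat (a b : End) : Bool :=
  bif a.1 then !b.1 && decide (b.2 < a.2) else b.1 && decide (a.2 < b.2)

/-- Ends which are compatible with the cut between `s` and `s + 1`. -/
def cut (s : ℤ) (e : End) : Bool := bif e.1 then decide (s < e.2) else decide (e.2 ≤ s)

abbrev Prof := Multiset (End × End)

/-- Sum of a function over the pairs of ends of a profile. -/
def tot (M : Prof) (φ : End → End → ℤ) : ℤ := (M.map fun x => φ x.1 x.2).sum

theorem tot_add (M : Prof) (φ ψ : End → End → ℤ) :
    tot M (fun a b => φ a b + ψ a b) = tot M φ + tot M ψ := by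
  simp [tot, Multiset.sum_map_add]

theorem tot_mul_left (M : Prof) (c : ℤ) (φ : End → End → ℤ) :
    tot M (fun a b => c * φ a b) = c * tot M φ := by
  simp [tot, Multiset.sum_map_mul_left]

theorem tot_mono {M : Prof} {φ ψ : End → End → ℤ}
    (h : ∀ x ∈ M, φ x.1 x.2 ≤ ψ x.1 x.2) : tot M φ ≤ tot M ψ :=
  Multiset.sum_map_le_sum_map _ _ h

theorem tot_congr {M : Prof} {φ ψ : End → End → ℤ}
    (h : ∀ x ∈ M, φ x.1 x.2 = ψ x.1 x.2) : tot M φ = tot M ψ := by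
  unfold tot; rw [Multiset.map_congr rfl h]

theorem tot_comm (X Y : Prof) (φ : End → End → End → End → ℤ) :
    tot X (fun a b => tot Y (fun c d => φ a b c d)) =
      tot Y (fun c d => tot X (fun a b => φ a b c d)) := by
  unfold tot
  exact Multiset.sum_map_sum_map X Y

theorem tot_union (X Y : Prof) (φ : End → End → ℤ) :
    tot (X + Y) φ = tot X φ + tot Y φ := by
  simp [tot]

/-- The number of pairs whose left end satisfies `A` and whose right end satisfies `B`. -/
def cnt (M : Prof) (A B : End → Bool) : ℤ := tot M fun a b => ind (A a) * ind (B b)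

/-- Profile of all concatenations of a word from `X` with a word from `Y`. -/
def join (X Y : Prof) : Prof :=
  X.bind fun x => (Y.filter fun y => compat x.2 y.1 = true).map fun y => (x.1, y.2)

theorem sum_filter_map (X : Prof) (q : End × End → Bool) (g : End × End → ℤ) :
    ((X.filter fun x => q x = true).map g).sum = (X.map fun x => ind (q x) * g x).sum := by
  induction X using Multiset.induction_on with
  | empty => simp
  | cons y Y ih =>
    by_cases h : q y = true
    · rw [Multiset.filter_cons_of_pos (p := fun y : End × End => q y = true) Y h]
      simp [ih, ind, h]
    · rw [Multiset.filter_cons_of_neg (p := fun y : End × End => q y = true) Y h]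
      simp [ih, ind, h]

theorem tot_join (X Y : Prof) (φ : End → End → ℤ) :
    tot (join X Y) φ = tot X fun a b => tot Y fun c d => ind (compat b c) * φ a d := by
  unfold tot join
  rw [Multiset.map_bind, Multiset.sum_bind]
  congr 1
  refine Multiset.map_congr rfl fun x _ => ?_
  rw [Multiset.map_map]
  exact sum_filter_map Y (fun y => compat x.2 y.1) (fun y => φ x.1 y.2)

/-- A profile is symmetric if reversing all words does not change it. -/
structure Symm (M : Prof) : Prop where
  tot_eq : ∀ φ, tot M φ = tot M fun a b => φ b a

theorem compat_symm (a b : End) : compat a b = compat b a := by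
  rcases a with ⟨_ | _, x⟩ <;> rcases b with ⟨_ | _, y⟩ <;> simp [compat]

theorem tot_join_swap {X Y : Prof} (hX : Symm X) (hY : Symm Y) (φ : End → End → ℤ) :
    tot (join Y X) φ = tot (join X Y) fun a b => φ b a := by
  rw [tot_join, tot_join, tot_comm, hX.tot_eq]
  refine tot_congr fun x _ => ?_
  rw [hY.tot_eq]
  refine tot_congr fun y _ => ?_
  rw [compat_symm]

/-- Profile of the commutator of two profiles. -/
def merge (X Y : Prof) : Prof := join X Y + join Y X

theorem merge_comm (X Y : Prof) : merge X Y = merge Y X := add_comm _ _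

theorem tot_merge {X Y : Prof} (hX : Symm X) (hY : Symm Y) (φ : End → End → ℤ) :
    tot (merge X Y) φ = tot (join X Y) φ + tot (join X Y) fun a b => φ b a := by
  rw [merge, tot_union, tot_join_swap hX hY]

theorem symm_merge {X Y : Prof} (hX : Symm X) (hY : Symm Y) : Symm (merge X Y) := by
  refine ⟨fun φ => ?_⟩
  rw [tot_merge hX hY, tot_merge hX hY, add_comm]

theorem cnt_merge {X Y : Prof} (hX : Symm X) (hY : Symm Y) (A B : End → Bool) :
    cnt (merge X Y) A B = cnt (join X Y) A B + cnt (join X Y) B A := by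
  unfold cnt
  rw [tot_merge hX hY]
  simp only [mul_comm]

theorem cnt_symm {M : Prof} (hM : Symm M) (A B : End → Bool) : cnt M A B = cnt M B A := by
  unfold cnt; rw [hM.tot_eq]; simp only [mul_comm]

/-- Words of odd length: both ends have the same type. -/
def IsOdd (M : Prof) : Prop := ∀ x ∈ M, x.1.1 = x.2.1

/-- Words of even length: the ends have opposite types. -/
def IsEven (M : Prof) : Prop := ∀ x ∈ M, x.1.1 ≠ x.2.1

theorem mem_join {X Y : Prof} {z : End × End} :
    z ∈ join X Y ↔ ∃ x ∈ X, ∃ y ∈ Y, compat x.2 y.1 = true ∧ z = (x.1, y.2) := by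
  simp only [join, Multiset.mem_bind, Multiset.mem_map, Multiset.mem_filter]
  constructor
  · rintro ⟨x, hx, y, ⟨hy, h⟩, rfl⟩; exact ⟨x, hx, y, hy, h, rfl⟩
  · rintro ⟨x, hx, y, hy, h, rfl⟩; exact ⟨x, hx, y, ⟨hy, h⟩, rfl⟩

theorem compat_ne {a b : End} (h : compat a b = true) : a.1 ≠ b.1 := by
  rcases a with ⟨_ | _, x⟩ <;> rcases b with ⟨_ | _, y⟩ <;> simp_all [compat]

theorem IsOdd.merge_odd {X Y : Prof} (hX : IsOdd X) (hY : IsOdd Y) : IsEven (merge X Y) := by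
  intro z hz
  rcases Multiset.mem_add.1 hz with hz | hz <;>
  · obtain ⟨x, hx, y, hy, h, rfl⟩ := mem_join.1 hz
    have := compat_ne h
    first
      | rwa [← hX x hx, hY y hy] at this
      | rwa [← hY x hx, hX y hy] at this

theorem IsOdd.merge_even {X Y : Prof} (hX : IsOdd X) (hY : IsEven Y) : IsOdd (merge X Y) := by
  intro z hz
  rcases Multiset.mem_add.1 hz with hz | hz <;>
  · obtain ⟨x, hx, y, hy, h, rfl⟩ := mem_join.1 hz
    have h1 := compat_ne h
    first
      | have h2 := hX x hx; have h3 := hY y hy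
        revert h1 h2 h3; generalize x.1.1 = a; generalize x.2.1 = b; generalize y.1.1 = c
        dsimp only; generalize y.2.1 = d; revert a b c d; decide
      | have h2 := hY x hx; have h3 := hX y hy
        revert h1 h2 h3; dsimp only; generalize x.1.1 = a; generalize x.2.1 = b
        generalize y.1.1 = c; generalize y.2.1 = d; revert a b c d; decide

theorem IsEven.merge_even {X Y : Prof} (hX : IsEven X) (hY : IsEven Y) : IsEven (merge X Y) := by
  intro z hz
  rcases Multiset.mem_add.1 hz with hz | hz <;>
  · obtain ⟨x, hx, y, hy, h, rfl⟩ := mem_join.1 hz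
    have h1 := compat_ne h
    first
      | have h2 := hX x hx; have h3 := hY y hy
        revert h1 h2 h3; dsimp only; generalize x.1.1 = a; generalize x.2.1 = b
        generalize y.1.1 = c; generalize y.2.1 = d; revert a b c d; decide
      | have h2 := hY x hx; have h3 := hX y hy
        revert h1 h2 h3; dsimp only; generalize x.1.1 = a; generalize x.2.1 = b
        generalize y.1.1 = c; generalize y.2.1 = d; revert a b c d; decide

/-- Sum of a function over a multiset of ends. -/
def esum (X : Multiset End) (g : End → ℤ) : ℤ := (X.map g).sum

theorem esum_mono {X : Multiset End} {g h : End → ℤ} (H : ∀ x ∈ X, g x ≤ h x) :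
    esum X g ≤ esum X h :=
  Multiset.sum_map_le_sum_map _ _ H

theorem esum_add (X : Multiset End) (g h : End → ℤ) :
    esum X (fun x => g x + h x) = esum X g + esum X h := by
  simp [esum, Multiset.sum_map_add]

theorem esum_comm (X Y : Multiset End) (φ : End → End → ℤ) :
    esum X (fun a => esum Y fun b => φ a b) = esum Y fun b => esum X fun a => φ a b :=
  Multiset.sum_map_sum_map X Y

theorem esum_mul_left (X : Multiset End) (c : ℤ) (g : End → ℤ) :
    esum X (fun x => c * g x) = c * esum X g := by
  simp [esum, Multiset.sum_map_mul_left]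

theorem esum_mul_right (X : Multiset End) (c : ℤ) (g : End → ℤ) :
    esum X (fun x => g x * c) = esum X g * c := by
  simp [esum, Multiset.sum_map_mul_right]

theorem esum_finset_sum {ι : Type*} (s : Finset ι) (Y : Multiset End) (g : ι → End → ℤ) :
    esum Y (fun y => ∑ k ∈ s, g k y) = ∑ k ∈ s, esum Y (g k) := by
  unfold esum
  exact Multiset.sum_map_sum

theorem exists_bounds (Y : Multiset End) : ∃ lo hi : ℤ, ∀ y ∈ Y, lo < y.2 ∧ y.2 < hi := by
  induction Y using Multiset.induction_on with
  | empty => exact ⟨0, 0, by simp⟩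
  | cons y Y ih =>
    obtain ⟨lo, hi, h⟩ := ih
    refine ⟨min lo (y.2 - 1), max hi (y.2 + 1), fun z hz => ?_⟩
    rcases Multiset.mem_cons.1 hz with rfl | hz
    · constructor <;> omega
    · have := h z hz
      constructor <;> omega

/-- An upper set of integers looks like a cut from the point of view of finitely many ends. -/
theorem exists_cut (U : ℤ → Prop) (hU : ∀ x y, x ≤ y → U x → U y) (Y : Multiset End) :
    ∃ z, ∀ y ∈ Y, cut z y = false → if y.1 then ¬ U (y.2 - 1) else U y.2 := by
  obtain ⟨lo, hi, hb⟩ := exists_bounds Y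
  by_cases h1 : ∃ x, U x
  · by_cases h2 : ∃ b, ∀ x, U x → b ≤ x
    · obtain ⟨b, hb'⟩ := h2
      obtain ⟨s, hs, hmin⟩ := Int.exists_least_of_bdd (P := U) ⟨b, hb'⟩ h1
      refine ⟨s - 1, fun y _ hy => ?_⟩
      rcases y with ⟨_ | _, v⟩ <;> simp only [cut, cond_true, cond_false, decide_eq_false_iff_not,
        not_le, not_lt] at hy ⊢
      · simpa using hU s v (by omega) hs
      · simp only [if_true]
        intro h; have := hmin _ h; omega
    · push Not at h2
      refine ⟨lo, fun y hy hc => ?_⟩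
      have hl := hb y hy
      rcases y with ⟨_ | _, v⟩ <;> simp only [cut, cond_true, cond_false, decide_eq_false_iff_not,
        not_le, not_lt] at hc hl ⊢
      · obtain ⟨x, hx, hxv⟩ := h2 v
        simpa using hU x v hxv.le hx
      · omega
  · push Not at h1
    refine ⟨hi, fun y hy hc => ?_⟩
    have hl := hb y hy
    rcases y with ⟨_ | _, v⟩ <;> simp only [cut, cond_true, cond_false, decide_eq_false_iff_not,
        not_le, not_lt] at hc hl ⊢
    · omega
    · simpa using h1 (v - 1)

theorem ind_nonneg (p : Bool) : 0 ≤ ind p := by cases p <;> simp [ind]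

/-- Number of peaks of height at most `z`. -/
def low (X : Multiset End) (z : ℤ) : ℤ := esum X fun e => ind (e.1 && decide (e.2 ≤ z))

/-- Number of valleys of height more than `z`. -/
def high (X : Multiset End) (z : ℤ) : ℤ := esum X fun e => ind (!e.1 && decide (z < e.2))

theorem low_mono (X : Multiset End) {y z : ℤ} (h : y ≤ z) : low X y ≤ low X z := by
  refine esum_mono fun e _ => ?_
  rcases e with ⟨_ | _, v⟩ <;> simp only [ind, Bool.false_and, Bool.true_and, decide_eq_true_eq]
  · simp
  · split_ifs <;> omega

theorem low_nonneg (X : Multiset End) (z : ℤ) : 0 ≤ low X z := by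
  have := esum_mono (X := X) (g := fun _ => 0) (fun e _ => ind_nonneg (e.1 && decide (e.2 ≤ z)))
  simpa [esum, low] using this

theorem low_add_high (X : Multiset End) (z : ℤ) :
    low X z + high X z = esum X fun e => ind (!cut z e) := by
  unfold low high
  rw [← esum_add]
  congr 1; funext e
  rcases e with ⟨_ | _, v⟩ <;> simp [ind, cut]

theorem card_range_lt (d : ℕ) (a : ℤ) (ha : 0 ≤ a) :
    ∑ k ∈ Finset.range d, (if (k : ℤ) < a then (1 : ℤ) else 0) = min (d : ℤ) a := by
  induction d with
  | zero => simp [ha]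
  | succ d ih =>
    rw [Finset.sum_range_succ, ih]
    push_cast
    split_ifs <;> omega

/-- Key estimate: two families of ends, each of which is incompatible with every cut at least
`d` (respectively `d'`) times, have at least `d * d'` incompatible pairs of opposite types. -/
theorem compat_le (X Y : Multiset End) {d d' : ℤ} (hd0 : 0 ≤ d)
    (hd : ∀ z, d ≤ esum X fun e => ind (!cut z e))
    (hd' : ∀ z, d' ≤ esum Y fun e => ind (!cut z e)) :
    (esum X fun b => esum Y fun c => ind (compat b c)) + d * d' ≤
      (esum X fun b => ind b.1) * (esum Y fun c => ind (!c.1)) +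
      (esum X fun b => ind (!b.1)) * (esum Y fun c => ind c.1) := by
  lift d to ℕ using hd0
  let I : ℕ → End → ℤ := fun k c =>
    if c.1 then (if low X (c.2 - 1) ≤ k then 1 else 0) else (if (k : ℤ) < low X c.2 then 1 else 0)
  have h1 : ∀ k : ℕ, d' ≤ esum Y (I k) := by
    intro k
    obtain ⟨z, hz⟩ := exists_cut (fun w => (k : ℤ) < low X w)
      (fun x y hxy h => lt_of_lt_of_le h (low_mono X hxy)) Y
    refine (hd' z).trans (esum_mono fun c hc => ?_)
    have := hz c hc
    cases h : cut z c
    · have := this h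
      rcases c with ⟨_ | _, v⟩ <;> simp_all [ind, I]
    · simp only [ind, I, Bool.not_true]
      split_ifs <;> simp_all
  have h2 : ∀ c : End, ∑ k ∈ Finset.range d, I k c ≤
      if c.1 then high X (c.2 - 1) else low X c.2 := by
    intro c
    rcases c with ⟨_ | _, v⟩
    · simp only [I, Bool.false_eq_true, if_false]
      rw [card_range_lt _ _ (low_nonneg _ _)]
      exact min_le_right _ _
    · simp only [I, if_true]
      have e : ∀ k : ℕ, (if low X (v - 1) ≤ (k : ℤ) then (1 : ℤ) else 0) =
          1 - if (k : ℤ) < low X (v - 1) then 1 else 0 := by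
        intro k; split_ifs <;> omega
      simp only [e, Finset.sum_sub_distrib, card_range_lt _ _ (low_nonneg X (v - 1))]
      have h3 := hd (v - 1)
      rw [← low_add_high] at h3
      have h4 : 0 ≤ high X (v - 1) := by
        have h5 := esum_mono (X := X) (g := fun _ => 0)
          (fun e _ => ind_nonneg (!e.1 && decide (v - 1 < e.2)))
        exact le_trans (by simp [esum]) h5
      simp only [Finset.sum_const, Finset.card_range, nsmul_eq_mul, mul_one]
      omega
  have h3 : (d : ℤ) * d' ≤ esum Y fun c => if c.1 then high X (c.2 - 1) else low X c.2 := by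
    refine le_trans ?_ (esum_mono fun c _ => h2 c)
    rw [esum_finset_sum]
    have := Finset.sum_le_sum (s := Finset.range d) fun k _ => h1 k
    simpa using this
  have h4 : (esum X fun b => esum Y fun c => ind (compat b c)) +
      (esum Y fun c => if c.1 then high X (c.2 - 1) else low X c.2) =
      (esum X fun b => ind b.1) * (esum Y fun c => ind (!c.1)) +
      (esum X fun b => ind (!b.1)) * (esum Y fun c => ind c.1) := by
    rw [esum_comm, ← esum_mul_left, ← esum_mul_left, ← esum_add, ← esum_add]
    congr 1; funext c
    rw [← esum_mul_right, ← esum_mul_right]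
    rcases c with ⟨_ | _, v⟩
    · simp only [Bool.false_eq_true, if_false, low]
      rw [← esum_add, ← esum_add]
      congr 1; funext b
      rcases b with ⟨_ | _, w⟩
      · simp [ind, compat]
      · by_cases hh : v < w <;> simp [ind, compat, hh, not_le.2, not_lt.1]
    · simp only [if_true, high]
      rw [← esum_add, ← esum_add]
      congr 1; funext b
      rcases b with ⟨_ | _, w⟩
      · have e : (v - 1 < w) ↔ ¬ (w < v) := by omega
        by_cases hh : w < v <;> simp [ind, compat, hh, e]
      · simp [ind, compat]
  linarith

/-- Right ends of the words whose left end satisfies `A`. -/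
def endsR (X : Prof) (A : End → Bool) : Multiset End :=
  (X.filter fun x => A x.1 = true).map Prod.snd

/-- Left ends of the words whose right end satisfies `B`. -/
def endsL (Y : Prof) (B : End → Bool) : Multiset End :=
  (Y.filter fun x => B x.2 = true).map Prod.fst

theorem esum_endsR (X : Prof) (A : End → Bool) (g : End → ℤ) :
    esum (endsR X A) g = tot X fun a b => ind (A a) * g b := by
  unfold esum endsR tot
  rw [Multiset.map_map]
  exact sum_filter_map X (fun x => A x.1) (fun x => g x.2)

theorem esum_endsL (Y : Prof) (B : End → Bool) (g : End → ℤ) :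
    esum (endsL Y B) g = tot Y fun a b => ind (B b) * g a := by
  unfold esum endsL tot
  rw [Multiset.map_map]
  exact sum_filter_map Y (fun x => B x.2) (fun x => g x.1)

/-- Peaks. -/
def pk (e : End) : Bool := e.1

/-- Valleys. -/
def vl (e : End) : Bool := !e.1

/-- Ends incompatible with a cut. -/
def ncut (z : ℤ) (e : End) : Bool := !cut z e

theorem cnt_join_le (X Y : Prof) (A B : End → Bool) {d d' : ℤ} (hd0 : 0 ≤ d)
    (hd : ∀ z, d ≤ cnt X A (ncut z)) (hd' : ∀ z, d' ≤ cnt Y (ncut z) B) :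
    cnt (join X Y) A B + d * d' ≤ cnt X A pk * cnt Y vl B + cnt X A vl * cnt Y pk B := by
  have := compat_le (endsR X A) (endsL Y B) (d := d) (d' := d') hd0
    (by intro z; rw [esum_endsR]; exact hd z)
    (by intro z; rw [esum_endsL]; exact (hd' z).trans_eq (tot_congr fun x _ => mul_comm _ _))
  have e : (esum (endsR X A) fun b => esum (endsL Y B) fun c => ind (compat b c)) =
      cnt (join X Y) A B := by
    rw [esum_endsR, cnt, tot_join]
    refine tot_congr fun x _ => ?_
    rw [esum_endsL, ← tot_mul_left]
    refine tot_congr fun y _ => ?_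
    ring
  rw [e] at this
  simp only [esum_endsR, esum_endsL] at this
  simpa only [cnt, pk, vl, mul_comm] using this

theorem cnt_le {M : Prof} {A B A' B' : End → Bool}
    (h : ∀ x ∈ M, (A x.1 && B x.2) = true → (A' x.1 && B' x.2) = true) :
    cnt M A B ≤ cnt M A' B' := by
  refine tot_mono fun x hx => ?_
  have := h x hx
  revert this
  cases A x.1 <;> cases B x.2 <;> cases A' x.1 <;> cases B' x.2 <;> simp [ind]

theorem cnt_eq {M : Prof} {A B A' B' : End → Bool}
    (h : ∀ x ∈ M, (A x.1 && B x.2) = (A' x.1 && B' x.2)) : cnt M A B = cnt M A' B' :=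
  le_antisymm (cnt_le fun x hx => by rw [h x hx]; exact id)
    (cnt_le fun x hx => by rw [h x hx]; exact id)

theorem cnt_le_add {M : Prof} {A B A₁ B₁ A₂ B₂ : End → Bool}
    (h : ∀ x ∈ M, (A x.1 && B x.2) = true → (A₁ x.1 && B₁ x.2 || A₂ x.1 && B₂ x.2) = true) :
    cnt M A B ≤ cnt M A₁ B₁ + cnt M A₂ B₂ := by
  unfold cnt
  rw [← tot_add]
  refine tot_mono fun x hx => ?_
  have := h x hx
  revert this
  cases A x.1 <;> cases B x.2 <;> cases A₁ x.1 <;> cases B₁ x.2 <;> cases A₂ x.1 <;>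
    cases B₂ x.2 <;> simp [ind]

theorem add_le_cnt {M : Prof} {A B A₁ B₁ A₂ B₂ : End → Bool}
    (h : ∀ x ∈ M, ((A₁ x.1 && B₁ x.2 || A₂ x.1 && B₂ x.2) = true → (A x.1 && B x.2) = true) ∧
      (A₁ x.1 && B₁ x.2 && A₂ x.1 && B₂ x.2) = false) :
    cnt M A₁ B₁ + cnt M A₂ B₂ ≤ cnt M A B := by
  unfold cnt
  rw [← tot_add]
  refine tot_mono fun x hx => ?_
  have := h x hx
  revert this
  cases A x.1 <;> cases B x.2 <;> cases A₁ x.1 <;> cases B₁ x.2 <;> cases A₂ x.1 <;>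
    cases B₂ x.2 <;> simp [ind]

theorem cnt_nonneg (M : Prof) (A B : End → Bool) : 0 ≤ cnt M A B := by
  have := tot_mono (M := M) (φ := fun _ _ => 0) (ψ := fun a b => ind (A a) * ind (B b))
    fun x _ => mul_nonneg (ind_nonneg _) (ind_nonneg _)
  simpa [tot, cnt] using this

theorem cnt_eq_zero {M : Prof} {A B : End → Bool}
    (h : ∀ x ∈ M, (A x.1 && B x.2) = false) : cnt M A B = 0 := by
  unfold cnt
  rw [tot_congr (ψ := fun _ _ => 0)]
  · simp [tot]
  · intro x hx
    have := h x hx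
    revert this
    cases A x.1 <;> cases B x.2 <;> simp [ind]

/-- No condition on an end. -/
def any (_ : End) : Bool := true

/-- Peaks, and valleys compatible with the cut at `s`. -/
def que (s : ℤ) (e : End) : Bool := pk e || cut s e

/-- The supremum of an integer function. -/
noncomputable def mx (g : ℤ → ℤ) : ℤ := sSup (Set.range g)

theorem mx_spec {g : ℤ → ℤ} (b : ℤ) (h : ∀ z, g z ≤ b) :
    (∃ z, mx g = g z) ∧ ∀ z, g z ≤ mx g := by
  have hb : BddAbove (Set.range g) := ⟨b, by rintro _ ⟨z, rfl⟩; exact h z⟩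
  refine ⟨?_, fun z => le_csSup hb ⟨z, rfl⟩⟩
  obtain ⟨z, hz⟩ := Int.csSup_mem (Set.range_nonempty g) hb
  exact ⟨z, hz.symm⟩

section Counts

variable (M : Prof)

/-- Number of words starting with a peak. -/
def P : ℤ := cnt M pk any

/-- Number of words starting with a valley. -/
def V : ℤ := cnt M vl any

/-- Number of words starting with a peak and ending compatibly with a cut. -/
def p (s : ℤ) : ℤ := cnt M pk (cut s)

/-- Number of words starting with a valley and ending compatibly with a cut. -/
def v (s : ℤ) : ℤ := cnt M vl (cut s)

/-- Maximal number of words ending compatibly with a cut. -/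
noncomputable def K : ℤ := mx fun z => cnt M any (cut z)

/-- Maximal number of words with one end compatible with a given cut, and the other one with
another cut. -/
noncomputable def h (s : ℤ) : ℤ := mx fun z => cnt M (cut s) (cut z)

/-- Maximal number of words with one end satisfying `que s`, the other one compatible with a
cut. -/
noncomputable def a (s : ℤ) : ℤ := mx fun z => cnt M (que s) (cut z)

end Counts

theorem cnt_le_any (M : Prof) (A B : End → Bool) : cnt M A B ≤ cnt M A any :=
  cnt_le fun x _ => by simp +contextual [any]

theorem K_spec (M : Prof) : (∃ z, K M = cnt M any (cut z)) ∧ ∀ z, cnt M any (cut z) ≤ K M :=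
  mx_spec _ fun _ => cnt_le_any _ _ _

theorem h_spec (M : Prof) (s : ℤ) :
    (∃ z, h M s = cnt M (cut s) (cut z)) ∧ ∀ z, cnt M (cut s) (cut z) ≤ h M s :=
  mx_spec _ fun _ => cnt_le_any _ _ _

theorem a_spec (M : Prof) (s : ℤ) :
    (∃ z, a M s = cnt M (que s) (cut z)) ∧ ∀ z, cnt M (que s) (cut z) ≤ a M s :=
  mx_spec _ fun _ => cnt_le_any _ _ _

theorem cnt_pk_add_vl (M : Prof) (B : End → Bool) : cnt M pk B + cnt M vl B = cnt M any B := by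
  refine le_antisymm (add_le_cnt fun x _ => ?_) (cnt_le_add fun x _ => ?_) <;>
  · cases hh : x.1.1 <;> simp [pk, vl, any, hh]

theorem cnt_cut_add_ncut (M : Prof) (A : End → Bool) (z : ℤ) :
    cnt M A (cut z) + cnt M A (ncut z) = cnt M A any := by
  refine le_antisymm (add_le_cnt fun x _ => ?_) (cnt_le_add fun x _ => ?_) <;>
  · cases hh : cut z x.2 <;> cases A x.1 <;> simp [ncut, any, hh]

theorem exists_cut_eq (M : Prof) :
    (∃ z, ∀ x ∈ M, cut z x.2 = pk x.2) ∧ ∃ z, ∀ x ∈ M, cut z x.2 = vl x.2 := by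
  obtain ⟨lo, hi, hb⟩ := exists_bounds (M.map Prod.snd)
  refine ⟨⟨lo, fun x hx => ?_⟩, ⟨hi, fun x hx => ?_⟩⟩ <;>
  · have := hb x.2 (Multiset.mem_map_of_mem _ hx)
    rcases x with ⟨_, ⟨_ | _, y⟩⟩ <;> simp [cut, pk, vl] <;> dsimp only at this <;> omega

theorem exists_cnt_pk (M : Prof) : ∃ z, ∀ A, cnt M A (cut z) = cnt M A pk := by
  obtain ⟨⟨z, hz⟩, -⟩ := exists_cut_eq M
  exact ⟨z, fun A => cnt_eq fun x hx => by rw [hz x hx]⟩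

theorem exists_cnt_vl (M : Prof) : ∃ z, ∀ A, cnt M A (cut z) = cnt M A vl := by
  obtain ⟨-, ⟨z, hz⟩⟩ := exists_cut_eq M
  exact ⟨z, fun A => cnt_eq fun x hx => by rw [hz x hx]⟩

theorem p_add_v (M : Prof) (s : ℤ) : p M s + v M s = cnt M any (cut s) := cnt_pk_add_vl M _

theorem P_add_V (M : Prof) : P M + V M = cnt M any any := cnt_pk_add_vl M _

theorem P0 (M : Prof) : 0 ≤ P M := cnt_nonneg _ _ _
theorem p0 (M : Prof) (s : ℤ) : 0 ≤ p M s := cnt_nonneg _ _ _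
theorem v0 (M : Prof) (s : ℤ) : 0 ≤ v M s := cnt_nonneg _ _ _

theorem kT (M : Prof) : 0 ≤ P M + V M - K M := by
  obtain ⟨⟨z, hz⟩, -⟩ := K_spec M
  rw [P_add_V, hz]
  linarith [cnt_le_any M any (cut z)]

theorem kn (M : Prof) (s : ℤ) : 0 ≤ K M - p M s - v M s := by
  linarith [(K_spec M).2 s, p_add_v M s]

theorem pP (M : Prof) (s : ℤ) : 0 ≤ P M - p M s := sub_nonneg.2 (cnt_le_any _ _ _)

theorem vV (M : Prof) (s : ℤ) : 0 ≤ V M - v M s := sub_nonneg.2 (cnt_le_any _ _ _)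

theorem ak (M : Prof) (s : ℤ) : 0 ≤ K M - a M s := by
  obtain ⟨⟨z, hz⟩, -⟩ := a_spec M s
  have := (K_spec M).2 z
  have e : cnt M (que s) (cut z) ≤ cnt M any (cut z) := cnt_le fun x _ => by
    simp +contextual [any]
  linarith

theorem kh (M : Prof) (s : ℤ) : 0 ≤ K M - h M s := by
  obtain ⟨⟨z, hz⟩, -⟩ := h_spec M s
  have := (K_spec M).2 z
  have e : cnt M (cut s) (cut z) ≤ cnt M any (cut z) := cnt_le fun x _ => by
    simp +contextual [any]
  linarith

variable {M : Prof}

theorem Symm.cnt_pk (hM : Symm M) : cnt M any pk = P M := cnt_symm hM _ _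

theorem Symm.cnt_vl (hM : Symm M) : cnt M any vl = V M := cnt_symm hM _ _

theorem Symm.kP (hM : Symm M) : 0 ≤ K M - P M := by
  obtain ⟨z, hz⟩ := exists_cnt_pk M
  linarith [(K_spec M).2 z, hz any, hM.cnt_pk]

theorem Symm.kV (hM : Symm M) : 0 ≤ K M - V M := by
  obtain ⟨z, hz⟩ := exists_cnt_vl M
  linarith [(K_spec M).2 z, hz any, hM.cnt_vl]

theorem Symm.K0 (hM : Symm M) : 0 ≤ K M := by
  linarith [hM.kP, P0 M]

theorem Symm.hp (hM : Symm M) (s : ℤ) : 0 ≤ h M s - p M s := by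
  obtain ⟨z, hz⟩ := exists_cnt_pk M
  have := cnt_symm hM (cut s) pk
  linarith [(h_spec M s).2 z, hz (cut s), show p M s = cnt M pk (cut s) from rfl]

theorem Symm.hv (hM : Symm M) (s : ℤ) : 0 ≤ h M s - v M s := by
  obtain ⟨z, hz⟩ := exists_cnt_vl M
  have := cnt_symm hM (cut s) vl
  linarith [(h_spec M s).2 z, hz (cut s), show v M s = cnt M vl (cut s) from rfl]

theorem Symm.cnt_cut (hM : Symm M) (s : ℤ) : cnt M (cut s) any = p M s + v M s := by
  rw [p_add_v, cnt_symm hM]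

theorem Symm.hn (hM : Symm M) (s : ℤ) : 0 ≤ p M s + v M s - h M s := by
  obtain ⟨⟨z, hz⟩, -⟩ := h_spec M s
  linarith [hM.cnt_cut s, cnt_le_any M (cut s) (cut z)]

theorem Symm.hk (hM : Symm M) (s : ℤ) : 0 ≤ h M s + P M + V M - p M s - v M s - K M := by
  obtain ⟨⟨z, hz⟩, -⟩ := K_spec M
  have h1 : cnt M any (cut z) ≤ cnt M (cut s) (cut z) + cnt M (ncut s) any :=
    cnt_le_add fun x _ => by cases hh : cut s x.1 <;> simp [ncut, any, hh]
  have h2 := cnt_cut_add_ncut M any s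
  rw [cnt_symm hM any (ncut s)] at h2
  linarith [(h_spec M s).2 z, P_add_V M, p_add_v M s]

/-- Symmetric profiles of words of odd length. -/
structure OddP (M : Prof) : Prop extends Symm M where
  odd : IsOdd M

/-- Symmetric profiles of words of even length. -/
structure EvenP (M : Prof) : Prop extends Symm M where
  even : IsEven M

theorem a_le (M : Prof) (s : ℤ) : a M s ≤ h M s + cnt M (fun e => pk e && ncut s e) any := by
  obtain ⟨⟨z, hz⟩, -⟩ := a_spec M s
  have h1 : cnt M (que s) (cut z) ≤ cnt M (cut s) (cut z) +
      cnt M (fun e => pk e && ncut s e) any :=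
    cnt_le_add fun x _ => by cases hh : cut s x.1 <;> simp +contextual [ncut, que, any, hh]
  linarith [(h_spec M s).2 z]

theorem pk_cut_add (M : Prof) (s : ℤ) : cnt M (fun e => pk e && cut s e) any +
    cnt M (fun e => pk e && ncut s e) any = P M := by
  refine le_antisymm (add_le_cnt fun x _ => ?_) (cnt_le_add fun x _ => ?_) <;>
  · cases hh : cut s x.1 <;> cases pk x.1 <;> simp [ncut, any, hh]

theorem cnt_que (M : Prof) (s : ℤ) :
    cnt M (que s) any = P M + cnt M (fun e => vl e && cut s e) any := by
  refine le_antisymm (cnt_le_add fun x _ => ?_) (add_le_cnt fun x _ => ?_) <;>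
  · cases hh : cut s x.1 <;> cases h2 : x.1.1 <;> simp [que, any, pk, vl, hh, h2]

namespace OddP

theorem cnt_pk_cut (hM : OddP M) (s : ℤ) : cnt M (fun e => pk e && cut s e) any = p M s := by
  rw [p, cnt_symm hM.toSymm]
  exact cnt_eq fun x hx => by simp [pk, any, hM.odd x hx]

theorem cnt_vl_cut (hM : OddP M) (s : ℤ) : cnt M (fun e => vl e && cut s e) any = v M s := by
  rw [v, cnt_symm hM.toSymm]
  exact cnt_eq fun x hx => by simp [vl, any, hM.odd x hx]

theorem aP (hM : OddP M) (s : ℤ) : 0 ≤ a M s - P M := by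
  obtain ⟨z, hz⟩ := exists_cnt_pk M
  have : P M ≤ cnt M (que s) pk :=
    cnt_le fun x hx => by simp +contextual [pk, que, any, hM.odd x hx]
  linarith [(a_spec M s).2 z, hz (que s)]

theorem av (hM : OddP M) (s : ℤ) : 0 ≤ a M s - v M s := by
  obtain ⟨z, hz⟩ := exists_cnt_vl M
  have : cnt M (cut s) vl ≤ cnt M (que s) vl :=
    cnt_le fun x hx => by simp +contextual [que]
  rw [cnt_symm hM.toSymm] at this
  linarith [(a_spec M s).2 z, hz (que s), show v M s = cnt M vl (cut s) from rfl]

theorem ah (hM : OddP M) (s : ℤ) : 0 ≤ h M s + P M - p M s - a M s := by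
  linarith [a_le M s, pk_cut_add M s, hM.cnt_pk_cut s]

theorem an (hM : OddP M) (s : ℤ) : 0 ≤ P M + v M s - a M s := by
  obtain ⟨⟨z, hz⟩, -⟩ := a_spec M s
  linarith [cnt_que M s, hM.cnt_vl_cut s, cnt_le_any M (que s) (cut z)]

end OddP

namespace EvenP

theorem fst_eq (hM : EvenP M) {x : End × End} (hx : x ∈ M) : x.1.1 = !x.2.1 :=
  Bool.eq_not.2 (hM.even x hx)

theorem cnt_pk_cut (hM : EvenP M) (s : ℤ) : cnt M (fun e => pk e && cut s e) any = v M s := by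
  rw [v, cnt_symm hM.toSymm]
  exact cnt_eq fun x hx => by simp [pk, vl, any, hM.fst_eq hx]

theorem cnt_vl_cut (hM : EvenP M) (s : ℤ) : cnt M (fun e => vl e && cut s e) any = p M s := by
  rw [p, cnt_symm hM.toSymm]
  exact cnt_eq fun x hx => by simp [pk, vl, any, hM.fst_eq hx]

theorem vP (hM : EvenP M) : V M = P M := by
  rw [← hM.cnt_vl]
  exact cnt_eq fun x hx => by simp [pk, vl, any, hM.fst_eq hx]

theorem aP (hM : EvenP M) (s : ℤ) : 0 ≤ a M s - P M := by
  obtain ⟨z, hz⟩ := exists_cnt_vl M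
  have : P M ≤ cnt M (que s) vl :=
    cnt_le fun x hx => by simp +contextual [pk, vl, que, any, hM.fst_eq hx]
  linarith [(a_spec M s).2 z, hz (que s)]

theorem ah (hM : EvenP M) (s : ℤ) : 0 ≤ h M s + P M - v M s - a M s := by
  linarith [a_le M s, pk_cut_add M s, hM.cnt_pk_cut s]

theorem an (hM : EvenP M) (s : ℤ) : 0 ≤ P M + p M s - a M s := by
  obtain ⟨⟨z, hz⟩, -⟩ := a_spec M s
  linarith [cnt_que M s, hM.cnt_vl_cut s, cnt_le_any M (que s) (cut z)]

end EvenP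

variable {X Y : Prof}

theorem cnt_join_le_zero (X Y : Prof) (A B : End → Bool) :
    cnt (join X Y) A B ≤ cnt X A pk * cnt Y vl B + cnt X A vl * cnt Y pk B := by
  have := cnt_join_le X Y A B (d := 0) (d' := 0) le_rfl (fun z => cnt_nonneg _ _ _)
    (fun z => cnt_nonneg _ _ _)
  linarith

section Deficiency

theorem def_any (M : Prof) (z : ℤ) : P M + V M - K M ≤ cnt M any (ncut z) := by
  linarith [(K_spec M).2 z, P_add_V M, cnt_cut_add_ncut M any z]

theorem def_cut {M : Prof} (hM : Symm M) (s z : ℤ) :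
    p M s + v M s - h M s ≤ cnt M (cut s) (ncut z) := by
  linarith [(h_spec M s).2 z, hM.cnt_cut s, cnt_cut_add_ncut M (cut s) z]

theorem OddP.def_que {M : Prof} (hM : OddP M) (s z : ℤ) :
    P M + v M s - a M s ≤ cnt M (que s) (ncut z) := by
  linarith [(a_spec M s).2 z, cnt_que M s, hM.cnt_vl_cut s, cnt_cut_add_ncut M (que s) z]

theorem EvenP.def_que {M : Prof} (hM : EvenP M) (s z : ℤ) :
    P M + p M s - a M s ≤ cnt M (que s) (ncut z) := by
  linarith [(a_spec M s).2 z, cnt_que M s, hM.cnt_vl_cut s, cnt_cut_add_ncut M (que s) z]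

end Deficiency

theorem join_any_le (hX : Symm X) (hY : Symm Y) : cnt (join X Y) any any ≤
    P X * V Y + V X * P Y - (P X + V X - K X) * (P Y + V Y - K Y) := by
  have := cnt_join_le X Y any any (kT X) (def_any X)
    (fun z => (def_any Y z).trans_eq (cnt_symm hY _ _))
  rw [hX.cnt_pk, hX.cnt_vl] at this
  exact le_sub_iff_add_le.2 this

theorem join_any_cut_le (hX : Symm X) (hY : Symm Y) (s : ℤ) : cnt (join X Y) any (cut s) ≤
    P X * v Y s + V X * p Y s - (P X + V X - K X) * (p Y s + v Y s - h Y s) := by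
  have := cnt_join_le X Y any (cut s) (kT X) (def_any X)
    (fun z => (def_cut hY s z).trans_eq (cnt_symm hY _ _))
  rw [hX.cnt_pk, hX.cnt_vl] at this
  exact le_sub_iff_add_le.2 this

theorem join_swap (hX : Symm X) (hY : Symm Y) (A B : End → Bool) :
    cnt (join X Y) A B = cnt (join Y X) B A := by
  unfold cnt
  rw [tot_join_swap hX hY]
  simp only [mul_comm]

theorem merge_N_le (hX : Symm X) (hY : Symm Y) (s : ℤ) :
    p (merge X Y) s + v (merge X Y) s ≤
      P X * v Y s + V X * p Y s - (P X + V X - K X) * (p Y s + v Y s - h Y s) +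
      (P Y * v X s + V Y * p X s - (P Y + V Y - K Y) * (p X s + v X s - h X s)) := by
  rw [p_add_v, cnt_merge hX hY, join_swap hX hY (cut s)]
  exact add_le_add (join_any_cut_le hX hY s) (join_any_cut_le hY hX s)

theorem join_cut_le (hX : Symm X) (hY : Symm Y) (s t : ℤ) : cnt (join X Y) (cut s) (cut t) ≤
    p X s * v Y t + v X s * p Y t - (p X s + v X s - h X s) * (p Y t + v Y t - h Y t) := by
  have := cnt_join_le X Y (cut s) (cut t) (hX.hn s) (def_cut hX s)
    (fun z => (def_cut hY t z).trans_eq (cnt_symm hY _ _))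
  rw [cnt_symm hX _ pk, cnt_symm hX _ vl] at this
  exact le_sub_iff_add_le.2 this

theorem merge_H_le (hX : Symm X) (hY : Symm Y) (s t : ℤ) :
    cnt (merge X Y) (cut s) (cut t) ≤
      p X s * v Y t + v X s * p Y t - (p X s + v X s - h X s) * (p Y t + v Y t - h Y t) +
      (p X t * v Y s + v X t * p Y s - (p X t + v X t - h X t) * (p Y s + v Y s - h Y s)) := by
  rw [cnt_merge hX hY]
  exact add_le_add (join_cut_le hX hY s t) (join_cut_le hX hY t s)

theorem merge_PV_le (hX : Symm X) (hY : Symm Y) : P (merge X Y) + V (merge X Y) ≤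
    2 * (P X * V Y + V X * P Y - (P X + V X - K X) * (P Y + V Y - K Y)) := by
  rw [P_add_V, cnt_merge hX hY]
  linarith [join_any_le hX hY]

theorem merge_P_even_le (hX : Symm X) (hY : Symm Y) (hT : EvenP (merge X Y)) :
    P (merge X Y) ≤ P X * V Y + V X * P Y - (P X + V X - K X) * (P Y + V Y - K Y) := by
  linarith [merge_PV_le hX hY, hT.vP]

theorem mem_merge_left {z : End × End} (hz : z ∈ join X Y) : z ∈ merge X Y :=
  Multiset.mem_add.2 (Or.inl hz)

theorem OddP.merge_even (hX : OddP X) (hY : EvenP Y) : OddP (merge X Y) :=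
  ⟨symm_merge hX.toSymm hY.toSymm, hX.odd.merge_even hY.even⟩

theorem OddP.merge_odd (hX : OddP X) (hY : OddP Y) : EvenP (merge X Y) :=
  ⟨symm_merge hX.toSymm hY.toSymm, hX.odd.merge_odd hY.odd⟩

theorem EvenP.merge_even (hX : EvenP X) (hY : EvenP Y) : EvenP (merge X Y) :=
  ⟨symm_merge hX.toSymm hY.toSymm, hX.even.merge_even hY.even⟩

theorem OddP.cnt_pk_pk (hX : OddP X) : cnt X pk pk = P X :=
  cnt_eq fun x hx => by simp [pk, any, hX.odd x hx]

theorem OddP.cnt_pk_vl (hX : OddP X) : cnt X pk vl = 0 :=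
  cnt_eq_zero fun x hx => by simp [pk, vl, hX.odd x hx]

theorem EvenP.cnt_vl_pk (hX : EvenP X) : cnt X vl pk = P X := by
  rw [← hX.cnt_pk]
  exact cnt_eq fun x hx => by simp [pk, vl, any, hX.fst_eq hx]

theorem EvenP.cnt_pk_pk (hX : EvenP X) : cnt X pk pk = 0 :=
  cnt_eq_zero fun x hx => by simp [pk, hX.fst_eq hx]

theorem merge_P_odd_le (hX : OddP X) (hY : EvenP Y) : P (merge X Y) ≤ 2 * (P X * P Y) := by
  rw [← (hX.merge_even hY).cnt_pk_pk, cnt_merge hX.toSymm hY.toSymm]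
  have := cnt_join_le_zero X Y pk pk
  rw [hX.cnt_pk_pk, hX.cnt_pk_vl, hY.cnt_vl_pk] at this
  linarith

theorem merge_p_odd_le (hX : OddP X) (hY : EvenP Y) (s : ℤ) :
    p (merge X Y) s ≤ P X * v Y s + p X s * P Y := by
  rw [p, cnt_merge hX.toSymm hY.toSymm]
  have h1 := cnt_join_le_zero X Y pk (cut s)
  have h2 := cnt_join_le_zero X Y (cut s) pk
  rw [hX.cnt_pk_pk, hX.cnt_pk_vl] at h1
  rw [hY.cnt_vl_pk, hY.cnt_pk_pk, cnt_symm hX.toSymm] at h2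
  have e1 : v Y s = cnt Y vl (cut s) := rfl
  have e2 : p X s = cnt X pk (cut s) := rfl
  rw [e1, e2]
  linarith

theorem EvenP.p_eq {T : Prof} (hT : IsEven T) (s : ℤ) :
    cnt T pk (cut s) + cnt T (cut s) pk = cnt T (que s) (que s) := by
  refine le_antisymm (add_le_cnt fun x hx => ?_) (cnt_le_add fun x hx => ?_) <;>
  · have := hT x hx
    cases h1 : x.1.1 <;> cases h2 : x.2.1 <;> simp_all [pk, que]

theorem OddP.que_pk (hX : OddP X) (s : ℤ) : cnt X (que s) pk = P X := by
  rw [← hX.cnt_pk]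
  exact cnt_eq fun x hx => by simp +contextual [pk, any, que, hX.odd x hx]

theorem OddP.que_vl (hX : OddP X) (s : ℤ) : cnt X (que s) vl = v X s := by
  rw [v, cnt_symm hX.toSymm vl]
  refine cnt_eq fun x hx => ?_
  have := hX.odd x hx
  cases h1 : x.2.1 <;> simp_all [vl, pk, que]

theorem EvenP.que_pk (hX : EvenP X) (s : ℤ) : cnt X (que s) pk = p X s := by
  rw [p, cnt_symm hX.toSymm pk]
  refine cnt_eq fun x hx => ?_
  have := hX.fst_eq hx
  cases h1 : x.2.1 <;> simp_all [pk, que]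

theorem EvenP.que_vl (hX : EvenP X) (s : ℤ) : cnt X (que s) vl = P X := by
  refine cnt_eq fun x hx => ?_
  have := hX.fst_eq hx
  cases h1 : x.2.1 <;> simp_all [vl, pk, que, any]

theorem join_isEven {X Y : Prof} (h : IsEven (merge X Y)) : IsEven (join X Y) :=
  fun x hx => h x (mem_merge_left hx)

theorem merge_p_odd_odd_le (hX : OddP X) (hY : OddP Y) (s : ℤ) :
    p (merge X Y) s ≤
      P X * v Y s + v X s * P Y - (P X + v X s - a X s) * (P Y + v Y s - a Y s) := by
  rw [p, cnt_merge hX.toSymm hY.toSymm, EvenP.p_eq (join_isEven (hX.merge_odd hY).even)]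
  have := cnt_join_le X Y (que s) (que s) (hX.an s) (hX.def_que s)
    (fun z => (hY.def_que s z).trans_eq (cnt_symm hY.toSymm _ _))
  rw [cnt_symm hY.toSymm vl, cnt_symm hY.toSymm pk, hX.que_pk, hX.que_vl, hY.que_pk,
    hY.que_vl] at this
  exact le_sub_iff_add_le.2 this

theorem merge_p_even_even_le (hX : EvenP X) (hY : EvenP Y) (s : ℤ) :
    p (merge X Y) s ≤
      p X s * P Y + P X * p Y s - (P X + p X s - a X s) * (P Y + p Y s - a Y s) := by
  rw [p, cnt_merge hX.toSymm hY.toSymm, EvenP.p_eq (join_isEven (hX.merge_even hY).even)]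
  have := cnt_join_le X Y (que s) (que s) (hX.an s) (hX.def_que s)
    (fun z => (hY.def_que s z).trans_eq (cnt_symm hY.toSymm _ _))
  rw [cnt_symm hY.toSymm vl, cnt_symm hY.toSymm pk, hX.que_pk, hX.que_vl, hY.que_pk,
    hY.que_vl] at this
  exact le_sub_iff_add_le.2 this

/-- Valleys compatible with the cut at `s`. -/
def vcut (s : ℤ) (e : End) : Bool := vl e && cut s e

/-- Number of words with both ends valleys compatible with given cuts. -/
def B (M : Prof) (s t : ℤ) : ℤ := cnt M (vcut s) (vcut t)

/-- Peaks compatible with the cut at `s` and valleys compatible with the cut at `t`. -/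
def pvcut (s t : ℤ) (e : End) : Bool := bif pk e then cut s e else cut t e

theorem cut_le_pvcut {s t : ℤ} (hst : s ≤ t) (e : End) (he : cut t e = true) :
    pvcut s t e = true := by
  rcases e with ⟨_ | _, x⟩ <;> simp [cut, pvcut, pk] at he ⊢ <;> omega

theorem pvcut_eq {T : Prof} (hT : IsOdd T) (s t : ℤ) :
    cnt T pk (cut s) + cnt T (vcut s) (vcut t) = cnt T (que s) (pvcut s t) := by
  refine le_antisymm (add_le_cnt fun x hx => ?_) (cnt_le_add fun x hx => ?_) <;>
  · have := hT x hx
    cases h1 : x.1.1 <;> cases h2 : x.2.1 <;> simp_all [pk, vl, vcut, que, pvcut]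

theorem merge_pB_le (hX : OddP X) (hY : EvenP Y) {i j : ℤ} (hij : i ≤ j) :
    p (merge X Y) i + B (merge X Y) i j ≤
      P X * v Y i + v X i * p Y j - (P X + v X i - a X i) * (p Y j + v Y j - h Y j) +
      (p X i * P Y + v X j * p Y i - (p X j + v X j - h X j) * (P Y + p Y i - a Y i)) := by
  have hO : IsOdd (merge X Y) := (hX.merge_even hY).odd
  have e1 := pvcut_eq (T := join X Y) (fun x hx => hO x (mem_merge_left hx)) i j
  have e2 := pvcut_eq (T := join Y X) (fun x hx => hO x (Multiset.mem_add.2 (Or.inr hx))) i j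
  rw [← join_swap hX.toSymm hY.toSymm, ← join_swap hX.toSymm hY.toSymm,
    ← join_swap hX.toSymm hY.toSymm] at e2
  have b1 := cnt_join_le X Y (que i) (pvcut i j) (hX.an i) (hX.def_que i)
    (fun z => ((def_cut hY.toSymm j z).trans_eq (cnt_symm hY.toSymm _ _)).trans
      (cnt_le (A' := ncut z) (B' := pvcut i j) fun x _ => by
        simp +contextual [cut_le_pvcut hij x.2]))
  have b2 := cnt_join_le X Y (pvcut i j) (que i) (hX.hn j)
    (fun z => (def_cut hX.toSymm j z).trans
      (cnt_le (A' := pvcut i j) (B' := ncut z) fun x _ => by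
        simp +contextual [cut_le_pvcut hij x.1]))
    (fun z => (hY.def_que i z).trans_eq (cnt_symm hY.toSymm _ _))
  have c1 : cnt Y vl (pvcut i j) = v Y i := cnt_eq fun x hx => by
    have := hY.fst_eq hx
    cases h1 : x.2.1 <;> simp_all [vl, pvcut, pk]
  have c2 : cnt Y pk (pvcut i j) = p Y j := cnt_eq fun x hx => by
    have := hY.fst_eq hx
    cases h1 : x.2.1 <;> simp_all [pvcut, pk]
  have c3 : cnt X (pvcut i j) pk = p X i := by
    rw [cnt_symm hX.toSymm]
    exact cnt_eq fun x hx => by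
      have := hX.odd x hx
      cases h1 : x.2.1 <;> simp_all [pvcut, pk]
  have c4 : cnt X (pvcut i j) vl = v X j := by
    rw [cnt_symm hX.toSymm]
    exact cnt_eq fun x hx => by
      have := hX.odd x hx
      cases h1 : x.2.1 <;> simp_all [pvcut, vl, pk]
  rw [hX.que_pk, hX.que_vl, c1, c2] at b1
  rw [c3, c4, cnt_symm hY.toSymm vl, cnt_symm hY.toSymm pk, hY.que_vl, hY.que_pk] at b2
  rw [p, B, cnt_merge hX.toSymm hY.toSymm, cnt_merge hX.toSymm hY.toSymm]
  linarith

/-- Change of sign of the heights, which exchanges peaks and valleys. -/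
def nege (e : End) : End := (!e.1, -e.2)

/-- Change of sign of all heights in a profile. -/
def neg (M : Prof) : Prof := M.map fun x => (nege x.1, nege x.2)

theorem nege_nege (e : End) : nege (nege e) = e := by
  rcases e with ⟨t, x⟩; simp [nege]

theorem neg_neg_prof (M : Prof) : neg (neg M) = M := by
  simp [neg, nege_nege]

theorem compat_nege (a b : End) : compat (nege a) (nege b) = compat a b := by
  rcases a with ⟨_ | _, x⟩ <;> rcases b with ⟨_ | _, y⟩ <;> simp [compat, nege]

theorem neg_join (X Y : Prof) : neg (join X Y) = join (neg X) (neg Y) := by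
  unfold neg join
  rw [Multiset.map_bind, Multiset.bind_map]
  refine Multiset.bind_congr fun x _ => ?_
  rw [Multiset.map_map, Multiset.filter_map, Multiset.map_map]
  simp only [Function.comp_def, compat_nege]

theorem neg_merge (X Y : Prof) : neg (merge X Y) = merge (neg X) (neg Y) := by
  unfold merge
  rw [← neg_join, ← neg_join]
  exact Multiset.map_add _ _ _

theorem tot_neg (M : Prof) (φ : End → End → ℤ) :
    tot (neg M) φ = tot M fun a b => φ (nege a) (nege b) := by
  simp [tot, neg, Multiset.map_map]

theorem cnt_neg (M : Prof) (A B : End → Bool) :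
    cnt (neg M) A B = cnt M (fun e => A (nege e)) fun e => B (nege e) := tot_neg _ _

theorem Symm.neg {M : Prof} (hM : Symm M) : Symm (neg M) :=
  ⟨fun φ => by rw [tot_neg, tot_neg, hM.tot_eq]⟩

theorem OddP.neg {M : Prof} (hM : OddP M) : OddP (neg M) where
  toSymm := hM.toSymm.neg
  odd := by
    intro x hx
    obtain ⟨y, hy, rfl⟩ := Multiset.mem_map.1 hx
    simp [nege, hM.odd y hy]

theorem EvenP.neg {M : Prof} (hM : EvenP M) : EvenP (neg M) where
  toSymm := hM.toSymm.neg
  even := by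
    intro x hx
    obtain ⟨y, hy, rfl⟩ := Multiset.mem_map.1 hx
    simp [nege, hM.fst_eq hy]

theorem pk_nege (e : End) : pk (nege e) = vl e := rfl

theorem vl_nege (e : End) : vl (nege e) = pk e := by simp [vl, pk, nege]

theorem cut_nege (s : ℤ) (e : End) : cut s (nege e) = cut (-s - 1) e := by
  rcases e with ⟨_ | _, x⟩ <;> simp only [cut, nege, Bool.not_true, Bool.not_false, cond_true,
    cond_false, decide_eq_decide] <;> omega

theorem P_neg (M : Prof) : P (neg M) = V M := cnt_neg _ _ _

theorem V_neg (M : Prof) : V (neg M) = P M := by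
  simp only [V, P, cnt_neg, vl_nege]; rfl

theorem p_neg (M : Prof) (s : ℤ) : p (neg M) s = v M (-s - 1) := by
  simp only [p, v, cnt_neg, cut_nege, pk_nege]

theorem v_neg (M : Prof) (s : ℤ) : v (neg M) s = p M (-s - 1) := by
  simp only [p, v, cnt_neg, cut_nege, vl_nege]

theorem mx_reflect (g : ℤ → ℤ) : mx (fun z => g (-z - 1)) = mx g := by
  unfold mx
  have : Function.Surjective fun z : ℤ => -z - 1 := fun z => ⟨-z - 1, by ring⟩
  rw [← this.range_comp g]
  rfl

theorem K_neg (M : Prof) : K (neg M) = K M := by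
  simp only [K, cnt_neg, cut_nege]
  exact mx_reflect fun z => cnt M any (cut z)

theorem h_neg (M : Prof) (s : ℤ) : h (neg M) s = h M (-s - 1) := by
  simp only [h, cnt_neg, cut_nege]
  exact mx_reflect fun z => cnt M (cut (-s - 1)) (cut z)

theorem EvenP.kT {M : Prof} (hM : EvenP M) : 0 ≤ 2 * P M - K M := by
  linarith [Profile.kT M, hM.vP]

theorem EvenP.vV {M : Prof} (hM : EvenP M) (s : ℤ) : 0 ≤ P M - v M s := by
  linarith [Profile.vV M s, hM.vP]

theorem EvenP.hk {M : Prof} (hM : EvenP M) (s : ℤ) :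
    0 ≤ h M s + 2 * P M - p M s - v M s - K M := by
  linarith [hM.toSymm.hk s, hM.vP]

/-- Estimates for profiles of trees with `4 * q + 3` leaves. -/
structure BoundOO (u : ℤ) (M : Prof) : Prop where
  gP : 0 ≤ 7 * u - 3 * P M
  gPV : 0 ≤ 8 * u - 3 * P M - V M
  gK : 0 ≤ 3 * u - K M
  gPH : ∀ s, 0 ≤ 7 * u - 2 * P M - h M s
  gPKH : ∀ s, 0 ≤ 12 * u - 2 * P M - 2 * K M - h M s
  gpHB : ∀ s t, s ≤ t → 0 ≤ 7 * u - 2 * p M s - cnt M (cut s) (cut t) - B M s t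

/-- Estimates for profiles of trees with `4 * q + 5` leaves. -/
structure BoundOE (u : ℤ) (M : Prof) : Prop where
  gP : 0 ≤ 6 * u - P M
  gPV : 0 ≤ 14 * u - 2 * P M - V M
  gK : 0 ≤ 7 * u - K M
  gPK : 0 ≤ 12 * u - P M - K M
  gpvh : ∀ s, 0 ≤ 24 * u - 3 * p M s - 2 * v M s - h M s

/-- Estimates for profiles of trees with `4 * q + 2` leaves. -/
structure BoundEO (u : ℤ) (M : Prof) : Prop where
  gP : 0 ≤ 7 * u - 6 * P M
  gPK : 0 ≤ 4 * u - 2 * P M - K M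
  gph : ∀ s, 0 ≤ 6 * u - 4 * p M s - h M s

/-- Estimates for profiles of trees with `4 * q + 4` leaves. -/
structure BoundEE (u : ℤ) (M : Prof) : Prop where
  gP : 0 ≤ 3 * u - P M
  gpv : ∀ s, 0 ≤ 7 * u - 2 * p M s - v M s
  gPph : ∀ s, 0 ≤ 12 * u - 2 * P M - p M s - h M s

/-- Two-sided estimates for profiles of trees with `4 * q + 3` leaves. -/
structure OO (u : ℤ) (M : Prof) : Prop extends OddP M, BoundOO u M where
  u0 : 0 ≤ u
  bneg : BoundOO u (neg M)

/-- Two-sided estimates for profiles of trees with `4 * q + 5` leaves. -/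
structure OE (u : ℤ) (M : Prof) : Prop extends OddP M, BoundOE u M where
  u0 : 0 ≤ u
  bneg : BoundOE u (neg M)

/-- Two-sided estimates for profiles of trees with `4 * q + 2` leaves. -/
structure EO (u : ℤ) (M : Prof) : Prop extends EvenP M, BoundEO u M where
  u0 : 0 ≤ u
  bneg : BoundEO u (neg M)

/-- Two-sided estimates for profiles of trees with `4 * q + 4` leaves. -/
structure EE (u : ℤ) (M : Prof) : Prop extends EvenP M, BoundEE u M where
  u0 : 0 ≤ u
  bneg : BoundEE u (neg M)

section Reflection

variable {u : ℤ} {M : Prof}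

theorem OO.neg (L : OO u M) : OO u (neg M) :=
  ⟨L.toOddP.neg, L.bneg, L.u0, by rw [neg_neg_prof]; exact L.toBoundOO⟩

theorem OE.neg (L : OE u M) : OE u (Profile.neg M) :=
  ⟨L.toOddP.neg, L.bneg, L.u0, by rw [neg_neg_prof]; exact L.toBoundOE⟩

theorem EO.neg (L : EO u M) : EO u (Profile.neg M) :=
  ⟨L.toEvenP.neg, L.bneg, L.u0, by rw [neg_neg_prof]; exact L.toBoundEO⟩

theorem EE.neg (L : EE u M) : EE u (Profile.neg M) :=
  ⟨L.toEvenP.neg, L.bneg, L.u0, by rw [neg_neg_prof]; exact L.toBoundEE⟩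

theorem OO.gP' (L : OO u M) : 0 ≤ 7 * u - 3 * V M := by
  simpa only [P_neg] using L.bneg.gP

theorem OO.gPV' (L : OO u M) : 0 ≤ 8 * u - 3 * V M - P M := by
  simpa only [P_neg, V_neg] using L.bneg.gPV

theorem OO.gPH' (L : OO u M) (s : ℤ) : 0 ≤ 7 * u - 2 * V M - h M s := by
  simpa only [P_neg, h_neg, neg_sub, sub_neg_eq_add, add_sub_cancel_left] using
    L.bneg.gPH (-s - 1)

theorem OO.gPKH' (L : OO u M) (s : ℤ) : 0 ≤ 12 * u - 2 * V M - 2 * K M - h M s := by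
  simpa only [P_neg, h_neg, K_neg, neg_sub, sub_neg_eq_add, add_sub_cancel_left] using
    L.bneg.gPKH (-s - 1)

theorem OE.gP' (L : OE u M) : 0 ≤ 6 * u - V M := by
  simpa only [P_neg] using L.bneg.gP

theorem OE.gPV' (L : OE u M) : 0 ≤ 14 * u - 2 * V M - P M := by
  simpa only [P_neg, V_neg] using L.bneg.gPV

theorem OE.gPK' (L : OE u M) : 0 ≤ 12 * u - V M - K M := by
  simpa only [P_neg, K_neg] using L.bneg.gPK

theorem OE.gpvh' (L : OE u M) (s : ℤ) : 0 ≤ 24 * u - 3 * v M s - 2 * p M s - h M s := by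
  simpa only [p_neg, v_neg, h_neg, neg_sub, sub_neg_eq_add, add_sub_cancel_left] using
    L.bneg.gpvh (-s - 1)

theorem EO.gph' (L : EO u M) (s : ℤ) : 0 ≤ 6 * u - 4 * v M s - h M s := by
  simpa only [p_neg, h_neg, neg_sub, sub_neg_eq_add, add_sub_cancel_left] using
    L.bneg.gph (-s - 1)

theorem EE.gpv' (L : EE u M) (s : ℤ) : 0 ≤ 7 * u - 2 * v M s - p M s := by
  simpa only [p_neg, v_neg, neg_sub, sub_neg_eq_add, add_sub_cancel_left] using
    L.bneg.gpv (-s - 1)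

theorem EE.gPph' (L : EE u M) (s : ℤ) : 0 ≤ 12 * u - 2 * P M - v M s - h M s := by
  simpa only [P_neg, L.vP, p_neg, h_neg, neg_sub, sub_neg_eq_add, add_sub_cancel_left] using
    L.bneg.gPph (-s - 1)

end Reflection

theorem nonneg_of_mul {d x : ℤ} (hd : 0 < d) (h : 0 ≤ d * x) : 0 ≤ x :=
  nonneg_of_mul_nonneg_right h hd

theorem merge_K_le {X Y : Prof} (hX : Symm X) (hY : Symm Y) : ∃ s, K (merge X Y) ≤
    P X * v Y s + V X * p Y s - (P X + V X - K X) * (p Y s + v Y s - h Y s) +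
    (P Y * v X s + V Y * p X s - (P Y + V Y - K Y) * (p X s + v X s - h X s)) := by
  obtain ⟨⟨s, hs⟩, -⟩ := K_spec (merge X Y)
  exact ⟨s, by rw [hs, ← p_add_v]; exact merge_N_le hX hY s⟩

theorem merge_h_le {X Y : Prof} (hX : Symm X) (hY : Symm Y) (s : ℤ) : ∃ t, h (merge X Y) s ≤
    p X s * v Y t + v X s * p Y t - (p X s + v X s - h X s) * (p Y t + v Y t - h Y t) +
    (p X t * v Y s + v X t * p Y s - (p X t + v X t - h X t) * (p Y s + v Y s - h Y s)) := by
  obtain ⟨⟨t, ht⟩, -⟩ := h_spec (merge X Y) s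
  exact ⟨t, by rw [ht]; exact merge_H_le hX hY s t⟩

variable {u w : ℤ} {X Y : Prof}

theorem OO.merge_EO_gP (L : OO u X) (R : EO w Y) :
    0 ≤ 6 * (u * w) - P (merge X Y) := by
  have b1 := merge_P_odd_le L.toOddP R.toEvenP
  refine nonneg_of_mul (d := 9) (by norm_num) ?_
  linear_combination
    9 * b1 + 7 * mul_nonneg L.u0 R.gP + 6 * mul_nonneg L.gP R.kP + 6 * mul_nonneg L.gP R.kT +
    5 * mul_nonneg L.u0 R.u0

theorem OO.merge_EO_gPV (L : OO u X) (R : EO w Y) :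
    0 ≤ 14 * (u * w) - 2 * P (merge X Y) - V (merge X Y) := by
  have b1 := merge_PV_le L.toSymm R.toSymm
  rw [R.vP] at b1
  have b2 := merge_P_odd_le L.toOddP R.toEvenP
  refine nonneg_of_mul (d := 3) (by norm_num) ?_
  linear_combination
    3 * b1 + 3 * b2 + 2 * mul_nonneg L.gK R.kP + 3 * mul_nonneg L.u0 R.gP +
    3 * mul_nonneg (kT X) R.kT + 3 * mul_nonneg L.gPV R.kT + 4 * mul_nonneg L.gPV R.kP +
    3 * mul_nonneg L.gK R.kT + 2 * mul_nonneg L.kV R.kP + 5 * mul_nonneg L.u0 R.gPK +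
    mul_nonneg L.u0 R.u0

theorem OO.merge_EO_gK (L : OO u X) (R : EO w Y) :
    0 ≤ 7 * (u * w) - K (merge X Y) := by
  obtain ⟨i, b1⟩ := merge_K_le L.toSymm R.toSymm
  rw [R.vP] at b1
  refine nonneg_of_mul (d := 8) (by norm_num) ?_
  linear_combination
    8 * b1 + 14 * mul_nonneg L.u0 R.gPK + 2 * mul_nonneg (L.hk i) (R.hv i) +
    2 * mul_nonneg (L.gPKH' i) (R.hn i) + mul_nonneg (L.gPKH' i) (R.vV i) +
    mul_nonneg (L.gPKH i) (pP Y i) + 4 * mul_nonneg (L.hk i) (R.hn i) +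
    mul_nonneg (L.gPKH i) (R.hp i) + 2 * mul_nonneg (L.gPKH i) (R.hn i) +
    8 * mul_nonneg (L.hn i) (R.hk i) + 2 * mul_nonneg L.u0 (R.vV i) +
    2 * mul_nonneg (L.hk i) (pP Y i) + 14 * mul_nonneg L.u0 (kn Y i) +
    mul_nonneg (L.gPKH' i) (R.hv i) + 2 * mul_nonneg L.gPV' (R.hv i) +
    2 * mul_nonneg L.u0 (pP Y i) +
    8 * mul_nonneg (L.hn i) (R.hn i) + 8 * mul_nonneg L.u0 (R.hn i) +
    2 * mul_nonneg L.gPV (R.hp i) +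
    6 * mul_nonneg (kn X i) (pP Y i) + 4 * mul_nonneg (kn X i) (R.hn i) +
    6 * mul_nonneg (kn X i) (R.hv i)

theorem OO.merge_EO_gPK (L : OO u X) (R : EO w Y) :
    0 ≤ 12 * (u * w) - P (merge X Y) - K (merge X Y) := by
  have b1 := merge_P_odd_le L.toOddP R.toEvenP
  obtain ⟨i, b2⟩ := merge_K_le L.toSymm R.toSymm
  rw [R.vP] at b2
  refine nonneg_of_mul (d := 95190) (by norm_num) ?_
  linear_combination
    95190 * b1 + 95190 * b2 + 31203 * mul_nonneg L.gPV R.kP + 19002 * mul_nonneg (L.gPKH i) R.K0 +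
    33915 * mul_nonneg (vV X i) (kn Y i) + 33915 * mul_nonneg L.gPV (v0 Y i) +
    12470 * mul_nonneg (L.gPKH i) (kn Y i) + 21658 * mul_nonneg (L.gPKH i) R.gPK +
    36892 * mul_nonneg (L.hv i) R.gP + 43316 * mul_nonneg (vV X i) R.gPK +
    33958 * mul_nonneg (kn X i) (R.hk i) + 22610 * mul_nonneg (kn X i) (v0 Y i) +
    10140 * mul_nonneg (L.gPKH i) (R.vV i) + 18650 * mul_nonneg (pP X i) (R.hn i) +
    45924 * mul_nonneg L.gPV (R.hk i) + 30616 * mul_nonneg (L.gPKH i) (R.hn i) +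
    24535 * mul_nonneg (pP X i) R.gPK + 15308 * mul_nonneg (L.hn i) (R.hn i) +
    38665 * mul_nonneg (pP X i) (R.vV i) + 38665 * mul_nonneg (p0 X i) (R.vV i) +
    49266 * mul_nonneg (vV X i) (R.hn i) + 24752 * mul_nonneg L.kV R.gP +
    83885 * mul_nonneg (L.hn i) (pP Y i) + 14508 * mul_nonneg L.u0 R.gP +
    107877 * mul_nonneg (L.hn i) R.gPK + 413 * mul_nonneg (p0 X i) R.gPK +
    15308 * mul_nonneg (p0 X i) (R.hn i) + 61275 * mul_nonneg (L.hp i) (pP Y i) +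
    26160 * mul_nonneg (L.hp i) R.gP + 62510 * mul_nonneg L.kV (R.vV i) +
    45924 * mul_nonneg (L.hp i) (R.hn i) + 5320 * mul_nonneg L.kV (kn Y i) +
    10732 * mul_nonneg (pP X i) R.gP + 11305 * mul_nonneg (L.hn i) (kn Y i) +
    61275 * mul_nonneg (vV X i) (pP Y i) + 6289 * mul_nonneg (L.hn i) R.K0 +
    33915 * mul_nonneg (L.hp i) (kn Y i) + 19194 * mul_nonneg (L.hp i) R.gPK +
    5320 * mul_nonneg L.kV (p0 Y i) + 12470 * mul_nonneg (L.gPKH i) (p0 Y i) +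
    48266 * mul_nonneg (kn X i) R.kP + 1140 * mul_nonneg L.u0 R.u0

theorem OO.merge_EO_gpvh (L : OO u X) (R : EO w Y) (i : ℤ) :
    0 ≤ 24 * (u * w) - 3 * p (merge X Y) i - 2 * v (merge X Y) i - h (merge X Y) i := by
  have b1 := merge_N_le L.toSymm R.toSymm i
  rw [R.vP] at b1
  have b2 := merge_p_odd_le L.toOddP R.toEvenP i
  obtain ⟨j, b3⟩ := merge_h_le L.toSymm R.toSymm i
  refine nonneg_of_mul (d := 2142) (by norm_num) ?_
  linear_combination
    4284 * b1 + 2142 * b2 + 2142 * b3 + 1638 * mul_nonneg (L.hn i) (R.hn i) +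
    3159 * mul_nonneg (L.hk i) (R.hn i) + 864 * mul_nonneg (pP X i) (pP Y i) +
    270 * mul_nonneg L.gPV' R.gP + 828 * mul_nonneg (L.hp i) (R.hp i) +
    34 * mul_nonneg (kn X i) R.gP + 1053 * mul_nonneg L.gPV' (R.hn i) +
    918 * mul_nonneg (L.hp j) R.gPK + 54 * mul_nonneg L.gPV' (R.vV i) +
    1044 * mul_nonneg (L.gPKH i) (pP Y i) + 1008 * mul_nonneg (L.hp i) R.gP +
    354 * mul_nonneg (kn X i) (R.gph' i) + 2457 * mul_nonneg (L.hv i) R.gPK +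
    1836 * mul_nonneg (L.gPKH i) R.u0 + 162 * mul_nonneg (L.hk i) (R.vV i) +
    918 * mul_nonneg (L.hn j) R.gPK + 504 * mul_nonneg (L.hv i) (R.gph' i) +
    612 * mul_nonneg (L.hp j) (R.hn i) + 1566 * mul_nonneg L.gPV' (R.hv i) +
    3842 * mul_nonneg (kn X i) R.u0 + 612 * mul_nonneg (vV X j) (R.gph' i) +
    2142 * mul_nonneg (L.hn i) (kh Y j) + 954 * mul_nonneg (L.hp i) (pP Y i) +
    297 * mul_nonneg L.gPV' (R.gph' i) + 3465 * mul_nonneg (L.hn i) (pP Y i) +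
    918 * mul_nonneg (L.hn j) (kn Y i) + 1326 * mul_nonneg (kn X i) (R.hp i) +
    2754 * mul_nonneg (L.hn j) (R.hn i) + 279 * mul_nonneg (L.hk i) (R.gph' i) +
    1638 * mul_nonneg (pP X i) (R.hn i) + 918 * mul_nonneg (L.hn i) (R.gph' i) +
    1836 * mul_nonneg (L.hp j) (pP Y i) + 3591 * mul_nonneg (L.hn i) (R.vV i) +
    810 * mul_nonneg (L.hk i) R.gP + 2142 * mul_nonneg (kn X j) (R.hp i) +
    414 * mul_nonneg (L.hk i) (R.hv i) + 2457 * mul_nonneg (L.hv i) (kn Y i) +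
    1368 * mul_nonneg (L.gPKH i) (R.hn i) + 4356 * mul_nonneg (pP X i) (R.vV i) +
    1026 * mul_nonneg (L.gPKH i) (R.hp i) + 1836 * mul_nonneg (L.hn j) (pP Y i) +
    1449 * mul_nonneg (L.hp i) R.gPK + 198 * mul_nonneg (L.gPKH i) (R.hv i) +
    1449 * mul_nonneg (L.hp i) (kn Y i) + 1203 * mul_nonneg (kn X i) R.gPK +
    1203 * mul_nonneg (kn X i) (kn Y i) + 918 * mul_nonneg (L.hp j) (kn Y i) +
    6426 * mul_nonneg (L.hn i) R.gPK + 2142 * mul_nonneg (kn X j) (R.hn i) +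
    306 * mul_nonneg (pP X i) (R.hv i) + 2142 * mul_nonneg (L.hp i) (pP Y j) +
    2142 * mul_nonneg (L.hv i) (R.vV j)

theorem OO.bound_merge_EO (L : OO u X) (R : EO w Y) :
    BoundOE (u * w) (merge X Y) :=
  ⟨L.merge_EO_gP R, L.merge_EO_gPV R, L.merge_EO_gK R,
    L.merge_EO_gPK R, L.merge_EO_gpvh R⟩

theorem OO.merge_EE_gP (L : OO u X) (R : EE w Y) :
    0 ≤ 7 * (6 * (u * w)) - 3 * P (merge X Y) := by
  have b1 := merge_P_odd_le L.toOddP R.toEvenP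
  linear_combination
    3 * b1 + 14 * mul_nonneg L.u0 R.gP + 2 * mul_nonneg L.gP R.kP + 2 * mul_nonneg L.gP R.kT

theorem OO.merge_EE_gPV (L : OO u X) (R : EE w Y) :
    0 ≤ 8 * (6 * (u * w)) - 3 * P (merge X Y) - V (merge X Y) := by
  have b1 := merge_PV_le L.toSymm R.toSymm
  rw [R.vP] at b1
  have b2 := merge_P_odd_le L.toOddP R.toEvenP
  linear_combination
    b1 + 2 * b2 + 16 * mul_nonneg L.u0 R.gP + 2 * mul_nonneg (kT X) R.kT +
    2 * mul_nonneg L.gPV R.kP + 2 * mul_nonneg L.gPV R.kT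

theorem OO.merge_EE_gK (L : OO u X) (R : EE w Y) :
    0 ≤ 3 * (6 * (u * w)) - K (merge X Y) := by
  obtain ⟨i, b1⟩ := merge_K_le L.toSymm R.toSymm
  rw [R.vP] at b1
  refine nonneg_of_mul (d := 23800) (by norm_num) ?_
  linear_combination
    23800 * b1 + 15300 * mul_nonneg (kn X i) (R.gpv i) + 23800 * mul_nonneg (L.hn i) (R.hk i) +
    7140 * mul_nonneg L.gPV' (R.hn i) + 26180 * mul_nonneg (L.hv i) R.gP +
    1120 * mul_nonneg (L.gPKH i) (R.vV i) + 5355 * mul_nonneg (L.hk i) (R.gPph' i) +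
    8925 * mul_nonneg L.gPV' (R.hv i) + 19516 * mul_nonneg (L.hn i) (R.gPph' i) +
    3570 * mul_nonneg L.gPV' (R.vV i) + 8568 * mul_nonneg (L.hn i) R.gP +
    8540 * mul_nonneg (L.gPKH i) (R.hn i) + 9100 * mul_nonneg (L.gPKH i) (R.hp i) +
    1785 * mul_nonneg L.gPV' (R.gPph' i) + 7140 * mul_nonneg (L.hp i) (R.gpv i) +
    10710 * mul_nonneg (L.hk i) (R.vV i) + 5712 * mul_nonneg (L.hn i) (R.gpv i) +
    560 * mul_nonneg (L.gPKH i) (R.gPph' i) + 2100 * mul_nonneg (L.gPKH i) (R.gpv i) +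
    2380 * mul_nonneg (L.hv i) (pP Y i) + 7140 * mul_nonneg (L.hv i) (R.gpv i) +
    3400 * mul_nonneg (kn X i) (R.hp i) + 22100 * mul_nonneg (kn X i) (R.hn i) +
    2380 * mul_nonneg (L.hp i) (pP Y i) + 32368 * mul_nonneg (L.hn i) (R.hn i) +
    26180 * mul_nonneg (L.hp i) R.gP + 2975 * mul_nonneg (L.hk i) (R.hv i) +
    4284 * mul_nonneg (L.hn i) (R.hp i) + 18700 * mul_nonneg (kn X i) (R.hv i) +
    21420 * mul_nonneg (L.hk i) (R.hn i)

theorem OO.merge_EE_gPH (L : OO u X) (R : EE w Y) (i : ℤ) :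
    0 ≤ 7 * (6 * (u * w)) - 2 * P (merge X Y) - h (merge X Y) i := by
  have b1 := merge_P_odd_le L.toOddP R.toEvenP
  obtain ⟨j, b2⟩ := merge_h_le L.toSymm R.toSymm i
  refine nonneg_of_mul (d := 1794) (by norm_num) ?_
  linear_combination
    3588 * b1 + 1794 * b2 + 69 * mul_nonneg (kn X j) (R.hv j) + 828 * mul_nonneg (vV X i) (R.hv j) +
    1794 * mul_nonneg (L.hp j) (pP Y i) + 138 * mul_nonneg (L.gPH j) (R.hn j) +
    897 * mul_nonneg (L.hn j) (R.gPph' i) + 897 * mul_nonneg (L.hv i) (R.gPph' j) +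
    195 * mul_nonneg (L.gPKH' j) (R.hv i) + 2392 * mul_nonneg (L.hk i) R.gP +
    78 * mul_nonneg (L.hv j) (R.hv i) + 1196 * mul_nonneg (L.gPKH' j) R.gP +
    69 * mul_nonneg (L.hv i) (R.hv j) + 936 * mul_nonneg L.gPV (R.hv i) +
    897 * mul_nonneg (L.hk i) (R.hv j) + 507 * mul_nonneg (L.hp j) (R.hv i) +
    3588 * mul_nonneg (kh X i) R.gP + 1326 * mul_nonneg (vV X j) (R.hv i) +
    1196 * mul_nonneg (kn X j) R.gP + 1404 * mul_nonneg (L.gPH j) (R.hn i) +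
    897 * mul_nonneg (L.hv j) (R.gPph' i) + 1587 * mul_nonneg L.gPV (R.hv j) +
    1794 * mul_nonneg (L.hp i) (pP Y j) + 897 * mul_nonneg (L.hn i) (R.gPph' j) +
    69 * mul_nonneg (L.gPKH' j) (R.hv j) + 1196 * mul_nonneg (L.hn j) R.gP +
    1794 * mul_nonneg (L.gPH i) (R.hn j) + 3588 * mul_nonneg (L.hp i) R.gP +
    966 * mul_nonneg (kh X i) (R.hv j) + 1404 * mul_nonneg (L.gPH j) (pP Y i) +
    2392 * mul_nonneg (L.hn i) R.gP + 390 * mul_nonneg (kn X j) (R.hv i) +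
    69 * mul_nonneg (L.hn j) (R.hv j) + 944 * mul_nonneg (L.gPH j) R.gP +
    138 * mul_nonneg (L.gPH j) (pP Y j) + 3588 * mul_nonneg (L.hp j) R.gP +
    1794 * mul_nonneg (L.gPH i) (pP Y j) + 2392 * mul_nonneg L.u0 R.gP +
    756 * mul_nonneg (L.gPH j) R.u0

theorem OO.merge_EE_gPKH (L : OO u X) (R : EE w Y) (j : ℤ) :
    0 ≤ 12 * (6 * (u * w)) - 2 * P (merge X Y) - 2 * K (merge X Y) - h (merge X Y) j := by
  have b1 := merge_P_odd_le L.toOddP R.toEvenP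
  obtain ⟨i, b2⟩ := merge_K_le L.toSymm R.toSymm
  rw [R.vP] at b2
  obtain ⟨k, b3⟩ := merge_h_le L.toSymm R.toSymm j
  refine nonneg_of_mul (d := 5410802) (by norm_num) ?_
  linear_combination
    10821604 * b1 + 10821604 * b2 + 5410802 * b3 + 33607 * mul_nonneg (L.hk k) (R.hv k) +
    923557 * mul_nonneg L.gPV (R.hp i) + 268856 * mul_nonneg (pP X k) (R.gPph j) +
    906171 * mul_nonneg L.gPV' (R.gPph' i) + 13083028 * mul_nonneg (pP X k) R.gP +
    185492 * mul_nonneg L.gPV (R.hv j) + 48029 * mul_nonneg (pP X j) (R.gPph' i) +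
    46527 * mul_nonneg (L.gPKH j) (pP Y k) + 134428 * mul_nonneg (kh X i) (R.hn j) +
    511872 * mul_nonneg (kn X k) (R.hp i) + 966886 * mul_nonneg (kn X j) (R.hn i) +
    5074959 * mul_nonneg (L.hn k) (R.gPph' i) + 5058808 * mul_nonneg (L.hp j) (pP Y k) +
    15918932 * mul_nonneg (pP X j) R.gP + 3163428 * mul_nonneg L.gP (R.gPph i) +
    1628670 * mul_nonneg (L.hn k) (R.gPph j) + 2029830 * mul_nonneg (L.gPKH j) (R.hn i) +
    6992948 * mul_nonneg (kh X i) (R.hn i) + 268856 * mul_nonneg (kn X k) (R.hv j) +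
    134428 * mul_nonneg L.gP (kn Y k) + 352220 * mul_nonneg L.gPV' (R.vV k) +
    2732548 * mul_nonneg (L.gPKH k) (R.hp i) + 33607 * mul_nonneg L.gPV (kn Y k) +
    1763098 * mul_nonneg (L.hn k) (R.hn j) + 524792 * mul_nonneg (L.gPKH k) (R.hp j) +
    33607 * mul_nonneg (L.hk k) (kn Y k) + 43329 * mul_nonneg (kn X j) (pP Y i) +
    255936 * mul_nonneg (kn X k) (R.hv i) + 33607 * mul_nonneg (L.gPKH' k) (R.hv k) +
    1581678 * mul_nonneg (L.gPKH j) (R.hn k) + 67214 * mul_nonneg (kn X k) (R.hn k) +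
    2857329 * mul_nonneg (kn X j) (R.vV i) + 302463 * mul_nonneg (kn X j) (R.hv k) +
    780728 * mul_nonneg (L.hk k) (R.hv j) + 2000961 * mul_nonneg (L.hv j) (R.hv k) +
    1799294 * mul_nonneg (L.hn j) (R.hn k) + 70444 * mul_nonneg L.gPV (R.vV k) +
    268856 * mul_nonneg L.kP (R.hk j) + 8055524 * mul_nonneg (L.hv j) R.gP +
    5488 * mul_nonneg L.gPV' (R.vV i) + 261080 * mul_nonneg L.kP (R.hn i) +
    150578 * mul_nonneg L.gPV (R.hv k) + 198412 * mul_nonneg L.gPV' (R.hv j) +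
    1217619 * mul_nonneg (kn X k) (R.hn j) + 2953387 * mul_nonneg (L.gPKH j) (R.hp i) +
    3694228 * mul_nonneg (L.gPKH i) (R.hn i) + 265626 * mul_nonneg L.gPV (R.vV j) +
    521562 * mul_nonneg L.gPV' (R.vV j) + 832408 * mul_nonneg (kn X j) (R.hn k) +
    1127104 * mul_nonneg (vV X j) (R.vV k) + 1938472 * mul_nonneg (L.hn j) (R.gPph' i) +
    1830312 * mul_nonneg (vV X k) (R.vV j) + 1664866 * mul_nonneg (L.hn j) (R.gPph' k) +
    35109 * mul_nonneg (L.hp j) (R.hp k) + 511872 * mul_nonneg (kn X k) (R.hn i) +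
    33607 * mul_nonneg (L.gPKH k) (kn Y k) + 535120 * mul_nonneg L.gP (pP Y i) +
    2282737 * mul_nonneg (L.hv j) (R.gPph' k) + 7157267 * mul_nonneg L.gPV (R.hv i) +
    331316 * mul_nonneg L.kV (R.gPph' i) + 255936 * mul_nonneg (L.gPKH k) (pP Y j) +
    91358 * mul_nonneg (L.gPKH j) (R.hv i) + 10963120 * mul_nonneg L.kV R.gP +
    268856 * mul_nonneg (pP X j) (R.gPph k) + 4320 * mul_nonneg L.gP (R.hn i) +
    1527849 * mul_nonneg (L.hv k) (R.hv j) + 2732548 * mul_nonneg (L.gPKH' k) (R.vV i) +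
    10821604 * mul_nonneg (kn X i) R.kP + 2052641 * mul_nonneg (L.hv k) (R.gPph' j) +
    48029 * mul_nonneg (vV X j) (R.gPph' i) + 4886010 * mul_nonneg (L.hp k) (pP Y j) +
    915156 * mul_nonneg (L.gPKH k) (R.hn j) + 2732548 * mul_nonneg (L.gPKH k) (R.hn i) +
    3694228 * mul_nonneg L.kP (R.gPph i) + 255936 * mul_nonneg (L.gPKH' k) (R.gPph' i) +
    6971632 * mul_nonneg (L.hv k) R.gP + 33607 * mul_nonneg (kn X k) (R.hp k) +
    10687176 * mul_nonneg (kh X i) (R.hk i) + 33607 * mul_nonneg (kn X k) (R.hk j) +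
    48029 * mul_nonneg (L.hp j) (R.gPph k) + 134428 * mul_nonneg (L.gPKH i) (R.hk j) +
    70444 * mul_nonneg L.gPV' (R.hv k) + 923557 * mul_nonneg (L.hk j) (R.gPph i) +
    395517 * mul_nonneg (L.hk j) (R.hv k) + 255936 * mul_nonneg (L.hp k) (R.gPph j) +
    1049584 * mul_nonneg (kn X k) (R.hp j) + 1400723 * mul_nonneg (L.gPKH j) (R.hp k) +
    5330895 * mul_nonneg (L.hk k) (R.gPph' i) + 697980 * mul_nonneg (kn X j) (R.hp k) +
    984519 * mul_nonneg (L.gPKH j) (R.vV k) + 1628670 * mul_nonneg (L.hn k) (R.gPph' j) +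
    1664866 * mul_nonneg (L.hn j) (R.gPph k) + 3176580 * mul_nonneg (L.hn k) R.gP +
    2592 * mul_nonneg L.u0 R.u0

theorem OO.merge_EE_gpHB (L : OO u X) (R : EE w Y) {i j : ℤ} (hij : i ≤ j) :
    0 ≤ 7 * (6 * (u * w)) - 2 * p (merge X Y) i - cnt (merge X Y) (cut i) (cut j) -
      B (merge X Y) i j := by
  have b1 := merge_p_odd_le L.toOddP R.toEvenP i
  have b2 := merge_H_le L.toSymm R.toSymm i j
  have b3 := merge_pB_le L.toOddP R.toEvenP hij
  rcases le_total (p X j) (v X j) with s1 | s1 <;>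
    rw [← sub_nonneg] at s1
  · refine nonneg_of_mul (d := 321300) (by norm_num) ?_
    linear_combination
      321300 * b1 + 321300 * b2 + 321300 * b3 + 258860 * mul_nonneg (vV X j) (R.hn i) +
      42963 * mul_nonneg (L.gPKH' i) (R.aP j) + 163108 * mul_nonneg (L.aP i) (pP Y j) +
      218540 * mul_nonneg (L.hv j) R.gP + 459756 * mul_nonneg (L.hn j) (R.gPph' i) +
      542500 * mul_nonneg (pP X i) (R.hn j) + 42963 * mul_nonneg (L.gPKH' i) (R.ah j) +
      182844 * mul_nonneg (L.hn j) (R.hn i) + 95760 * mul_nonneg (L.av j) (R.gpv' i) +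
      152552 * mul_nonneg (L.hn i) (R.gPph' j) + 37800 * mul_nonneg L.gPV' (R.gPph' i) +
      540925 * mul_nonneg (kn X i) (R.aP j) + 345800 * mul_nonneg (L.gPH i) (R.hn j) +
      83300 * mul_nonneg (L.ah i) (R.hn j) + 114240 * mul_nonneg (L.hk j) (R.gpv' i) +
      165900 * mul_nonneg s1 (R.gpv i) + 36304 * mul_nonneg (pP X i) (R.vV i) +
      95760 * mul_nonneg (L.ah j) (R.gpv' i) + 69300 * mul_nonneg (L.ah i) (R.gPph' j) +
      47408 * mul_nonneg (L.ah i) R.gP + 124708 * mul_nonneg (ak X i) (R.gPph' j) +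
      107100 * mul_nonneg (kn X j) (R.aP i) + 142800 * mul_nonneg (ak X i) (R.gpv i) +
      452300 * mul_nonneg (pP X i) (pP Y j) + 2760 * mul_nonneg (L.gPKH j) (R.gPph' j) +
      50400 * mul_nonneg (L.gPKH' i) (R.gpv' i) + 107100 * mul_nonneg (kn X j) (R.ah i) +
      35223 * mul_nonneg (L.hk i) (R.ah j) + 107100 * mul_nonneg (L.gPKH j) (R.hn i) +
      238000 * mul_nonneg (L.aP i) (R.hk j) + 11484 * mul_nonneg (L.hn j) (R.gpv' i) +
      19648 * mul_nonneg (pP X i) (R.gPph' i) + 90200 * mul_nonneg (pP X i) (R.hp j) +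
      19648 * mul_nonneg (pP X i) (R.ah i) + 91915 * mul_nonneg (L.gPKH j) (R.ah j) +
      113400 * mul_nonneg L.gPV' (R.ah i) + 88350 * mul_nonneg (kn X j) (pP Y j) +
      217688 * mul_nonneg (L.gPH i) (pP Y j) + 69212 * mul_nonneg (L.gPKH' i) (R.vV j) +
      265808 * mul_nonneg (kn X i) R.gP + 685970 * mul_nonneg (L.hk j) R.gP +
      86100 * mul_nonneg (L.hv i) (R.gPph' j) + 37800 * mul_nonneg (L.hn j) (R.vV i) +
      30363 * mul_nonneg (L.hk j) (R.ah j) + 30363 * mul_nonneg (L.hk j) (R.aP j) +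
      23100 * mul_nonneg (L.hv j) (R.gpv i) + 142330 * mul_nonneg (kn X j) R.gP +
      7130 * mul_nonneg (kn X j) (R.hp j) + 25200 * mul_nonneg (L.ah i) (R.gpv i) +
      240240 * mul_nonneg (vV X j) (R.ah i) + 823440 * mul_nonneg (L.aP i) R.gP +
      43992 * mul_nonneg (ak X i) (R.vV j) + 197500 * mul_nonneg (L.ah i) (R.hp j) +
      7700 * mul_nonneg L.gPV' (pP Y j) + 113400 * mul_nonneg L.gPV' (R.aP i) +
      218540 * mul_nonneg (vV X j) (R.vV i) + 3492 * mul_nonneg (L.aP i) (R.hp j) +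
      7700 * mul_nonneg L.gPV' (R.hn j) + 50400 * mul_nonneg (L.hn i) (R.gpv' i) +
      2760 * mul_nonneg (L.hk j) (R.gPph' j) + 18620 * mul_nonneg (vV X j) (R.hp i) +
      19648 * mul_nonneg (pP X i) (R.aP i) + 75600 * mul_nonneg (L.gPH i) (R.hp i) +
      91590 * mul_nonneg L.gPV' R.gP + 240240 * mul_nonneg (vV X j) (R.aP i) +
      321300 * mul_nonneg (L.hn j) (R.ah i) + 238000 * mul_nonneg (L.aP i) (kn Y j) +
      215040 * mul_nonneg (L.hv j) (R.gpv' i) + 70560 * mul_nonneg (kn X j) (R.hn i) +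
      540925 * mul_nonneg (kn X i) (R.ah j) + 36540 * mul_nonneg (kn X j) (R.gPph' i) +
      61552 * mul_nonneg (L.hn j) (R.hn j) + 128112 * mul_nonneg (L.gPH i) (R.hp j) +
      107100 * mul_nonneg (L.gPKH j) (R.hp i) + 75600 * mul_nonneg (L.gPH i) (R.hn i) +
      75600 * mul_nonneg L.gPV' (R.hn i) + 168000 * mul_nonneg (L.aP i) (R.gpv i) +
      91915 * mul_nonneg (L.gPKH j) (R.aP j) + 61552 * mul_nonneg (L.hn j) (pP Y j) +
      95480 * mul_nonneg (kn X j) (R.hn j) + 84350 * mul_nonneg (L.gPKH j) R.gP +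
      805 * mul_nonneg (kn X j) (R.gPph' j) + 35223 * mul_nonneg (L.hk i) (R.aP j) +
      207100 * mul_nonneg (L.ah i) (pP Y j) + 50400 * mul_nonneg (L.hv i) (R.gpv' i) +
      132904 * mul_nonneg (L.hk i) (R.vV j)
  · refine nonneg_of_mul (d := 2052) (by norm_num) ?_
    linear_combination
      2052 * b1 + 2052 * b2 + 2052 * b3 + 896 * mul_nonneg (L.gPH j) (R.hn j) +
      246 * mul_nonneg (L.hn j) (R.gPph' j) + 532 * mul_nonneg (L.hk j) (R.aP i) +
      76 * mul_nonneg (L.ah i) (pP Y i) + 2052 * mul_nonneg (L.hn j) (R.ah i) +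
      266 * mul_nonneg (L.gPKH' j) (R.ah i) + 532 * mul_nonneg (L.hk j) (R.ah i) +
      760 * mul_nonneg (L.ah j) (R.hk j) + 100 * mul_nonneg (L.aP j) (pP Y i) +
      28 * mul_nonneg (L.aP i) (R.hn i) + 76 * mul_nonneg (L.av i) (R.aP j) +
      28 * mul_nonneg (L.ah i) (R.hn i) + 938 * mul_nonneg (L.aP j) (R.gPph' j) +
      1608 * mul_nonneg (L.ah i) (R.hp j) + 332 * mul_nonneg (L.aP j) (R.hk i) +
      1326 * mul_nonneg (kn X j) R.gP + 1394 * mul_nonneg s1 (R.aP i) +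
      76 * mul_nonneg (L.av i) (R.ah j) + 48 * mul_nonneg (pP X j) (R.gpv' i) +
      290 * mul_nonneg (L.hk j) R.gP + 710 * mul_nonneg (L.hk j) (R.ah j) +
      6 * mul_nonneg (L.aP j) (R.ah j) + 1608 * mul_nonneg (L.gPH i) (R.hp j) +
      1064 * mul_nonneg (kn X j) (R.aP i) + 710 * mul_nonneg (L.hk j) (R.aP j) +
      2752 * mul_nonneg (L.gPH i) (R.hn j) + 3644 * mul_nonneg (pP X i) (pP Y j) +
      104 * mul_nonneg (L.aP i) (R.hp j) + 6 * mul_nonneg s1 (R.vV j) +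
      1428 * mul_nonneg (ak X i) (R.gPph' j) + 1064 * mul_nonneg (pP X j) (R.vV i) +
      76 * mul_nonneg (L.aP i) (pP Y i) + 428 * mul_nonneg (L.gPH j) (R.hn i) +
      28 * mul_nonneg (L.gPH i) (R.hn i) + 145 * mul_nonneg (L.gPKH' j) R.gP +
      6 * mul_nonneg (L.aP j) (R.aP j) + 76 * mul_nonneg (pP X i) (R.aP i) +
      5712 * mul_nonneg (L.aP i) R.gP + 380 * mul_nonneg (L.gPH j) (pP Y i) +
      4028 * mul_nonneg (kn X i) (R.ah j) + 1656 * mul_nonneg (L.gPH j) (pP Y j) +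
      1092 * mul_nonneg (L.ah j) (kn Y i) + 6 * mul_nonneg (L.ah j) (R.aP j) +
      3328 * mul_nonneg (pP X i) (R.hn j) + 384 * mul_nonneg (L.ah i) (pP Y j) +
      1472 * mul_nonneg (pP X j) (R.gPph' i) + 760 * mul_nonneg (pP X j) (R.hn j) +
      1064 * mul_nonneg (kn X j) (R.ah i) + 1304 * mul_nonneg (L.gPKH j) (R.aP j) +
      224 * mul_nonneg (L.gPKH j) (R.gPph' j) + 76 * mul_nonneg (L.gPH i) (pP Y i) +
      373 * mul_nonneg (L.gPKH j) R.gP + 1092 * mul_nonneg (L.aP j) (kn Y i) +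
      700 * mul_nonneg (L.ah i) (R.hn j) + 332 * mul_nonneg (L.ah j) (R.hk i) +
      1964 * mul_nonneg s1 (R.gPph' i) + 938 * mul_nonneg (L.ah j) (R.gPph' j) +
      355 * mul_nonneg (L.gPKH' j) (R.aP j) + 2532 * mul_nonneg (L.ah j) (R.gpv' i) +
      266 * mul_nonneg (L.gPKH' j) (R.aP i) + 1352 * mul_nonneg (L.aP i) (kn Y j) +
      245 * mul_nonneg (L.gPKH' j) (R.gPph' j) + 100 * mul_nonneg (L.ah j) (pP Y i) +
      444 * mul_nonneg (pP X i) (R.hp j) + 3078 * mul_nonneg (L.hn j) (R.gPph' i) +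
      490 * mul_nonneg (L.hk j) (R.gPph' j) + 3780 * mul_nonneg (L.aP j) R.gP +
      355 * mul_nonneg (L.gPKH' j) (R.ah j) + 1426 * mul_nonneg (L.hn j) (R.vV j) +
      384 * mul_nonneg (L.gPH i) (pP Y j) + 466 * mul_nonneg s1 (R.gPph' j) +
      1394 * mul_nonneg s1 (R.ah i) + 760 * mul_nonneg (L.aP j) (R.hk j) +
      6 * mul_nonneg (L.ah j) (R.ah j) + 1304 * mul_nonneg (L.gPKH j) (R.ah j) +
      3780 * mul_nonneg (L.ah j) R.gP + 48 * mul_nonneg (pP X i) (R.hn i) +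
      4028 * mul_nonneg (kn X i) (R.aP j) + 2228 * mul_nonneg s1 (R.vV i) +
      1352 * mul_nonneg (L.aP i) (R.hk j) + 2532 * mul_nonneg (L.aP j) (R.gpv' i) +
      76 * mul_nonneg (pP X i) (R.ah i) + 536 * mul_nonneg (L.aP i) (pP Y j)

theorem OO.bound_merge_EE (L : OO u X) (R : EE w Y) :
    BoundOO (6 * (u * w)) (merge X Y) :=
  ⟨L.merge_EE_gP R, L.merge_EE_gPV R, L.merge_EE_gK R,
    L.merge_EE_gPH R, L.merge_EE_gPKH R, fun _ _ h => L.merge_EE_gpHB R h⟩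

theorem OE.merge_EO_gP (L : OE u X) (R : EO w Y) :
    0 ≤ 7 * (6 * (u * w)) - 3 * P (merge X Y) := by
  have b1 := merge_P_odd_le L.toOddP R.toEvenP
  linear_combination
    3 * b1 + 6 * mul_nonneg L.u0 R.gP + 3 * mul_nonneg L.kP R.kT + 3 * mul_nonneg L.gPK R.kP +
    3 * mul_nonneg L.kP R.kP + 3 * mul_nonneg L.gPK R.kT

theorem OE.merge_EO_gPV (L : OE u X) (R : EO w Y) :
    0 ≤ 8 * (6 * (u * w)) - 3 * P (merge X Y) - V (merge X Y) := by
  have b1 := merge_PV_le L.toSymm R.toSymm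
  rw [R.vP] at b1
  have b2 := merge_P_odd_le L.toOddP R.toEvenP
  linear_combination
    b1 + 2 * b2 + 2 * mul_nonneg L.kV R.kP + 3 * mul_nonneg L.gPK R.kT + 4 * mul_nonneg L.gPK R.kP +
    mul_nonneg L.kP R.kT + 2 * mul_nonneg L.kP R.kP + 12 * mul_nonneg L.u0 R.gPK

theorem OE.merge_EO_gK (L : OE u X) (R : EO w Y) :
    0 ≤ 3 * (6 * (u * w)) - K (merge X Y) := by
  obtain ⟨i, b1⟩ := merge_K_le L.toSymm R.toSymm
  rw [R.vP] at b1
  refine nonneg_of_mul (d := 24) (by norm_num) ?_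
  linear_combination
    24 * b1 + 12 * mul_nonneg L.gPK' (R.hv i) + 6 * mul_nonneg (L.hk i) (R.vV i) +
    9 * mul_nonneg L.gPK' (R.vV i) + 9 * mul_nonneg (L.hk i) (kn Y i) +
    9 * mul_nonneg L.kV (R.hv i) + 7 * mul_nonneg L.gPK (kn Y i) +
    24 * mul_nonneg (L.hk i) (R.hn i) + 9 * mul_nonneg L.kV (kn Y i) + 9 * mul_nonneg L.kV R.gPK +
    16 * mul_nonneg L.gPK (R.hp i) + 3 * mul_nonneg (L.hv i) (pP Y i) +
    9 * mul_nonneg (L.hk i) R.gPK + 3 * mul_nonneg (L.hp i) (pP Y i) +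
    9 * mul_nonneg (kn X i) (pP Y i) + 3 * mul_nonneg (kn X i) (kn Y i) +
    3 * mul_nonneg (kn X i) R.gPK + 8 * mul_nonneg L.gPK R.u0 + 16 * mul_nonneg L.gPK (R.hn i) +
    9 * mul_nonneg (L.hv i) R.gPK + 30 * mul_nonneg (L.hn i) (R.vV i) +
    3 * mul_nonneg (L.hk i) (pP Y i) + 9 * mul_nonneg (L.hp i) R.gPK +
    9 * mul_nonneg (L.hv i) (kn Y i) + 24 * mul_nonneg (L.hn i) (R.hn i) +
    33 * mul_nonneg (L.hn i) (pP Y i) + 27 * mul_nonneg (L.hn i) R.gPK +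
    3 * mul_nonneg (L.hn i) (kn Y i) + 3 * mul_nonneg L.kV (R.hp i) +
    12 * mul_nonneg L.gPK' (R.hn i) + 7 * mul_nonneg L.gPK R.gPK + 24 * mul_nonneg (kn X i) R.u0 +
    6 * mul_nonneg (kn X i) (R.vV i) + 5 * mul_nonneg L.gPK (pP Y i) +
    9 * mul_nonneg (L.hp i) (kn Y i) + 12 * mul_nonneg L.kV (R.hn i)

theorem OE.merge_EO_gPH (L : OE u X) (R : EO w Y) (i : ℤ) :
    0 ≤ 7 * (6 * (u * w)) - 2 * P (merge X Y) - h (merge X Y) i := by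
  have b1 := merge_P_odd_le L.toOddP R.toEvenP
  obtain ⟨j, b2⟩ := merge_h_le L.toSymm R.toSymm i
  linear_combination
    2 * b1 + b2 + 6 * mul_nonneg L.u0 R.gP + mul_nonneg (kn X j) (R.hv j) +
    3 * mul_nonneg L.gPK (R.hv j) + 3 * mul_nonneg L.gPK (pP Y j) + mul_nonneg L.kP (R.hv j) +
    mul_nonneg L.kP (pP Y j) + mul_nonneg L.kP (R.hn j) + 3 * mul_nonneg L.gPK (R.hn j) +
    mul_nonneg (L.hn i) (R.vV j) + mul_nonneg (L.hv i) (R.vV j) + mul_nonneg (L.hn i) (R.hn j) +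
    mul_nonneg (kn X i) (R.hn j) + mul_nonneg (L.hn j) (kh Y i) + mul_nonneg (L.hn j) (R.hk j) +
    mul_nonneg (L.hp j) (pP Y i) + mul_nonneg (L.hv j) (R.vV i) + mul_nonneg (L.hn j) (R.hn j) +
    mul_nonneg (L.hp i) (pP Y j) + mul_nonneg (kn X j) (pP Y j) + mul_nonneg (kn X j) (R.hn j) +
    mul_nonneg (kn X i) (pP Y j) + mul_nonneg (kn X i) (R.hv j) + mul_nonneg (L.hn i) (pP Y j)

theorem OE.merge_EO_gPKH (L : OE u X) (R : EO w Y) (j : ℤ) :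
    0 ≤ 12 * (6 * (u * w)) - 2 * P (merge X Y) - 2 * K (merge X Y) - h (merge X Y) j := by
  have b1 := merge_P_odd_le L.toOddP R.toEvenP
  obtain ⟨i, b2⟩ := merge_K_le L.toSymm R.toSymm
  rw [R.vP] at b2
  obtain ⟨k, b3⟩ := merge_h_le L.toSymm R.toSymm j
  refine nonneg_of_mul (d := 5155920) (by norm_num) ?_
  linear_combination
    10311840 * b1 + 10311840 * b2 + 5155920 * b3 + 647955 * mul_nonneg L.kP (R.hn i) +
    69120 * mul_nonneg (kn X i) (R.hn j) + 6472800 * mul_nonneg (kn X i) (R.hp k) +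
    6252120 * mul_nonneg (vV X j) (R.vV k) + 2598120 * mul_nonneg (L.hn j) (pP Y k) +
    69120 * mul_nonneg (kn X i) (pP Y j) + 17280 * mul_nonneg (L.gpvh' i) (R.hv j) +
    17280 * mul_nonneg (pP X i) (R.hv j) + 3694320 * mul_nonneg (kn X j) (R.hp k) +
    942480 * mul_nonneg (L.gpvh' i) (R.vV i) + 2279970 * mul_nonneg L.gPV (R.hp i) +
    1418109 * mul_nonneg L.gPK (R.gph i) + 908880 * mul_nonneg (kn X k) (R.hp j) +
    949200 * mul_nonneg (L.hv k) (kn Y j) + 7625016 * mul_nonneg L.gPK R.u0 +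
    3582810 * mul_nonneg (L.hk i) (R.hn i) + 1432920 * mul_nonneg L.gPV R.gP +
    1461600 * mul_nonneg (vV X j) R.gP + 908880 * mul_nonneg L.gPK (R.hn j) +
    2557800 * mul_nonneg (L.hp j) (kn Y k) + 949200 * mul_nonneg (L.gpvh' k) (R.hn j) +
    698940 * mul_nonneg (L.hp k) (pP Y j) + 5654880 * mul_nonneg (L.hn i) (R.vV i) +
    759990 * mul_nonneg (pP X i) (R.hn i) + 1898400 * mul_nonneg L.gPK (pP Y j) +
    2598120 * mul_nonneg (L.hp j) (pP Y k) + 729960 * mul_nonneg (kn X i) (R.hn i) +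
    2025870 * mul_nonneg L.kV (R.gph' i) + 454440 * mul_nonneg (L.gpvh' k) (R.vV j) +
    949200 * mul_nonneg (L.hv k) R.gPK + 10311840 * mul_nonneg (L.hn i) R.gPK +
    643104 * mul_nonneg L.gPK (R.hp i) + 839760 * mul_nonneg (kn X k) (R.hn j) +
    1252020 * mul_nonneg (L.hn i) (R.gph i) + 931920 * mul_nonneg (L.gpvh' k) (R.hv j) +
    7455525 * mul_nonneg L.gPK (R.hn i) + 5138640 * mul_nonneg (L.hn k) (R.hn j) +
    1461600 * mul_nonneg (pP X j) (R.hp k) + 2180520 * mul_nonneg L.kV (R.vV k) +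
    1461600 * mul_nonneg (pP X j) (R.hn k) + 1649700 * mul_nonneg L.kP (pP Y j) +
    397320 * mul_nonneg (L.hk i) (R.gph' i) + 778320 * mul_nonneg (L.hn i) (R.hn j) +
    7986600 * mul_nonneg L.gPK (R.hn k) + 334740 * mul_nonneg (kn X k) R.gP +
    3752280 * mul_nonneg (L.hv k) (R.vV j) + 1024800 * mul_nonneg (L.hn i) R.u0 +
    3565380 * mul_nonneg (pP X k) (pP Y j) + 3488940 * mul_nonneg (L.hn k) R.gPK +
    761040 * mul_nonneg (L.hn i) (R.hv j) + 1968120 * mul_nonneg (L.hn i) (R.hn i) +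
    759990 * mul_nonneg (L.gpvh' i) (R.hn i) + 2557800 * mul_nonneg (L.hn j) R.gPK +
    1666980 * mul_nonneg (L.hn k) (R.vV j) + 942480 * mul_nonneg (pP X i) (R.vV i) +
    926160 * mul_nonneg (pP X k) (R.hn j) + 2557800 * mul_nonneg (L.hn j) (kn Y k) +
    7986600 * mul_nonneg L.gPK (R.hp k) + 3769920 * mul_nonneg (kn X i) (R.hp i) +
    3421320 * mul_nonneg (L.hk i) R.gP + 220700 * mul_nonneg (L.gpvh' k) R.gP +
    6472800 * mul_nonneg (kn X i) (R.hn k) + 2557800 * mul_nonneg (L.hp j) R.gPK +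
    1618200 * mul_nonneg (pP X i) (R.vV k) + 908880 * mul_nonneg L.gPK (R.hp j) +
    1618200 * mul_nonneg (L.gpvh' i) (R.vV k) + 5862780 * mul_nonneg (L.hk i) (kn Y i) +
    5155920 * mul_nonneg (L.hn j) (R.hn k) + 698180 * mul_nonneg (L.hp k) R.gP +
    5404260 * mul_nonneg L.kV R.gP + 454440 * mul_nonneg (L.hv k) R.gP +
    3488940 * mul_nonneg (L.hn k) (kn Y j) + 179580 * mul_nonneg (kn X k) (pP Y j) +
    908880 * mul_nonneg (L.hp k) R.gPK + 3694320 * mul_nonneg (kn X j) (R.hn k) +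
    778320 * mul_nonneg (L.hn i) (pP Y j) + 4071600 * mul_nonneg L.gPV (R.vV k) +
    6077610 * mul_nonneg L.gPV (R.hv i) + 1618200 * mul_nonneg (L.hn i) (R.hp k) +
    2264955 * mul_nonneg L.kP (R.gph i) + 908880 * mul_nonneg (pP X k) (R.hp j) +
    1618200 * mul_nonneg (L.hn i) (R.hn k) + 5862780 * mul_nonneg (L.hk i) R.gPK +
    908880 * mul_nonneg (L.hp k) (kn Y j) + 118440 * mul_nonneg L.u0 R.u0

theorem OE.merge_EO_gpHB (L : OE u X) (R : EO w Y) {i j : ℤ} (hij : i ≤ j) :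
    0 ≤ 7 * (6 * (u * w)) - 2 * p (merge X Y) i - cnt (merge X Y) (cut i) (cut j) -
      B (merge X Y) i j := by
  have b1 := merge_p_odd_le L.toOddP R.toEvenP i
  have b2 := merge_H_le L.toSymm R.toSymm i j
  have b3 := merge_pB_le L.toOddP R.toEvenP hij
  refine nonneg_of_mul (d := 24) (by norm_num) ?_
  linear_combination
    24 * b1 + 24 * b2 + 24 * b3 + 24 * mul_nonneg (kh X i) (R.hn j) +
    18 * mul_nonneg (kn X i) (R.hp i) + 8 * mul_nonneg (L.ah i) (R.vV j) +
    6 * mul_nonneg (L.gpvh' j) R.gP + 6 * mul_nonneg (L.av j) (R.vV i) +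
    45 * mul_nonneg (L.hv j) (R.vV i) + 42 * mul_nonneg (L.an j) (kn Y i) +
    36 * mul_nonneg (L.aP j) (kn Y i) + 24 * mul_nonneg (kn X j) (R.hp i) +
    18 * mul_nonneg (kn X i) (R.hn i) + 8 * mul_nonneg (L.aP i) (R.vV j) +
    16 * mul_nonneg (L.an j) (R.vV j) + 6 * mul_nonneg (L.gpvh' i) (R.vV i) +
    6 * mul_nonneg (kn X i) (R.an j) + 6 * mul_nonneg (L.an j) (pP Y i) +
    42 * mul_nonneg (L.aP j) R.gPK + 18 * mul_nonneg (L.hv j) R.gP +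
    6 * mul_nonneg (kn X i) (R.aP j) + 8 * mul_nonneg (ak X j) (R.vV j) +
    24 * mul_nonneg (kn X i) (R.hp j) + 6 * mul_nonneg (L.aP j) (kn Y j) +
    6 * mul_nonneg (L.ah i) (R.vV i) + 42 * mul_nonneg (L.an j) R.gPK +
    6 * mul_nonneg (ak X j) (pP Y j) + 16 * mul_nonneg L.gPK (R.hp j) +
    15 * mul_nonneg (L.gpvh' j) (R.vV i) + 42 * mul_nonneg (L.an i) (pP Y j) +
    24 * mul_nonneg (pP X i) (R.hp j) + 14 * mul_nonneg L.gPK (R.vV i) +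
    30 * mul_nonneg (L.hn j) (R.vV i) + 42 * mul_nonneg (L.aP i) (pP Y j) +
    16 * mul_nonneg L.gPK (R.hn j) + 12 * mul_nonneg (L.aP j) (pP Y i) +
    2 * mul_nonneg (L.aP j) (R.vV j) + 8 * mul_nonneg (L.gpvh' i) (R.vV j) +
    12 * mul_nonneg (L.hn j) R.gP + 24 * mul_nonneg (kn X j) (R.hn i) +
    6 * mul_nonneg (pP X i) (pP Y j) + 24 * mul_nonneg (L.hn j) (R.hn i) +
    16 * mul_nonneg (L.av j) (R.vV j) + 24 * mul_nonneg (L.an i) (R.hn j) +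
    56 * mul_nonneg L.gPK (R.hn i) + 6 * mul_nonneg (L.aP i) (R.vV i) +
    24 * mul_nonneg (L.hn j) (R.an i) + 56 * mul_nonneg L.gPK (R.hp i) +
    24 * mul_nonneg (pP X i) (R.hn j)

theorem OE.bound_merge_EO (L : OE u X) (R : EO w Y) :
    BoundOO (6 * (u * w)) (merge X Y) :=
  ⟨L.merge_EO_gP R, L.merge_EO_gPV R, L.merge_EO_gK R,
    L.merge_EO_gPH R, L.merge_EO_gPKH R, fun _ _ h => L.merge_EO_gpHB R h⟩

theorem OE.merge_EE_gP (L : OE u X) (R : EE w Y) :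
    0 ≤ 6 * (6 * (u * w)) - P (merge X Y) := by
  have b1 := merge_P_odd_le L.toOddP R.toEvenP
  linear_combination
    b1 + 12 * mul_nonneg L.u0 R.gP + mul_nonneg L.kP R.kT + mul_nonneg L.gPK R.kP +
    mul_nonneg L.kP R.kP + mul_nonneg L.gPK R.kT

theorem OE.merge_EE_gPV (L : OE u X) (R : EE w Y) :
    0 ≤ 14 * (6 * (u * w)) - 2 * P (merge X Y) - V (merge X Y) := by
  have b1 := merge_PV_le L.toSymm R.toSymm
  rw [R.vP] at b1
  have b2 := merge_P_odd_le L.toOddP R.toEvenP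
  linear_combination
    b1 + b2 + 28 * mul_nonneg L.u0 R.gP + 2 * mul_nonneg (kT X) R.kT + 2 * mul_nonneg L.gPV R.kP +
    2 * mul_nonneg L.gPV R.kT

theorem OE.merge_EE_gK (L : OE u X) (R : EE w Y) :
    0 ≤ 7 * (6 * (u * w)) - K (merge X Y) := by
  obtain ⟨i, b1⟩ := merge_K_le L.toSymm R.toSymm
  rw [R.vP] at b1
  refine nonneg_of_mul (d := 46194) (by norm_num) ?_
  linear_combination
    46194 * b1 + 3826 * mul_nonneg (L.gpvh' i) (R.hp i) + 2948 * mul_nonneg (L.hp i) (R.hk i) +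
    2232 * mul_nonneg (L.gpvh' i) (R.hv i) + 2948 * mul_nonneg (L.hp i) (kn Y i) +
    2493 * mul_nonneg (L.hv i) (kn Y i) + 27942 * mul_nonneg (kn X i) (R.hk i) +
    6213 * mul_nonneg L.gPK (R.gPph i) + 5598 * mul_nonneg (L.hn i) (R.hv i) +
    27942 * mul_nonneg (kn X i) (kn Y i) + 8985 * mul_nonneg (L.hv i) (R.gPph i) +
    18 * mul_nonneg (L.hn i) (pP Y i) + 23097 * mul_nonneg L.gPV' (R.hv i) +
    15516 * mul_nonneg (L.hk i) (R.vV i) + 13929 * mul_nonneg (kn X i) (R.hp i) +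
    5148 * mul_nonneg (pP X i) (R.hv i) + 17797 * mul_nonneg (L.gpvh' i) (R.hn i) +
    3068 * mul_nonneg (L.gpvh' i) (R.vV i) + 22956 * mul_nonneg (L.hn i) (R.hn i) +
    25132 * mul_nonneg (L.hp i) R.gP + 12356 * mul_nonneg (L.hp i) (R.gPph i) +
    57264 * mul_nonneg (kn X i) R.gP + 28245 * mul_nonneg L.gPK (R.hp i) +
    4323 * mul_nonneg (kn X i) (R.gPph i) + 26766 * mul_nonneg (L.hn i) (R.gPph' i) +
    18252 * mul_nonneg L.gPK (R.hn i) + 46194 * mul_nonneg (L.hn i) (R.hk i) +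
    11736 * mul_nonneg L.gPK (pP Y i) + 2493 * mul_nonneg (L.hv i) (R.hk i) +
    22938 * mul_nonneg (L.hn i) (R.gPph i) + 18252 * mul_nonneg (pP X i) (R.hn i) +
    3978 * mul_nonneg (pP X i) (R.vV i) + 6213 * mul_nonneg L.gPV' (R.gPph' i) +
    12426 * mul_nonneg (L.hk i) (R.gPph' i) + 21492 * mul_nonneg (L.hv i) R.gP +
    4281 * mul_nonneg (L.hv i) (R.gPph' i) + 7758 * mul_nonneg L.gPV' (R.vV i) +
    1692 * mul_nonneg L.u0 R.u0

theorem OE.merge_EE_gPK (L : OE u X) (R : EE w Y) :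
    0 ≤ 12 * (6 * (u * w)) - P (merge X Y) - K (merge X Y) := by
  have b1 := merge_P_odd_le L.toOddP R.toEvenP
  obtain ⟨i, b2⟩ := merge_K_le L.toSymm R.toSymm
  rw [R.vP] at b2
  refine nonneg_of_mul (d := 3) (by norm_num) ?_
  linear_combination
    3 * b1 + 3 * b2 + 3 * mul_nonneg (kn X i) (R.hp i) + 3 * mul_nonneg L.gPK (R.hp i) +
    3 * mul_nonneg (L.hn i) (R.hn i) + 3 * mul_nonneg L.gPV (R.hv i) +
    6 * mul_nonneg L.gPK (R.hn i) + 3 * mul_nonneg L.kP (pP Y i) + 3 * mul_nonneg L.gPK (pP Y i) +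
    6 * mul_nonneg L.u0 (R.gPph' i) + 3 * mul_nonneg (L.hn i) (R.hk i) +
    mul_nonneg (L.gpvh' i) (R.vV i) + 48 * mul_nonneg L.u0 R.gP + mul_nonneg (L.hp i) (R.vV i) +
    3 * mul_nonneg (kn X i) (R.hn i)

theorem OE.merge_EE_gpvh (L : OE u X) (R : EE w Y) (i : ℤ) :
    0 ≤ 24 * (6 * (u * w)) - 3 * p (merge X Y) i - 2 * v (merge X Y) i - h (merge X Y) i := by
  have b1 := merge_N_le L.toSymm R.toSymm i
  rw [R.vP] at b1
  have b2 := merge_p_odd_le L.toOddP R.toEvenP i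
  obtain ⟨j, b3⟩ := merge_h_le L.toSymm R.toSymm i
  refine nonneg_of_mul (d := 2) (by norm_num) ?_
  linear_combination
    4 * b1 + 2 * b2 + 2 * b3 + 2 * mul_nonneg (L.hn j) (R.gPph' i) +
    6 * mul_nonneg (L.hn i) (R.hk i) + 2 * mul_nonneg (L.hn i) (R.gPph i) +
    mul_nonneg (L.hn i) (R.gPph' i) + 2 * mul_nonneg (L.hp i) (R.hk i) +
    2 * mul_nonneg (kn X i) (kn Y i) + mul_nonneg (L.hn i) (R.hv i) +
    2 * mul_nonneg (pP X i) (R.hn i) + 2 * mul_nonneg (pP X j) (R.gPph i) +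
    2 * mul_nonneg L.gPK (R.gPph i) + 4 * mul_nonneg L.gPK (R.hn i) +
    6 * mul_nonneg L.gPK (R.hp i) +
    2 * mul_nonneg (kn X j) (R.hn i) + 2 * mul_nonneg (L.hv i) (R.gPph' i) +
    2 * mul_nonneg (kn X i) (R.hk i) + 8 * mul_nonneg (kn X i) R.gP +
    2 * mul_nonneg (kn X j) (R.hv i) + 2 * mul_nonneg (L.gpvh i) (R.hn i) +
    2 * mul_nonneg (L.hn i) (R.hn i) + 2 * mul_nonneg (L.hp i) (pP Y j) +
    4 * mul_nonneg (L.hn i) R.gP + 2 * mul_nonneg (L.hn j) (R.hn i) +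
    2 * mul_nonneg (L.hv i) (R.vV j) + 2 * mul_nonneg (L.hv j) (R.gPph' i) +
    2 * mul_nonneg (L.hn i) (kh Y j) + 2 * mul_nonneg (L.hp i) (kn Y i) +
    2 * mul_nonneg (L.gpvh i) (R.vV i) + 4 * mul_nonneg L.gPK' (R.hv i) +
    8 * mul_nonneg (L.hp i) R.gP + 6 * mul_nonneg (kn X i) (R.hp i)

theorem OE.bound_merge_EE (L : OE u X) (R : EE w Y) :
    BoundOE (6 * (u * w)) (merge X Y) :=
  ⟨L.merge_EE_gP R, L.merge_EE_gPV R, L.merge_EE_gK R,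
    L.merge_EE_gPK R, L.merge_EE_gpvh R⟩

theorem EO.merge_EO_gP (L : EO u X) (R : EO w Y) :
    0 ≤ 3 * (u * w) - P (merge X Y) := by
  have b1 := merge_P_even_le L.toSymm R.toSymm (L.toEvenP.merge_even R.toEvenP)
  rw [L.vP, R.vP] at b1
  refine nonneg_of_mul (d := 6) (by norm_num) ?_
  linear_combination
    6 * b1 + 4 * mul_nonneg L.gPK R.u0 + 3 * mul_nonneg L.kT R.gPK + 3 * mul_nonneg L.kT R.kT +
    4 * mul_nonneg L.kP R.gPK + 4 * mul_nonneg L.kP R.kP + 2 * mul_nonneg L.u0 R.u0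

theorem EO.merge_EO_gpv (L : EO u X) (R : EO w Y) (i : ℤ) :
    0 ≤ 7 * (u * w) - 2 * p (merge X Y) i - v (merge X Y) i := by
  have b1 := merge_N_le L.toSymm R.toSymm i
  rw [L.vP, R.vP] at b1
  have b2 := merge_p_even_even_le L.toEvenP R.toEvenP i
  refine nonneg_of_mul (d := 2400) (by norm_num) ?_
  linear_combination
    2400 * b1 + 2400 * b2 + 600 * mul_nonneg (L.gph' i) (R.hn i) + 410 * mul_nonneg (pP X i) R.gPK +
    184 * mul_nonneg (L.gph' i) (R.hk i) + 1050 * mul_nonneg (pP X i) (R.hn i) +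
    1800 * mul_nonneg L.u0 (kn Y i) + 631 * mul_nonneg (L.an i) (R.hk i) +
    600 * mul_nonneg (pP X i) R.u0 + 1200 * mul_nonneg (L.aP i) (kn Y i) +
    600 * mul_nonneg L.u0 (R.hk i) + 765 * mul_nonneg (L.an i) R.gPK +
    2100 * mul_nonneg (L.an i) (ak Y i) + 344 * mul_nonneg L.gPK (R.hk i) +
    640 * mul_nonneg L.gPK (kh Y i) + 1540 * mul_nonneg L.gPK (R.aP i) +
    975 * mul_nonneg (L.an i) (R.hn i) + 640 * mul_nonneg (kn X i) (R.aP i) +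
    640 * mul_nonneg (kn X i) (kn Y i) + 1120 * mul_nonneg L.gPK R.u0 +
    300 * mul_nonneg (L.an i) R.u0 + 2100 * mul_nonneg (pP X i) (kh Y i) +
    900 * mul_nonneg (ak X i) (R.ah i) + 320 * mul_nonneg L.gPK (R.hn i) +
    300 * mul_nonneg (L.an i) (R.ah i) + 2216 * mul_nonneg (L.hn i) (R.hk i) +
    1120 * mul_nonneg (kn X i) R.u0 + 280 * mul_nonneg (v0 X i) R.gPK +
    900 * mul_nonneg (ak X i) (R.aP i) + 3080 * mul_nonneg L.u0 R.gPK +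
    1440 * mul_nonneg L.gPK (v0 Y i) + 840 * mul_nonneg (L.aP i) R.gPK +
    1442 * mul_nonneg (pP X i) (R.hk i) + 1200 * mul_nonneg (L.aP i) (R.hp i) +
    1540 * mul_nonneg L.gPK (R.ah i) + 1800 * mul_nonneg (L.hn i) (R.hn i) +
    640 * mul_nonneg (kn X i) (R.ah i) + 1440 * mul_nonneg (kn X i) (R.hp i) +
    344 * mul_nonneg (ak X i) (R.hk i) + 1300 * mul_nonneg (pP X i) (v0 Y i) +
    1800 * mul_nonneg L.u0 (kh Y i) + 400 * mul_nonneg L.u0 (v0 Y i) +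
    800 * mul_nonneg (v0 X i) (v0 Y i)

theorem EO.merge_EO_gPph (L : EO u X) (R : EO w Y) (i : ℤ) :
    0 ≤ 12 * (u * w) - 2 * P (merge X Y) - p (merge X Y) i - h (merge X Y) i := by
  have b1 := merge_P_even_le L.toSymm R.toSymm (L.toEvenP.merge_even R.toEvenP)
  rw [L.vP, R.vP] at b1
  have b2 := merge_p_even_even_le L.toEvenP R.toEvenP i
  obtain ⟨j, b3⟩ := merge_h_le L.toSymm R.toSymm i
  refine nonneg_of_mul (d := 4) (by norm_num) ?_
  linear_combination
    8 * b1 + 4 * b2 + 4 * b3 + 4 * mul_nonneg (L.hp j) (pP Y i) + mul_nonneg (L.hp j) R.gPK +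
    3 * mul_nonneg (L.aP j) R.gPK + 3 * mul_nonneg (L.hk j) (R.hk j) +
    4 * mul_nonneg (L.aP i) (pP Y i) + 2 * mul_nonneg (ak X j) R.gPK +
    3 * mul_nonneg (L.hk j) (R.hn j) + mul_nonneg (L.hn j) (ak Y i) +
    4 * mul_nonneg (kh X i) (R.ah j) + 4 * mul_nonneg (kn X j) (ak Y i) +
    4 * mul_nonneg (kh X i) (R.aP j) + 4 * mul_nonneg (L.ah i) (R.aP j) +
    mul_nonneg (L.hn j) R.gPK +
    7 * mul_nonneg (L.hn j) (pP Y i) + 4 * mul_nonneg (L.hk j) (R.vV j) +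
    8 * mul_nonneg (L.aP i) R.gPK + 4 * mul_nonneg (L.an i) (pP Y j) +
    mul_nonneg (kn X j) (R.hk j) +
    4 * mul_nonneg (kn X j) R.u0 + 4 * mul_nonneg (L.aP j) (kh Y i) + mul_nonneg (kn X j) (R.hn j) +
    4 * mul_nonneg (L.aP i) (R.aP i) + 4 * mul_nonneg (pP X i) (pP Y j) +
    3 * mul_nonneg (L.hn j) (R.ah i) + 4 * mul_nonneg (L.hp j) (ak Y i) +
    4 * mul_nonneg (L.an j) (R.ah i) + 4 * mul_nonneg (L.hn j) (R.vV j) +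
    4 * mul_nonneg (pP X i) (pP Y i) + 8 * mul_nonneg (pP X i) R.gPK + 12 * mul_nonneg L.gPK R.u0 +
    4 * mul_nonneg (pP X i) (R.hp j) + 4 * mul_nonneg (L.aP j) (R.aP i) +
    4 * mul_nonneg (L.an i) (R.hn j) + 4 * mul_nonneg (L.aP j) (kn Y j) +
    4 * mul_nonneg (L.an j) (kh Y i) + 4 * mul_nonneg (ak X j) (kn Y j) +
    4 * mul_nonneg (pP X i) (R.hn j) + mul_nonneg (L.an j) R.gPK +
    4 * mul_nonneg (ak X j) (R.aP i) +
    4 * mul_nonneg (L.ah i) (R.ah j) + 4 * mul_nonneg (pP X i) (R.aP i) +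
    4 * mul_nonneg (kh X i) (R.hn j) + 7 * mul_nonneg (L.hn j) (R.hn i) +
    4 * mul_nonneg (L.aP j) (R.ah i) + 8 * mul_nonneg (L.an i) R.gPK

theorem EO.bound_merge_EO (L : EO u X) (R : EO w Y) :
    BoundEE (u * w) (merge X Y) :=
  ⟨L.merge_EO_gP R, L.merge_EO_gpv R, L.merge_EO_gPph R⟩

theorem EO.merge_EE_gP (L : EO u X) (R : EE w Y) :
    0 ≤ 7 * (6 * (u * w)) - 6 * P (merge X Y) := by
  have b1 := merge_P_even_le L.toSymm R.toSymm (L.toEvenP.merge_even R.toEvenP)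
  rw [L.vP, R.vP] at b1
  linear_combination
    6 * b1 + 14 * mul_nonneg L.u0 R.gP + 6 * mul_nonneg L.kT R.kT + 2 * mul_nonneg L.gP R.kP +
    2 * mul_nonneg L.gP R.kT

theorem EO.merge_EE_gPK (L : EO u X) (R : EE w Y) :
    0 ≤ 4 * (6 * (u * w)) - 2 * P (merge X Y) - K (merge X Y) := by
  have b1 := merge_P_even_le L.toSymm R.toSymm (L.toEvenP.merge_even R.toEvenP)
  rw [L.vP, R.vP] at b1
  obtain ⟨i, b2⟩ := merge_K_le L.toSymm R.toSymm
  rw [L.vP, R.vP] at b2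
  refine nonneg_of_mul (d := 12) (by norm_num) ?_
  linear_combination
    24 * b1 + 12 * b2 + 4 * mul_nonneg L.gP (R.hp i) + 21 * mul_nonneg (L.hk i) (R.hk i) +
    24 * mul_nonneg (L.hk i) (R.hn i) + 6 * mul_nonneg L.gPK (kh Y i) +
    4 * mul_nonneg L.gP (R.hv i) + 9 * mul_nonneg L.gPK (R.hk i) + 4 * mul_nonneg L.u0 (R.gPph' i) +
    33 * mul_nonneg (L.hn i) (R.hk i) + 24 * mul_nonneg L.gPK (R.hn i) + 56 * mul_nonneg L.u0 R.gP +
    2 * mul_nonneg L.gP (kh Y i) + 6 * mul_nonneg L.gPK (R.hp i) +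
    6 * mul_nonneg (kn X i) (R.hk i) +
    2 * mul_nonneg L.u0 (R.hv i) + 36 * mul_nonneg (L.hn i) (R.hn i) +
    6 * mul_nonneg L.gPK (R.hv i) + 2 * mul_nonneg L.u0 (R.hk i) +
    6 * mul_nonneg (kn X i) (kh Y i) +
    6 * mul_nonneg L.u0 (R.gPph i) + 6 * mul_nonneg (kn X i) (R.hv i) +
    6 * mul_nonneg (kn X i) (R.hp i) + 12 * mul_nonneg (kn X i) (R.hn i)

theorem EO.merge_EE_gph (L : EO u X) (R : EE w Y) (i : ℤ) :
    0 ≤ 6 * (6 * (u * w)) - 4 * p (merge X Y) i - h (merge X Y) i := by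
  have b1 := merge_p_even_even_le L.toEvenP R.toEvenP i
  obtain ⟨j, b2⟩ := merge_h_le L.toSymm R.toSymm i
  refine nonneg_of_mul (d := 396) (by norm_num) ?_
  linear_combination
    1584 * b1 + 396 * b2 + 396 * mul_nonneg (L.gph i) (R.hn j) + 66 * mul_nonneg (L.hk j) (R.hp j) +
    67 * mul_nonneg L.gP (R.ah j) + 198 * mul_nonneg (L.gph' j) R.u0 +
    1188 * mul_nonneg (L.hp j) (pP Y i) + 333 * mul_nonneg L.gP (R.hn j) +
    792 * mul_nonneg (L.hk j) (pP Y i) + 324 * mul_nonneg (L.hk j) R.gP +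
    456 * mul_nonneg L.gP R.u0 + 33 * mul_nonneg (L.hk j) (R.ah j) +
    33 * mul_nonneg (L.hk j) (R.gPph' j) + 1980 * mul_nonneg (L.hn j) (pP Y i) +
    22 * mul_nonneg L.u0 (R.hk j) + 22 * mul_nonneg L.u0 (kn Y j) +
    396 * mul_nonneg (L.an j) (R.gpv i) + 199 * mul_nonneg L.gP (R.hk j) +
    792 * mul_nonneg (pP X i) (pP Y j) + 396 * mul_nonneg (L.aP j) (R.gpv i) +
    67 * mul_nonneg L.gP (R.aP j) + 198 * mul_nonneg (L.hk i) (R.aP j) +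
    33 * mul_nonneg (L.hk j) (R.aP j) + 198 * mul_nonneg (kn X j) R.u0 +
    402 * mul_nonneg (L.gph' j) R.gP + 199 * mul_nonneg L.gP (kn Y j) +
    792 * mul_nonneg (pP X i) (R.hp j) + 1584 * mul_nonneg (L.an i) (R.an i) +
    396 * mul_nonneg (L.hn j) (R.hn i) + 198 * mul_nonneg (L.gph i) (R.ah j) +
    22 * mul_nonneg L.u0 (pP Y j) + 390 * mul_nonneg (kn X j) R.gP +
    396 * mul_nonneg (pP X i) (kn Y j) + 198 * mul_nonneg (L.gph i) (R.aP j) +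
    265 * mul_nonneg L.gP (R.hp j) + 2796 * mul_nonneg (L.hp j) R.gP +
    792 * mul_nonneg (kn X j) (pP Y i) + 198 * mul_nonneg (kn X i) (R.ah j) +
    2784 * mul_nonneg (L.hn j) R.gP + 396 * mul_nonneg (pP X i) (R.hk j) +
    198 * mul_nonneg (L.hk i) (R.ah j) + 396 * mul_nonneg (pP X i) (R.hn j) +
    66 * mul_nonneg (L.hk j) (R.hn j) + 198 * mul_nonneg (kn X i) (R.aP j) +
    220 * mul_nonneg L.u0 (R.gPph' j)

theorem EO.bound_merge_EE (L : EO u X) (R : EE w Y) :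
    BoundEO (6 * (u * w)) (merge X Y) :=
  ⟨L.merge_EE_gP R, L.merge_EE_gPK R, L.merge_EE_gph R⟩

theorem EE.merge_EE_gP (L : EE u X) (R : EE w Y) :
    0 ≤ 3 * (6 * (u * w)) - P (merge X Y) := by
  have b1 := merge_P_even_le L.toSymm R.toSymm (L.toEvenP.merge_even R.toEvenP)
  rw [L.vP, R.vP] at b1
  linear_combination
    b1 + 6 * mul_nonneg L.u0 R.gP + mul_nonneg L.kT R.kT + 2 * mul_nonneg L.gP R.kP +
    2 * mul_nonneg L.gP R.kT

theorem EE.merge_EE_gpv (L : EE u X) (R : EE w Y) (i : ℤ) :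
    0 ≤ 7 * (6 * (u * w)) - 2 * p (merge X Y) i - v (merge X Y) i := by
  have b1 := merge_N_le L.toSymm R.toSymm i
  rw [L.vP, R.vP] at b1
  have b2 := merge_p_even_even_le L.toEvenP R.toEvenP i
  refine nonneg_of_mul (d := 48) (by norm_num) ?_
  linear_combination
    48 * b1 + 48 * b2 + 16 * mul_nonneg (kn X i) (R.hk i) + 12 * mul_nonneg (L.hk i) (R.ah i) +
    84 * mul_nonneg L.gP (R.aP i) + 48 * mul_nonneg (L.hk i) (R.hn i) +
    84 * mul_nonneg L.gP (R.ah i) + 126 * mul_nonneg L.u0 R.gP + 12 * mul_nonneg (kn X i) (R.hp i) +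
    48 * mul_nonneg (L.an i) (R.ah i) + 16 * mul_nonneg (kn X i) (kn Y i) +
    9 * mul_nonneg L.u0 (R.hp i) + 18 * mul_nonneg (L.gPph i) (R.hp i) +
    18 * mul_nonneg (L.gPph i) (R.aP i) + 12 * mul_nonneg (L.hk i) (R.aP i) +
    16 * mul_nonneg (L.gPph i) (kn Y i) + 18 * mul_nonneg (L.gPph i) (R.ah i) +
    16 * mul_nonneg (L.hk i) (kn Y i) + 36 * mul_nonneg L.gP (R.hp i) +
    6 * mul_nonneg L.u0 (R.hk i) + 56 * mul_nonneg (L.hn i) (R.hk i) +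
    72 * mul_nonneg (L.gPph i) (R.hn i) + 6 * mul_nonneg (L.hp i) (R.hp i) +
    16 * mul_nonneg (L.hk i) (R.hk i) + 48 * mul_nonneg (L.an i) (R.hn i) +
    12 * mul_nonneg (kn X i) (R.ah i) + 6 * mul_nonneg (L.hp i) (R.ah i) +
    12 * mul_nonneg (kn X i) (R.aP i) + 6 * mul_nonneg (L.hp i) (R.aP i) +
    8 * mul_nonneg (L.hp i) (kn Y i) + 135 * mul_nonneg L.u0 (R.gPph i) +
    8 * mul_nonneg (L.hn i) (kn Y i) + 6 * mul_nonneg L.u0 (kn Y i) +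
    16 * mul_nonneg (L.gPph i) (R.hk i) + 8 * mul_nonneg (L.hp i) (R.hk i) +
    24 * mul_nonneg (L.hn i) (R.hn i) + 12 * mul_nonneg (L.hk i) (R.hp i) +
    18 * mul_nonneg L.u0 R.u0

theorem EE.merge_EE_gPph (L : EE u X) (R : EE w Y) (i : ℤ) :
    0 ≤ 12 * (6 * (u * w)) - 2 * P (merge X Y) - p (merge X Y) i - h (merge X Y) i := by
  have b1 := merge_P_even_le L.toSymm R.toSymm (L.toEvenP.merge_even R.toEvenP)
  rw [L.vP, R.vP] at b1
  have b2 := merge_p_even_even_le L.toEvenP R.toEvenP i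
  obtain ⟨j, b3⟩ := merge_h_le L.toSymm R.toSymm i
  refine nonneg_of_mul (d := 4) (by norm_num) ?_
  linear_combination
    8 * b1 + 4 * b2 + 4 * b3 + 8 * mul_nonneg (L.hn j) (R.hk j) + 4 * mul_nonneg (L.an i) (R.an i) +
    2 * mul_nonneg (L.an i) (R.gPph' j) + 16 * mul_nonneg L.gP (R.aP j) +
    mul_nonneg (L.hp i) (R.gPph i) + 8 * mul_nonneg (L.hn j) (R.hn j) +
    2 * mul_nonneg (pP X j) (R.gPph i) + mul_nonneg (L.gPph i) (R.gPph i) +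
    8 * mul_nonneg L.gP (pP Y j) + 6 * mul_nonneg (L.gPph i) R.u0 +
    2 * mul_nonneg (L.aP j) (R.hk i) + 2 * mul_nonneg (L.an i) (R.gPph i) +
    2 * mul_nonneg (L.aP i) (R.gPph' j) + 2 * mul_nonneg (L.gPph i) (R.hn j) +
    4 * mul_nonneg (pP X j) (R.hp i) + 2 * mul_nonneg (kn X i) (R.aP j) +
    8 * mul_nonneg L.gP (R.hn j) + 2 * mul_nonneg (L.gPph' j) (R.aP i) +
    8 * mul_nonneg (L.hk j) (R.hn j) + 2 * mul_nonneg (L.aP j) (kn Y i) +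
    4 * mul_nonneg (L.hp i) R.gP + 2 * mul_nonneg (L.hn j) (R.gPph i) +
    8 * mul_nonneg (pP X j) R.gP + 8 * mul_nonneg (L.hn j) R.gP + 8 * mul_nonneg (L.hk j) (R.hk j) +
    2 * mul_nonneg (L.gPph i) R.gP + 4 * mul_nonneg L.gP (R.hp i) +
    2 * mul_nonneg (L.gPph i) (pP Y j) + 16 * mul_nonneg (L.ah j) R.gP +
    2 * mul_nonneg (L.ah j) (R.hk i) + 16 * mul_nonneg L.gP (R.ah j) +
    16 * mul_nonneg (L.aP j) R.gP + 2 * mul_nonneg (L.hk i) (R.ah j) +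
    4 * mul_nonneg (L.hp i) (pP Y j) + 2 * mul_nonneg (kn X i) (R.ah j) +
    2 * mul_nonneg (L.hk i) (R.aP j) + 2 * mul_nonneg (L.ah j) (kn Y i) +
    2 * mul_nonneg (L.gPph' j) (R.an i) + 2 * mul_nonneg (L.aP i) (R.gPph i)

theorem EE.bound_merge_EE (L : EE u X) (R : EE w Y) :
    BoundEE (6 * (u * w)) (merge X Y) :=
  ⟨L.merge_EE_gP R, L.merge_EE_gpv R, L.merge_EE_gPph R⟩

theorem OO.merge_OO_gP (L : OO u X) (R : OO w Y) :
    0 ≤ 7 * (6 * (u * w)) - 6 * P (merge X Y) := by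
  have b1 := merge_P_even_le L.toSymm R.toSymm (L.toOddP.merge_odd R.toOddP)
  refine nonneg_of_mul (d := 8) (by norm_num) ?_
  linear_combination
    48 * b1 + 3 * mul_nonneg L.gPV R.gP + 12 * mul_nonneg L.kP R.gK + 6 * mul_nonneg L.kV R.gPV' +
    12 * mul_nonneg L.kV R.gK + 3 * mul_nonneg L.gPV' R.gP' + 9 * mul_nonneg L.gPV' R.kV +
    6 * mul_nonneg (kT X) R.gPV + 9 * mul_nonneg L.gPV R.kP + 6 * mul_nonneg (kT X) R.gPV' +
    48 * mul_nonneg L.gK (kT Y) + 6 * mul_nonneg L.kP R.gPV + 24 * mul_nonneg (kT X) R.gK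

theorem OO.merge_OO_gPK (L : OO u X) (R : OO w Y) :
    0 ≤ 4 * (6 * (u * w)) - 2 * P (merge X Y) - K (merge X Y) := by
  have b1 := merge_P_even_le L.toSymm R.toSymm (L.toOddP.merge_odd R.toOddP)
  obtain ⟨i, b2⟩ := merge_K_le L.toSymm R.toSymm
  rcases le_total (P X) (V X) with s1 | s1 <;>
    rw [← sub_nonneg] at s1
  · refine nonneg_of_mul (d := 240) (by norm_num) ?_
    linear_combination
      480 * b1 + 240 * b2 + 40 * mul_nonneg (L.gPKH' i) R.gPV' + 160 * mul_nonneg (L.gPKH' i) R.u0 +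
      80 * mul_nonneg (L.hp i) (R.gPKH i) + 96 * mul_nonneg L.u0 (kn Y i) +
      30 * mul_nonneg (L.hk i) (R.gPKH' i) + 240 * mul_nonneg s1 (R.hp i) +
      15 * mul_nonneg (kn X i) R.gPV' + 190 * mul_nonneg (L.hn i) (R.gPKH i) +
      36 * mul_nonneg L.gPV' (kn Y i) + 120 * mul_nonneg (L.gPKH' i) (R.hk i) +
      30 * mul_nonneg (kn X i) (R.hk i) + 60 * mul_nonneg L.gPV' (R.hv i) +
      80 * mul_nonneg s1 (R.gPKH i) + 180 * mul_nonneg s1 (R.hn i) +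
      60 * mul_nonneg (L.hp i) R.gPV +
      120 * mul_nonneg (L.hn i) (R.hk i) + 240 * mul_nonneg s1 R.kP +
      45 * mul_nonneg (kn X i) R.gPV + 24 * mul_nonneg s1 (kn Y i) + 60 * mul_nonneg s1 (R.hk i) +
      120 * mul_nonneg L.gPV' R.kP + 66 * mul_nonneg (kn X i) (kn Y i) +
      8 * mul_nonneg (L.gPKH' i) (kn Y i) + 30 * mul_nonneg (kn X i) (R.gPKH i) +
      20 * mul_nonneg (L.hv i) R.gPV + 120 * mul_nonneg L.kV R.gPV' +
      24 * mul_nonneg (L.hp i) (kn Y i) + 90 * mul_nonneg (L.hn i) (R.gPKH' i) +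
      50 * mul_nonneg (L.hk i) (R.gPKH i) + 40 * mul_nonneg (L.hv i) R.gPV' +
      120 * mul_nonneg (kn X i) R.u0 + 120 * mul_nonneg (L.hk i) (R.hk i) +
      60 * mul_nonneg L.gPV' (R.hp i) + 200 * mul_nonneg (L.gPKH' i) (R.hn i) +
      80 * mul_nonneg (L.hv i) (R.gPKH' i) + 24 * mul_nonneg (L.hv i) (kn Y i) +
      120 * mul_nonneg (L.hk i) (R.hn i)
  · refine nonneg_of_mul (d := 120) (by norm_num) ?_
    linear_combination
      240 * b1 + 120 * b2 + 25 * mul_nonneg (L.hk i) (R.gPKH' i) + 60 * mul_nonneg L.gPV R.kV +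
      18 * mul_nonneg L.gPV (kn Y i) + 4 * mul_nonneg (L.gPKH i) (kn Y i) +
      95 * mul_nonneg (L.hn i) (R.gPKH' i) + 60 * mul_nonneg (L.gPKH i) (R.hk i) +
      60 * mul_nonneg L.kP R.gPV + 25 * mul_nonneg (kn X i) (R.gPKH' i) +
      90 * mul_nonneg s1 (R.hn i) + 20 * mul_nonneg (kn X i) (R.hv i) +
      60 * mul_nonneg (L.hk i) (R.hn i) + 60 * mul_nonneg (L.hk i) (R.hk i) +
      15 * mul_nonneg (L.hk i) (R.gPKH i) + 30 * mul_nonneg L.gPV (R.hp i) +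
      12 * mul_nonneg s1 (kn Y i) + 20 * mul_nonneg (kn X i) (R.hp i) +
      40 * mul_nonneg s1 (R.gPKH' i) + 120 * mul_nonneg s1 R.kV + 48 * mul_nonneg L.u0 (kn Y i) +
      120 * mul_nonneg s1 (R.hv i) + 20 * mul_nonneg (L.gPKH i) R.gPV +
      45 * mul_nonneg (L.hn i) (R.gPKH i) + 30 * mul_nonneg L.gPV (R.hv i) +
      40 * mul_nonneg (kn X i) R.kV + 30 * mul_nonneg (L.hv i) R.gPV' +
      60 * mul_nonneg (L.hn i) (R.hk i) + 30 * mul_nonneg (L.hp i) (R.gPKH i) +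
      28 * mul_nonneg (kn X i) (kn Y i) + 100 * mul_nonneg (L.gPKH i) (R.hn i) +
      40 * mul_nonneg (L.hv i) (R.gPKH' i) + 80 * mul_nonneg (L.gPKH i) R.u0 +
      12 * mul_nonneg (L.hp i) (kn Y i) + 30 * mul_nonneg s1 (R.hk i) +
      30 * mul_nonneg (L.hp i) R.gPV + 12 * mul_nonneg (L.hv i) (kn Y i) +
      15 * mul_nonneg (kn X i) (R.gPKH i) + 10 * mul_nonneg (L.hp i) (R.gPKH' i)

theorem OO.merge_OO_gph (L : OO u X) (R : OO w Y) (i : ℤ) :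
    0 ≤ 6 * (6 * (u * w)) - 4 * p (merge X Y) i - h (merge X Y) i := by
  have b1 := merge_p_odd_odd_le L.toOddP R.toOddP i
  obtain ⟨j, b2⟩ := merge_h_le L.toSymm R.toSymm i
  refine nonneg_of_mul (d := 59808) (by norm_num) ?_
  linear_combination
    239232 * b1 + 59808 * b2 + 2239 * mul_nonneg L.gPV (kn Y i) +
    10158 * mul_nonneg (kn X i) (R.ah j) + 15216 * mul_nonneg (L.hv j) (ak Y i) +
    9348 * mul_nonneg (L.ah j) (R.gPKH i) + 5340 * mul_nonneg (ak X j) (R.gPKH i) +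
    29376 * mul_nonneg (pP X j) (ak Y j) + 7936 * mul_nonneg (L.ah j) (kn Y i) +
    18360 * mul_nonneg L.gPV' (R.hn j) + 15348 * mul_nonneg (L.aP i) (R.gPKH i) +
    1314 * mul_nonneg (L.gPKH' i) (R.gPKH' j) + 120924 * mul_nonneg (ak X i) (R.ah i) +
    14448 * mul_nonneg (L.gPKH i) (R.hn j) + 30432 * mul_nonneg (pP X j) (pP Y i) +
    4200 * mul_nonneg (L.hv j) (R.gPKH' i) + 57216 * mul_nonneg (L.ah i) R.gK +
    29376 * mul_nonneg (L.ah j) (R.aP j) + 2868 * mul_nonneg (pP X i) (vV Y i) +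
    16806 * mul_nonneg (vV X i) (R.av j) + 3704 * mul_nonneg (L.gPKH j) (R.aP i) +
    47640 * mul_nonneg (kn X j) (R.hv i) + 24491 * mul_nonneg L.gPV' (kn Y i) +
    7278 * mul_nonneg (L.gPKH i) (pP Y j) + 11022 * mul_nonneg (L.av i) (R.gPKH' i) +
    27202 * mul_nonneg (vV X i) (kn Y i) + 57690 * mul_nonneg (vV X i) (R.hv j) +
    29376 * mul_nonneg (ak X j) (pP Y j) + 6300 * mul_nonneg L.gPV (kn Y j) +
    25704 * mul_nonneg L.gPV (ak Y j) + 31494 * mul_nonneg (vV X i) (ak Y j) +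
    3078 * mul_nonneg (L.gPKH i) (ak Y j) + 26592 * mul_nonneg L.gK (R.hk j) +
    972 * mul_nonneg (vV X i) R.gPV' + 60864 * mul_nonneg (L.hv i) (R.hv i) +
    71280 * mul_nonneg L.gK (R.ah i) + 528 * mul_nonneg (L.ah j) (ak Y i) +
    4101 * mul_nonneg (L.hn j) (R.gPKH i) + 22824 * mul_nonneg (L.aP i) R.gPV +
    1354 * mul_nonneg (L.gPKH' j) (R.gPKH' i) + 54852 * mul_nonneg (L.hk j) (ak Y i) +
    3162 * mul_nonneg (L.gPKH i) (R.hk j) + 4200 * mul_nonneg (L.gPKH' i) (R.hv j) +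
    29376 * mul_nonneg (L.aP j) (R.ah j) + 1422 * mul_nonneg (L.hk j) (R.gPKH' i) +
    3138 * mul_nonneg (L.hk j) (R.gPKH' j) + 15216 * mul_nonneg (L.aP j) (ak Y i) +
    11610 * mul_nonneg (L.gPKH i) (R.ah j) + 59532 * mul_nonneg (ak X i) (R.hk j) +
    14688 * mul_nonneg (ak X i) (R.aP j) + 14688 * mul_nonneg (L.ah i) (R.ah j) +
    24234 * mul_nonneg (kn X i) R.gPV' + 17820 * mul_nonneg (pP X i) (ak Y i) +
    25704 * mul_nonneg (ak X j) R.gPV + 22824 * mul_nonneg L.gPV (R.aP i) +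
    94548 * mul_nonneg (L.av i) (vV Y i) + 22624 * mul_nonneg (L.aP j) (kn Y i) +
    2520 * mul_nonneg (L.gPKH' i) (R.hk j) + 3138 * mul_nonneg (L.hn j) (R.gPKH j) +
    396 * mul_nonneg L.gPV (pP Y i) + 3672 * mul_nonneg L.gPV' (R.av j) +
    136128 * mul_nonneg (L.hn i) (ak Y i) + 2676 * mul_nonneg (kn X j) R.gPV +
    9852 * mul_nonneg (L.aP i) (vV Y i) + 30432 * mul_nonneg (pP X i) (pP Y j) +
    28074 * mul_nonneg (L.gPKH' i) (R.hv i) + 118308 * mul_nonneg (L.ah i) (ak Y i) +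
    74220 * mul_nonneg (ak X i) (R.hn j) + 62328 * mul_nonneg (L.hn j) (vV Y i) +
    29766 * mul_nonneg (L.hv i) (R.gPKH' i) + 12462 * mul_nonneg (L.ah i) (R.gPKH i) +
    396 * mul_nonneg (pP X i) R.gPV + 33634 * mul_nonneg (L.gPKH' j) (R.hn i) +
    46512 * mul_nonneg (L.hv i) (kn Y j) + 15582 * mul_nonneg (L.hn j) R.gPV' +
    58752 * mul_nonneg (L.aP j) (R.aP j) + 9540 * mul_nonneg (pP X j) (R.gPKH i) +
    24336 * mul_nonneg (L.hk j) R.gK + 134832 * mul_nonneg (ak X i) (R.hn i) +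
    61200 * mul_nonneg (vV X i) (R.hn j) + 6538 * mul_nonneg (L.gPKH i) (R.ah i) +
    1584 * mul_nonneg (ak X i) R.u0 + 2754 * mul_nonneg (L.gPKH' i) (vV Y i) +
    4874 * mul_nonneg (L.gPKH' i) (R.gPKH' i) + 29376 * mul_nonneg (L.aP j) (R.gPKH j) +
    14688 * mul_nonneg (L.ah i) (R.gPKH j) + 12714 * mul_nonneg (L.gPKH' i) (R.av i) +
    6108 * mul_nonneg (L.hn i) (R.gPKH i) + 14688 * mul_nonneg (L.ah j) (R.ah i) +
    18360 * mul_nonneg (L.hv j) R.gPV' + 86688 * mul_nonneg (vV X i) (R.av i) +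
    70068 * mul_nonneg (L.hn j) (ak Y i) + 29376 * mul_nonneg (L.gPKH j) (R.aP j) +
    16416 * mul_nonneg (vV X i) (R.aP i) + 3762 * mul_nonneg (L.gPKH j) (R.gPKH i) +
    13908 * mul_nonneg (ak X i) (pP Y i) + 23860 * mul_nonneg (L.hn i) (vV Y i) +
    22470 * mul_nonneg (L.gPKH j) (R.hn i) + 24846 * mul_nonneg (kn X i) (R.aP j) +
    14638 * mul_nonneg (kn X i) (vV Y i) + 6354 * mul_nonneg (kn X i) (R.hv i) +
    3648 * mul_nonneg (L.gPKH i) (R.gPKH j) + 14688 * mul_nonneg (ak X i) (R.hv j) +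
    6752 * mul_nonneg (pP X j) (kn Y i) + 3510 * mul_nonneg (pP X i) (R.gPKH j) +
    3174 * mul_nonneg (L.hn i) R.gPV + 31088 * mul_nonneg (ak X j) (vV Y i) +
    38139 * mul_nonneg (L.hn i) (R.gPKH' j) + 16400 * mul_nonneg (L.av j) (vV Y i) +
    13689 * mul_nonneg (L.hn j) (R.gPKH' i) + 28746 * mul_nonneg (vV X i) (R.hn i) +
    18920 * mul_nonneg (L.gPKH j) (R.ah i) + 1544 * mul_nonneg (L.hv i) (kn Y i) +
    3672 * mul_nonneg (L.av j) R.gPV' + 58096 * mul_nonneg (L.hv j) (vV Y i) +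
    8730 * mul_nonneg (L.gPKH' i) (R.hn j) + 4994 * mul_nonneg (L.gPKH' i) (R.hn i) +
    18360 * mul_nonneg L.gPV' (R.hv j) + 11644 * mul_nonneg (L.gPKH i) (R.aP i) +
    3792 * mul_nonneg (vV X i) (R.gPKH' i) + 15021 * mul_nonneg (L.hn i) (R.gPKH j) +
    4530 * mul_nonneg (kn X i) (pP Y j) + 396 * mul_nonneg L.gPV (R.hn i)

theorem OO.bound_merge_OO (L : OO u X) (R : OO w Y) :
    BoundEO (6 * (u * w)) (merge X Y) :=
  ⟨L.merge_OO_gP R, L.merge_OO_gPK R, L.merge_OO_gph R⟩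

theorem OO.merge_OE_gP (L : OO u X) (R : OE w Y) :
    0 ≤ 3 * (6 * (u * w)) - P (merge X Y) := by
  have b1 := merge_P_even_le L.toSymm R.toSymm (L.toOddP.merge_odd R.toOddP)
  refine nonneg_of_mul (d := 96) (by norm_num) ?_
  linear_combination
    96 * b1 + 48 * mul_nonneg (kT X) R.gPK' + 36 * mul_nonneg L.kV R.gPK' +
    3 * mul_nonneg L.gPV' R.gPK' + 33 * mul_nonneg L.gPV' R.kV + 24 * mul_nonneg (kT X) R.kP +
    96 * mul_nonneg L.gK (kT Y) + 24 * mul_nonneg L.kP R.kP + 21 * mul_nonneg L.gPV R.kP +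
    32 * mul_nonneg L.u0 R.gPK + 8 * mul_nonneg (kT X) R.gPK + 8 * mul_nonneg L.kP R.gPK +
    11 * mul_nonneg L.gPV R.gPK + 12 * mul_nonneg L.kP R.gPK'

theorem OO.merge_OE_gpv (L : OO u X) (R : OE w Y) (i : ℤ) :
    0 ≤ 7 * (6 * (u * w)) - 2 * p (merge X Y) i - v (merge X Y) i := by
  have b1 := merge_N_le L.toSymm R.toSymm i
  have b2 := merge_p_odd_odd_le L.toOddP R.toOddP i
  rcases le_total (p X i) (v X i) with s1 | s1 <;>
    rw [← sub_nonneg] at s1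
  · rcases le_total (p Y i) (v Y i) with s2 | s2 <;>
      rw [← sub_nonneg] at s2
    · refine nonneg_of_mul (d := 801600) (by norm_num) ?_
      linear_combination
        801600 * b1 + 801600 * b2 + 99400 * mul_nonneg (L.hn i) (R.gpvh' i) +
        598650 * mul_nonneg L.gPV' (R.hv i) + 400800 * mul_nonneg (L.hv i) R.gPV +
        17850 * mul_nonneg (L.gPKH' i) (R.gpvh' i) + 801600 * mul_nonneg (L.an i) (ak Y i) +
        261600 * mul_nonneg (kn X i) s2 + 48576 * mul_nonneg (L.hv i) (R.av i) +
        78600 * mul_nonneg (ak X i) (R.hn i) + 6000 * mul_nonneg (L.an i) R.gPK' +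
        346224 * mul_nonneg s1 R.gK + 197400 * mul_nonneg (L.gPKH i) (R.hn i) +
        233100 * mul_nonneg (L.av i) (R.gpvh' i) + 97625 * mul_nonneg (L.gPKH i) (R.hv i) +
        394800 * mul_nonneg (kn X i) (ak Y i) + 217100 * mul_nonneg (ak X i) (R.hv i) +
        23025 * mul_nonneg (L.gPKH' i) (R.hv i) + 60800 * mul_nonneg s1 s2 +
        394800 * mul_nonneg (kn X i) (vV Y i) + 476400 * mul_nonneg (L.hn i) (vV Y i) +
        288600 * mul_nonneg (L.an i) (R.hn i) + 400800 * mul_nonneg s1 R.gPV +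
        677424 * mul_nonneg (L.hn i) R.gK + 203200 * mul_nonneg (L.aP i) s2 +
        304500 * mul_nonneg (L.gPKH' i) (R.hn i) + 48576 * mul_nonneg (L.hv i) (ak Y i) +
        35700 * mul_nonneg (ak X i) (R.gpvh' i) + 75600 * mul_nonneg (L.hn i) R.gPK' +
        35700 * mul_nonneg (vV X i) (R.gpvh' i) + 48576 * mul_nonneg (L.aP i) R.gK +
        123600 * mul_nonneg (kn X i) (R.hn i) + 280968 * mul_nonneg (L.hv i) (R.hn i) +
        394800 * mul_nonneg (ak X i) R.gPK' + 609000 * mul_nonneg (vV X i) (R.hn i) +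
        217532 * mul_nonneg (L.hv i) (R.gpvh' i) + 197400 * mul_nonneg (L.gPKH' i) R.gPK' +
        394800 * mul_nonneg (vV X i) R.gPK' + 113900 * mul_nonneg (L.an i) (R.gpvh' i) +
        394800 * mul_nonneg (kn X i) (R.av i) + 66600 * mul_nonneg (L.av i) (R.hn i) +
        400800 * mul_nonneg (L.aP i) R.gPV + 1040400 * mul_nonneg (vV X i) (R.hv i) +
        44704 * mul_nonneg (L.hv i) s2 + 24200 * mul_nonneg (kn X i) (R.hv i) +
        197400 * mul_nonneg (L.gPKH i) (vV Y i) + 449376 * mul_nonneg (L.an i) R.gK +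
        197400 * mul_nonneg (L.gPKH i) (R.av i) + 670800 * mul_nonneg (ak X i) s2 +
        406800 * mul_nonneg s1 (vV Y i) + 466200 * mul_nonneg (L.gPKH i) s2 +
        197400 * mul_nonneg (L.gPKH i) (ak Y i) + 100800 * mul_nonneg L.u0 R.u0
    · refine nonneg_of_mul (d := 55440) (by norm_num) ?_
      linear_combination
        55440 * b1 + 55440 * b2 + 8792 * mul_nonneg (L.an i) (R.gpvh i) +
        1680 * mul_nonneg L.gPV' (R.hn i) + 3456 * mul_nonneg (L.gPH' i) R.u0 +
        18480 * mul_nonneg (L.an i) (R.hn i) + 18480 * mul_nonneg (L.gPKH i) (R.hn i) +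
        18718 * mul_nonneg (L.hk i) (R.hn i) + 96908 * mul_nonneg (vV X i) (pP Y i) +
        2996 * mul_nonneg (L.hk i) (pP Y i) + 28536 * mul_nonneg (L.gPH' i) (R.hn i) +
        4410 * mul_nonneg (kn X i) (ak Y i) + 8820 * mul_nonneg (L.gPKH i) (ak Y i) +
        9240 * mul_nonneg (L.hv i) (R.gpvh i) + 36960 * mul_nonneg (L.hv i) s2 +
        19376 * mul_nonneg (ak X i) (R.hn i) + 4410 * mul_nonneg L.gPV' (ak Y i) +
        10262 * mul_nonneg (L.hk i) (ak Y i) + 112 * mul_nonneg (L.hv i) (kn Y i) +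
        32109 * mul_nonneg (L.gPKH i) (R.aP i) + 2772 * mul_nonneg (L.aP i) (R.aP i) +
        44331 * mul_nonneg (L.hn i) R.gPK + 33761 * mul_nonneg s1 R.gPK +
        35168 * mul_nonneg (L.aP i) (kn Y i) + 35280 * mul_nonneg (kn X i) (kn Y i) +
        33880 * mul_nonneg L.u0 R.gPK + 44583 * mul_nonneg (kn X i) (R.aP i) +
        23352 * mul_nonneg (vV X i) R.u0 + 16170 * mul_nonneg (L.gPKH i) (R.ah i) +
        8071 * mul_nonneg (L.gPKH i) R.gPK + 24220 * mul_nonneg (vV X i) (R.ah i) +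
        8071 * mul_nonneg (L.hk i) (R.gpvh i) + 4354 * mul_nonneg (ak X i) (ak Y i) +
        22050 * mul_nonneg s1 (ak Y i) + 42252 * mul_nonneg (vV X i) (R.hn i) +
        2310 * mul_nonneg (kn X i) (R.ah i) + 11564 * mul_nonneg (ak X i) (R.aP i) +
        27027 * mul_nonneg L.gPV' (R.aP i) + 51548 * mul_nonneg (vV X i) s2 +
        13230 * mul_nonneg (L.an i) (ak Y i) + 13230 * mul_nonneg L.gPV' (R.ah i) +
        55440 * mul_nonneg (L.hv i) R.gPV + 17584 * mul_nonneg (L.aP i) R.gPK +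
        54864 * mul_nonneg (L.gPH' i) s2 + 22932 * mul_nonneg (L.gPH' i) (R.ah i) +
        46648 * mul_nonneg (ak X i) (R.ah i) + 35280 * mul_nonneg L.gPV' (pP Y i) +
        5152 * mul_nonneg s1 (kn Y i) + 32284 * mul_nonneg (kn X i) R.gPK +
        22330 * mul_nonneg (vV X i) (R.aP i) + 5551 * mul_nonneg (L.hk i) (R.ah i) +
        3636 * mul_nonneg (L.gPH' i) (R.gpvh i) + 18928 * mul_nonneg (L.hn i) (R.gpvh i) +
        1484 * mul_nonneg (L.gPH' i) R.gPK
  · rcases le_total (p Y i) (v Y i) with s2 | s2 <;>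
      rw [← sub_nonneg] at s2
    · refine nonneg_of_mul (d := 640) (by norm_num) ?_
      linear_combination
        640 * b1 + 640 * b2 + 376 * mul_nonneg (L.hk i) (R.hn i) + 8 * mul_nonneg L.gPV (vV Y i) +
        205 * mul_nonneg (L.gPKH' i) (R.hv i) + 120 * mul_nonneg (L.hn i) (R.gpvh' i) +
        380 * mul_nonneg (L.ah i) (ak Y i) + 12 * mul_nonneg L.gPV (R.hv i) +
        536 * mul_nonneg (L.ah i) R.gPK + 10 * mul_nonneg (L.ah i) (R.gpvh' i) +
        5 * mul_nonneg (L.gPKH' i) (R.gpvh' i) + 258 * mul_nonneg s1 (kn Y i) +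
        312 * mul_nonneg (L.ah i) R.gPV' + 20 * mul_nonneg (ak X i) (R.hn i) +
        134 * mul_nonneg (L.gPKH' i) (R.hn i) + 960 * mul_nonneg (L.aP i) R.gPV' +
        472 * mul_nonneg (ak X i) (vV Y i) + 80 * mul_nonneg (L.gPH i) R.gPK +
        10 * mul_nonneg (L.gPKH i) (R.av i) + 34 * mul_nonneg s1 (R.gpvh' i) +
        240 * mul_nonneg (pP X i) (R.gpvh' i) + 468 * mul_nonneg (ak X i) (ak Y i) +
        76 * mul_nonneg s1 (R.hn i) + 208 * mul_nonneg (L.ah i) (R.an i) +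
        220 * mul_nonneg (pP X i) (ak Y i) + 32 * mul_nonneg (L.gPH i) (R.hk i) +
        474 * mul_nonneg s1 (R.av i) + 320 * mul_nonneg (L.aP i) R.gPK +
        708 * mul_nonneg (L.hn i) (vV Y i) + 54 * mul_nonneg (L.gPKH' i) (ak Y i) +
        1248 * mul_nonneg (L.aP i) (vV Y i) + 100 * mul_nonneg (L.hk i) (kn Y i) +
        120 * mul_nonneg (L.hk i) (R.gpvh' i) + 212 * mul_nonneg L.gPV (kn Y i) +
        406 * mul_nonneg s1 (ak Y i) + 56 * mul_nonneg L.u0 (R.hn i) +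
        270 * mul_nonneg (L.gPKH i) (R.hv i) + 110 * mul_nonneg (L.gPKH' i) R.gPK' +
        560 * mul_nonneg (L.gPH i) s2 + 304 * mul_nonneg (L.ah i) (R.av i) +
        20 * mul_nonneg (L.gPKH i) R.gPK' + 340 * mul_nonneg (kn X i) (R.hn i) +
        460 * mul_nonneg (kn X i) (R.hv i) + 520 * mul_nonneg (ak X i) R.gPK' +
        366 * mul_nonneg (L.hn i) (R.hn i) + 108 * mul_nonneg L.gPV (R.av i) +
        358 * mul_nonneg (L.gPKH i) (R.hn i) + 30 * mul_nonneg (L.ah i) (R.hv i) +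
        106 * mul_nonneg (L.gPKH' i) (vV Y i) + 700 * mul_nonneg (L.hn i) R.gPK' +
        112 * mul_nonneg (L.aP i) (ak Y i) + 48 * mul_nonneg (L.gPH i) (R.an i) +
        380 * mul_nonneg (kn X i) (R.av i) + 632 * mul_nonneg s1 R.gPK' +
        192 * mul_nonneg (L.hn i) (ak Y i)
    · refine nonneg_of_mul (d := 12) (by norm_num) ?_
      linear_combination
        12 * b1 + 12 * b2 + 9 * mul_nonneg (L.aP i) (R.aP i) + 6 * mul_nonneg (L.hn i) (kn Y i) +
        6 * mul_nonneg s1 (kn Y i) + 9 * mul_nonneg (L.aP i) (ak Y i) +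
        4 * mul_nonneg (L.ah i) (R.an i) + 6 * mul_nonneg (L.hk i) R.gK +
        12 * mul_nonneg (L.aP i) R.u0 + 6 * mul_nonneg (L.hn i) s2 + 6 * mul_nonneg s1 s2 +
        12 * mul_nonneg (L.aP i) R.gPK' + 6 * mul_nonneg (L.gPKH i) (R.aP i) +
        12 * mul_nonneg (L.hk i) (kh Y i) + 6 * mul_nonneg (L.gPKH i) (R.an i) +
        21 * mul_nonneg (L.gPKH' i) R.u0 + 3 * mul_nonneg (L.gPKH i) R.gK +
        12 * mul_nonneg (ak X i) (kn Y i) + 15 * mul_nonneg (L.aP i) R.gPK +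
        6 * mul_nonneg (kn X i) s2 + 6 * mul_nonneg (kn X i) (kn Y i) +
        8 * mul_nonneg (L.ah i) (ak Y i) + 12 * mul_nonneg s1 R.gPK' + 6 * mul_nonneg (L.aP i) s2 +
        48 * mul_nonneg (L.hn i) R.gK + 16 * mul_nonneg (L.ah i) R.gPK +
        3 * mul_nonneg (L.gPKH' i) s2 + 8 * mul_nonneg (L.ah i) (kn Y i) +
        12 * mul_nonneg (L.hn i) (ak Y i) + 12 * mul_nonneg (kn X i) R.gK +
        42 * mul_nonneg (kn X i) R.u0 + 8 * mul_nonneg (L.ah i) s2 +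
        18 * mul_nonneg (L.aP i) (kn Y i) + 12 * mul_nonneg (ak X i) (R.an i) +
        12 * mul_nonneg (L.hn i) (kh Y i) + 24 * mul_nonneg s1 R.u0 +
        3 * mul_nonneg (L.gPKH' i) (kn Y i) + 12 * mul_nonneg (ak X i) (R.aP i) +
        12 * mul_nonneg (L.ah i) R.gPK'

theorem OO.merge_OE_gPph (L : OO u X) (R : OE w Y) (i : ℤ) :
    0 ≤ 12 * (6 * (u * w)) - 2 * P (merge X Y) - p (merge X Y) i - h (merge X Y) i := by
  have b1 := merge_P_even_le L.toSymm R.toSymm (L.toOddP.merge_odd R.toOddP)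
  have b2 := merge_p_odd_odd_le L.toOddP R.toOddP i
  obtain ⟨j, b3⟩ := merge_h_le L.toSymm R.toSymm i
  rcases le_total (p Y i) (v Y i) with s2 | s2 <;>
    rw [← sub_nonneg] at s2
  · refine nonneg_of_mul (d := 414999061920) (by norm_num) ?_
    linear_combination
      829998123840 * b1 + 414999061920 * b2 + 414999061920 * b3 +
      95302937775 * mul_nonneg (L.gPKH j) (R.hn j) + 157567000820 * mul_nonneg (vV X i) (R.hv j) +
      124371326880 * mul_nonneg (ak X i) (kn Y i) + 91276768080 * mul_nonneg (L.hv j) R.gPK' +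
      272931817240 * mul_nonneg (L.ah j) s2 + 49928172895 * mul_nonneg (L.ah j) (R.hn j) +
      622498592880 * mul_nonneg (L.aP i) R.gPV + 19732255050 * mul_nonneg (L.aP j) (R.hv i) +
      7139861424 * mul_nonneg L.gPV' (vV Y i) + 330935240380 * mul_nonneg (ak X i) R.gPV +
      162618675470 * mul_nonneg (L.ah i) R.gPV + 123247771680 * mul_nonneg (L.gPKH j) (R.ah j) +
      252385336200 * mul_nonneg (L.gPKH j) s2 + 22219104364 * mul_nonneg (L.hv i) (R.hn i) +
      13144182760 * mul_nonneg (L.aP j) (R.gpvh j) + 226899411338 * mul_nonneg (L.gPKH j) (R.hn i) +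
      54886373400 * mul_nonneg (L.aP j) (kn Y i) + 60444184020 * mul_nonneg (L.hn j) (kn Y j) +
      5106631750 * mul_nonneg (L.hn i) (R.gpvh' i) + 207017993520 * mul_nonneg (pP X i) (pP Y j) +
      158291602880 * mul_nonneg (L.ah j) R.gK + 240450794715 * mul_nonneg (kn X i) (R.hn j) +
      5106631750 * mul_nonneg (kn X i) (R.hn i) + 21912142642 * mul_nonneg (kn X j) (R.hn i) +
      68605451820 * mul_nonneg (L.av j) (R.hn i) + 283484717910 * mul_nonneg L.gPV' R.kV +
      100322353240 * mul_nonneg (L.gPKH' i) (R.hv j) + 50358905820 * mul_nonneg (ak X j) (R.hn i) +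
      193048357920 * mul_nonneg (vV X i) (R.hv i) + 60339630360 * mul_nonneg (kn X j) R.kV +
      113763819600 * mul_nonneg (ak X i) (R.hv j) + 101373169166 * mul_nonneg (vV X i) (R.hn i) +
      208040417100 * mul_nonneg (L.gPKH j) (R.hv i) + 90749529760 * mul_nonneg (L.ah j) (pP Y j) +
      1485709050 * mul_nonneg (L.av j) (R.gpvh' i) + 496024500540 * mul_nonneg (L.ah i) R.gK +
      45374764880 * mul_nonneg (L.ah j) R.gPV + 35746422250 * mul_nonneg (L.hk i) (vV Y i) +
      110838364365 * mul_nonneg (L.gPKH' i) (R.hn j) + 155932190740 * mul_nonneg (L.hn i) (pP Y j) +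
      115629808380 * mul_nonneg (pP X j) (vV Y j) + 7887839490 * mul_nonneg L.gPV' (R.hv j) +
      414999061920 * mul_nonneg (L.hn i) (ak Y i) + 57729565198 * mul_nonneg (L.hk j) R.kV +
      413988336000 * mul_nonneg (pP X i) R.gK + 960031700160 * mul_nonneg (L.hn i) R.gK +
      43345888260 * mul_nonneg (L.aP i) (kn Y j) + 94618172640 * mul_nonneg (ak X j) (kn Y j) +
      110862297750 * mul_nonneg (kn X j) (R.hv i) + 103749765480 * mul_nonneg (L.gPKH' i) R.gPK' +
      5258559660 * mul_nonneg (L.ah i) (R.ah j) + 76327659570 * mul_nonneg (L.hv j) (R.hv i) +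
      55216451970 * mul_nonneg (L.gPKH' i) (vV Y i) + 22247074710 * mul_nonneg L.gPV' (kn Y j) +
      131267707800 * mul_nonneg (L.hk i) R.gPK' + 154935504600 * mul_nonneg (vV X i) (R.hn j) +
      198464831934 * mul_nonneg (L.aP j) (vV Y i) + 177549124950 * mul_nonneg (L.aP i) (vV Y i) +
      60444184020 * mul_nonneg (L.hv j) (kn Y j) + 73369842776 * mul_nonneg (L.hn j) (vV Y i) +
      15656532980 * mul_nonneg (kn X i) R.gPV + 123247771680 * mul_nonneg (L.gPKH j) (R.aP j) +
      136814577120 * mul_nonneg (kn X i) R.gPV' + 2627063440 * mul_nonneg (L.hv i) (R.hv j) +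
      8899215180 * mul_nonneg (pP X j) (kn Y i) + 48604447920 * mul_nonneg (ak X i) (vV Y j) +
      29467688822 * mul_nonneg (L.hk j) (kn Y i) + 55216451970 * mul_nonneg (L.hv i) (vV Y i) +
      157109707860 * mul_nonneg (L.ah i) (pP Y j) + 545811961020 * mul_nonneg (L.hv i) R.gPK' +
      18401634225 * mul_nonneg (ak X j) (R.hn j) + 6236498700 * mul_nonneg (L.hv j) (R.gpvh' i) +
      344548550035 * mul_nonneg (L.hn i) (R.hn j) + 17112472614 * mul_nonneg (L.gPKH' i) (R.hn i) +
      58524517320 * mul_nonneg (vV X i) R.gPK' + 81490649940 * mul_nonneg (L.hn j) (R.gpvh' i) +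
      208586790020 * mul_nonneg (L.hn j) (R.hn i) + 30305345740 * mul_nonneg (pP X j) (R.hv j) +
      132790971360 * mul_nonneg (L.aP j) (pP Y j) + 15319895250 * mul_nonneg (L.ah i) s2 +
      414999061920 * mul_nonneg (L.ah i) (ak Y i) + 338975922714 * mul_nonneg (L.hv j) (vV Y i) +
      253593869280 * mul_nonneg (kn X i) (R.ah j) + 100071429600 * mul_nonneg (L.gPKH j) R.gK +
      66638377140 * mul_nonneg (vV X i) (vV Y i) + 17707305840 * mul_nonneg (L.hk j) R.gPK' +
      55185624360 * mul_nonneg (L.ah j) (R.aP j) + 80006993180 * mul_nonneg (L.ah j) (kn Y i) +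
      69456084390 * mul_nonneg (L.av i) (R.gpvh' i) + 109322703720 * mul_nonneg (L.hv i) (kn Y j) +
      66395485680 * mul_nonneg (L.aP j) R.gPV + 68677031040 * mul_nonneg (ak X i) s2 +
      192408976614 * mul_nonneg (L.gPKH j) (vV Y i) + 35971466852 * mul_nonneg (L.hk j) (R.hv i) +
      248335309620 * mul_nonneg (vV X i) (vV Y j) + 22687382440 * mul_nonneg (L.gPKH j) (R.gpvh j) +
      38552810460 * mul_nonneg (L.av j) R.gPK' + 52082488920 * mul_nonneg (L.hv i) (vV Y j) +
      60531361830 * mul_nonneg L.gPV' (vV Y j) + 52048877660 * mul_nonneg (L.hn i) (R.gpvh j) +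
      35562797205 * mul_nonneg (pP X j) (R.hn j) + 253593869280 * mul_nonneg (kn X i) (R.aP j) +
      5258559660 * mul_nonneg (L.ah i) (R.aP j) + 55185624360 * mul_nonneg (L.ah j) (R.ah j) +
      138891300674 * mul_nonneg (L.ah j) (vV Y i) + 66517378650 * mul_nonneg L.gPV' (R.hv i) +
      19445175220 * mul_nonneg (pP X i) R.gPV + 81248844180 * mul_nonneg (kn X i) R.kV +
      324059833820 * mul_nonneg (L.hn i) R.gPV' + 119022379260 * mul_nonneg (ak X i) (R.hn j) +
      313327564920 * mul_nonneg (L.aP j) s2 + 69456084390 * mul_nonneg (ak X i) (R.hn i) +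
      12560178372 * mul_nonneg L.gPV' (R.hn i)
  · refine nonneg_of_mul (d := 49140) (by norm_num) ?_
    linear_combination
      98280 * b1 + 49140 * b2 + 49140 * b3 + 28050 * mul_nonneg (L.aP i) (ak Y i) +
      14940 * mul_nonneg (kn X j) (R.an i) + 29526 * mul_nonneg (L.aP i) R.gPK +
      13320 * mul_nonneg (L.aP j) (kn Y j) + 51954 * mul_nonneg (L.aP j) R.gPK +
      12200 * mul_nonneg (L.ah j) (pP Y i) + 30120 * mul_nonneg L.gPV' (pP Y i) +
      13320 * mul_nonneg (ak X j) (kn Y j) + 7755 * mul_nonneg (L.gPKH j) (ak Y i) +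
      7510 * mul_nonneg (L.gPKH' i) (kn Y i) + 25025 * mul_nonneg (L.hk j) R.gPK +
      46361 * mul_nonneg (L.hn i) R.gPK + 8515 * mul_nonneg (L.hn i) (kn Y i) +
      20685 * mul_nonneg (L.hv j) R.gPK + 21090 * mul_nonneg (vV X i) (R.aP i) +
      1155 * mul_nonneg L.gPV' (kn Y i) + 2814 * mul_nonneg (vV X i) (pP Y j) +
      9150 * mul_nonneg (kn X j) (R.hv j) + 6660 * mul_nonneg (kn X j) (kn Y j) +
      20400 * mul_nonneg (ak X j) (ak Y i) + 16060 * mul_nonneg (vV X j) s2 +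
      810 * mul_nonneg (L.hv i) R.gK + 15615 * mul_nonneg (L.aP j) (R.aP i) +
      13530 * mul_nonneg (L.hv i) (pP Y i) + 49140 * mul_nonneg (ak X i) (R.an i) +
      23275 * mul_nonneg (vV X i) s2 + 159960 * mul_nonneg (L.hn j) R.gK +
      6660 * mul_nonneg (L.hn j) (kn Y j) + 6660 * mul_nonneg (L.gPKH j) (R.aP j) +
      6660 * mul_nonneg (L.gPKH' i) (vV Y j) + 7770 * mul_nonneg (L.hn i) (pP Y j) +
      18120 * mul_nonneg (L.gPKH j) (R.an i) + 6660 * mul_nonneg (L.gPKH j) (R.an j) +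
      13320 * mul_nonneg (L.hk j) (pP Y j) + 6375 * mul_nonneg (L.hv j) (ak Y i) +
      17355 * mul_nonneg (L.hv i) R.gPV' + 36855 * mul_nonneg L.gPV' (R.aP i) +
      3330 * mul_nonneg (L.gPKH' i) R.gPV' + 35855 * mul_nonneg (L.aP j) (kn Y i) +
      8515 * mul_nonneg (kn X i) (kn Y i) + 14 * mul_nonneg (L.hn j) R.gPK +
      16110 * mul_nonneg (L.hn j) (ak Y i) + 21090 * mul_nonneg (kn X i) (R.an j) +
      25865 * mul_nonneg (L.hv i) s2 + 7215 * mul_nonneg (vV X i) R.gPV' +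
      17510 * mul_nonneg (kn X j) s2 + 1110 * mul_nonneg (L.hv j) (R.hn j) +
      666 * mul_nonneg (vV X i) R.gK + 1110 * mul_nonneg (L.hv j) (R.hv j) +
      16134 * mul_nonneg (vV X i) (R.hv j) + 29245 * mul_nonneg (ak X j) (kn Y i) +
      6375 * mul_nonneg (L.hv j) (R.aP i) + 34860 * mul_nonneg (L.gPKH' i) (R.an i) +
      5550 * mul_nonneg (L.hn j) (pP Y j) + 44700 * mul_nonneg (L.gPKH' i) s2 +
      1110 * mul_nonneg (vV X j) (pP Y j) + 6810 * mul_nonneg (L.hn i) (R.aP i) +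
      16835 * mul_nonneg (kn X i) R.gPK + 49140 * mul_nonneg L.kV R.gPV' +
      1940 * mul_nonneg (L.ah j) (kn Y i) + 16134 * mul_nonneg (vV X i) (R.hn j) +
      9150 * mul_nonneg (kn X j) (R.hn j) + 1110 * mul_nonneg L.kV (kn Y j) +
      30149 * mul_nonneg (vV X j) R.gPK + 8610 * mul_nonneg (ak X j) (R.aP i) +
      1170 * mul_nonneg (L.hk j) (R.an i) + 68299 * mul_nonneg (L.ah j) R.gPK +
      14430 * mul_nonneg (vV X i) (vV Y j) + 28050 * mul_nonneg (L.ah i) (ak Y i) +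
      21090 * mul_nonneg (kn X i) (R.aP j) + 3340 * mul_nonneg (L.hn j) (kn Y i) +
      49140 * mul_nonneg (L.hn j) (kh Y i) + 28050 * mul_nonneg (L.hn i) (kn Y j) +
      40815 * mul_nonneg (L.gPKH j) (R.aP i) + 8040 * mul_nonneg (L.hv j) (kn Y i) +
      27405 * mul_nonneg (L.aP j) (ak Y i) + 1380 * mul_nonneg (kn X j) (pP Y j) +
      28020 * mul_nonneg (L.av j) R.gK + 34710 * mul_nonneg (L.hv i) (vV Y j) +
      35610 * mul_nonneg (vV X i) (pP Y i) + 29526 * mul_nonneg (L.ah i) R.gPK +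
      1920 * mul_nonneg (vV X j) R.gK + 25550 * mul_nonneg (L.hv j) s2 +
      34860 * mul_nonneg (kn X i) (R.aP i) + 20685 * mul_nonneg (L.gPKH j) R.gPK +
      35820 * mul_nonneg (L.aP i) (pP Y j) + 35820 * mul_nonneg (L.ah i) (pP Y j) +
      16340 * mul_nonneg (L.gPKH' i) (pP Y i) + 55850 * mul_nonneg (L.hk j) (pP Y i) +
      6975 * mul_nonneg L.gPV' (ak Y i) + 2860 * mul_nonneg (L.aP j) (pP Y i) +
      6100 * mul_nonneg (ak X j) s2 + 49140 * mul_nonneg (L.hn i) (R.hn j) +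
      1430 * mul_nonneg (L.av j) s2

theorem OO.bound_merge_OE (L : OO u X) (R : OE w Y) :
    BoundEE (6 * (u * w)) (merge X Y) :=
  ⟨L.merge_OE_gP R, L.merge_OE_gpv R, L.merge_OE_gPph R⟩

theorem OE.merge_OE_gP (L : OE u X) (R : OE w Y) :
    0 ≤ 7 * (36 * (u * w)) - 6 * P (merge X Y) := by
  have b1 := merge_P_even_le L.toSymm R.toSymm (L.toOddP.merge_odd R.toOddP)
  linear_combination
    6 * b1 + 3 * mul_nonneg L.kP R.gK + 3 * mul_nonneg L.kP R.kP + 3 * mul_nonneg L.gPK' R.kV +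
    3 * mul_nonneg L.gPK R.kP + 3 * mul_nonneg L.kV R.gPV' + 3 * mul_nonneg L.gPK' (kT Y) +
    6 * mul_nonneg (kT X) R.gK + 3 * mul_nonneg L.gPK R.gK

theorem OE.merge_OE_gPK (L : OE u X) (R : OE w Y) :
    0 ≤ 4 * (36 * (u * w)) - 2 * P (merge X Y) - K (merge X Y) := by
  have b1 := merge_P_even_le L.toSymm R.toSymm (L.toOddP.merge_odd R.toOddP)
  obtain ⟨i, b2⟩ := merge_K_le L.toSymm R.toSymm
  rcases le_total (P X) (V X) with s1 | s1 <;>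
    rw [← sub_nonneg] at s1
  · refine nonneg_of_mul (d := 7056) (by norm_num) ?_
    linear_combination
      14112 * b1 + 7056 * b2 + 511 * mul_nonneg L.kV (R.hv i) + 1932 * mul_nonneg L.gPV' (pP Y i) +
      1764 * mul_nonneg (L.gpvh' i) (pP Y i) + 8568 * mul_nonneg L.gPK' (R.hv i) +
      1764 * mul_nonneg (L.gpvh' i) (R.hn i) + 7716 * mul_nonneg s1 R.kP +
      1032 * mul_nonneg (L.hn i) R.gPK + 6132 * mul_nonneg L.kV R.gPV' +
      11172 * mul_nonneg s1 R.gPK + 2352 * mul_nonneg (L.hk i) (R.gpvh i) +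
      2317 * mul_nonneg (L.hn i) (R.hp i) + 7032 * mul_nonneg (L.hv i) R.gK +
      1764 * mul_nonneg (L.gpvh' i) (R.hv i) + 13224 * mul_nonneg (L.hn i) R.gK +
      1596 * mul_nonneg L.gPV' (kn Y i) + 3472 * mul_nonneg s1 (R.hn i) +
      4410 * mul_nonneg s1 (R.hp i) + 1596 * mul_nonneg L.gPV' (R.hp i) +
      168 * mul_nonneg (L.hk i) R.gPK + 1470 * mul_nonneg s1 (R.gpvh i) +
      1848 * mul_nonneg L.kV R.gPV + 1359 * mul_nonneg (L.hn i) (R.gpvh i) +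
      28 * mul_nonneg L.kV (R.gpvh i) + 1752 * mul_nonneg (L.hv i) R.gPV +
      2652 * mul_nonneg (L.hv i) R.gPV' + 9240 * mul_nonneg (pP X i) R.gPK +
      1324 * mul_nonneg (L.hn i) (R.gpvh' i) + 10430 * mul_nonneg L.gPK' (R.hn i) +
      1281 * mul_nonneg L.kV (R.gpvh' i) + 1848 * mul_nonneg L.kV (kn Y i) +
      8772 * mul_nonneg L.gPV' R.kP + 4452 * mul_nonneg L.gPK' (pP Y i) +
      3640 * mul_nonneg (L.hk i) (R.hn i) + 5626 * mul_nonneg (L.hn i) (R.hn i) +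
      2208 * mul_nonneg (pP X i) R.kP + 12096 * mul_nonneg L.gPK' R.gK
  · refine nonneg_of_mul (d := 141120) (by norm_num) ?_
    linear_combination
      282240 * b1 + 141120 * b2 + 201530 * mul_nonneg L.gPK (R.hn i) +
      43200 * mul_nonneg (vV X i) R.kV + 180576 * mul_nonneg (L.hn i) R.gK +
      39480 * mul_nonneg L.gPV' (vV Y i) + 24290 * mul_nonneg L.kP (R.gpvh i) +
      125160 * mul_nonneg L.kP R.gPV + 6444 * mul_nonneg (L.hn i) (R.hp i) +
      170415 * mul_nonneg L.gPK (R.hp i) + 45360 * mul_nonneg (L.hk i) (R.gpvh' i) +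
      34020 * mul_nonneg (L.hn i) (R.gpvh i) + 42400 * mul_nonneg s1 (R.hn i) +
      191520 * mul_nonneg (vV X i) R.gPK' + 93240 * mul_nonneg L.gPK (vV Y i) +
      2205 * mul_nonneg L.gPK (R.gpvh i) + 76720 * mul_nonneg (L.hk i) (R.hn i) +
      47880 * mul_nonneg L.kP (kn Y i) + 11520 * mul_nonneg s1 (R.hv i) +
      51120 * mul_nonneg (L.hp i) R.gPV + 9870 * mul_nonneg L.kP (R.hp i) +
      94504 * mul_nonneg (L.hn i) (R.hn i) + 31920 * mul_nonneg L.kP R.gPV' +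
      234360 * mul_nonneg L.gPK R.gK + 35280 * mul_nonneg (L.gpvh i) (vV Y i) +
      108864 * mul_nonneg (L.hn i) R.gPK' + 38880 * mul_nonneg (L.hp i) R.gPV' +
      35280 * mul_nonneg (L.gpvh i) (R.hp i) + 179880 * mul_nonneg L.gPV' R.kV +
      148320 * mul_nonneg (L.hp i) R.gK + 7200 * mul_nonneg s1 (R.gpvh' i) +
      85824 * mul_nonneg (L.hn i) (vV Y i) + 35280 * mul_nonneg (L.gpvh i) (R.hn i) +
      267840 * mul_nonneg s1 R.gPK' + 31680 * mul_nonneg s1 (vV Y i) +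
      21000 * mul_nonneg L.gPV' (kn Y i) + 140 * mul_nonneg L.kP (R.hv i) +
      28560 * mul_nonneg L.gPV' (R.hv i)

theorem OE.merge_OE_gph (L : OE u X) (R : OE w Y) (i : ℤ) :
    0 ≤ 6 * (36 * (u * w)) - 4 * p (merge X Y) i - h (merge X Y) i := by
  have b1 := merge_p_odd_odd_le L.toOddP R.toOddP i
  obtain ⟨j, b2⟩ := merge_h_le L.toSymm R.toSymm i
  rcases le_total (P X) (V X) with s1 | s1 <;>
    rw [← sub_nonneg] at s1
  · refine nonneg_of_mul (d := 561968) (by norm_num) ?_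
    linear_combination
      2247872 * b1 + 561968 * b2 + 1110668 * mul_nonneg s1 (ak Y i) +
      1029056 * mul_nonneg (L.an i) R.gPK + 572880 * mul_nonneg L.gPK' (R.hv i) +
      109120 * mul_nonneg (pP X j) (R.hn i) + 561968 * mul_nonneg (kh X i) (R.hn j) +
      309008 * mul_nonneg L.gPK' (R.ah j) + 88788 * mul_nonneg (L.an i) (pP Y j) +
      209848 * mul_nonneg (vV X i) (kn Y j) + 1781632 * mul_nonneg L.gPK' (R.hn j) +
      655716 * mul_nonneg (vV X i) (R.av i) + 247008 * mul_nonneg (L.an i) (R.ah i) +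
      1657136 * mul_nonneg (L.av i) (vV Y i) + 568912 * mul_nonneg (L.hv j) (vV Y i) +
      44144 * mul_nonneg (L.hv j) (R.hk j) + 44144 * mul_nonneg (L.hn j) (R.hk j) +
      664144 * mul_nonneg (pP X j) R.gPK + 1078800 * mul_nonneg L.gPK' (R.hk j) +
      10944 * mul_nonneg L.gPV' R.gPK + 264864 * mul_nonneg L.gPV' (kn Y j) +
      88288 * mul_nonneg s1 (R.ah j) + 393824 * mul_nonneg L.gPK' (R.hv j) +
      128335 * mul_nonneg (ak X i) (R.gpvh' i) + 1005398 * mul_nonneg (vV X i) (R.hv j) +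
      44144 * mul_nonneg (L.hv j) (pP Y j) + 831048 * mul_nonneg (L.av i) R.gPV' +
      63240 * mul_nonneg (ak X i) (R.gpvh' j) + 395917 * mul_nonneg (ak X i) (R.hv i) +
      842952 * mul_nonneg L.gPV' (R.aP i) + 561968 * mul_nonneg (kn X i) (R.ah j) +
      82836 * mul_nonneg (vV X i) (R.hn i) + 44144 * mul_nonneg (L.hv j) (R.gpvh' j) +
      311988 * mul_nonneg (vV X i) (R.ah i) + 383172 * mul_nonneg (ak X i) R.gPV' +
      491040 * mul_nonneg L.gPV' (kn Y i) + 98208 * mul_nonneg s1 (R.ah i) +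
      24790 * mul_nonneg (vV X i) (R.gpvh' j) + 561968 * mul_nonneg (L.hn j) (R.hn i) +
      6944 * mul_nonneg (L.an i) (R.hn i) + 190072 * mul_nonneg (vV X i) (R.aP i) +
      309008 * mul_nonneg L.gPK' (R.aP j) + 163680 * mul_nonneg s1 (R.hn i) +
      857068 * mul_nonneg (ak X i) (R.ah i) + 109120 * mul_nonneg (L.hv j) (R.gpvh' i) +
      4960 * mul_nonneg (L.av i) (R.gpvh' j) + 517324 * mul_nonneg (L.hn j) (pP Y j) +
      728652 * mul_nonneg (ak X i) (R.hn j) + 1316632 * mul_nonneg s1 (R.aP i) +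
      1145760 * mul_nonneg L.gPK' (R.hn i) + 10912 * mul_nonneg (L.av i) (R.hv i) +
      109120 * mul_nonneg (L.hn j) (R.gpvh' i) + 4960 * mul_nonneg (L.aP i) (pP Y j) +
      306528 * mul_nonneg (L.hv j) R.gPV' + 343728 * mul_nonneg L.gPK' (R.ah i) +
      980608 * mul_nonneg (vV X i) (R.hn j) + 539400 * mul_nonneg L.gPK' R.gPV' +
      196416 * mul_nonneg L.gPV' (R.ah i) + 443424 * mul_nonneg (pP X j) (kn Y i) +
      766344 * mul_nonneg (ak X i) (R.hk j) + 102776 * mul_nonneg (L.hk j) (ak Y i) +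
      323268 * mul_nonneg (L.aP i) (ak Y i) + 176576 * mul_nonneg (pP X j) (kn Y j) +
      561968 * mul_nonneg (kn X j) (R.hv i) + 398288 * mul_nonneg s1 (pP Y i) +
      10912 * mul_nonneg (vV X i) (pP Y i) + 445904 * mul_nonneg (pP X j) (pP Y i) +
      473180 * mul_nonneg (L.hk j) (pP Y j) + 25548 * mul_nonneg (ak X i) (R.hv j) +
      1353802 * mul_nonneg (ak X i) (R.hn i) + 468720 * mul_nonneg s1 (pP Y j) +
      410564 * mul_nonneg L.gPK' (ak Y i) + 88288 * mul_nonneg s1 (R.aP j) +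
      102776 * mul_nonneg (L.hn j) (ak Y i) + 84816 * mul_nonneg L.gPK' (pP Y j) +
      200884 * mul_nonneg L.gPK' R.gPK + 306528 * mul_nonneg (L.hn j) R.gPV' +
      561968 * mul_nonneg (kn X j) (R.hn i) + 879764 * mul_nonneg (L.aP i) R.gPK +
      44144 * mul_nonneg (L.hn j) (R.gpvh' j) + 802492 * mul_nonneg s1 R.gPK +
      568912 * mul_nonneg (L.hn j) (vV Y i) + 88288 * mul_nonneg s1 (R.hn j) +
      233120 * mul_nonneg (L.av i) (kn Y j) + 1467064 * mul_nonneg (L.an i) (ak Y i) +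
      4960 * mul_nonneg (L.av i) (R.hk j) + 561968 * mul_nonneg (kn X i) (R.aP j)
  · refine nonneg_of_mul (d := 252) (by norm_num) ?_
    linear_combination
      1008 * b1 + 252 * b2 + 252 * mul_nonneg (kn X i) (R.aP j) + 231 * mul_nonneg L.gPK R.gPK +
      252 * mul_nonneg (kn X i) (R.ah j) + 636 * mul_nonneg (vV X i) (ak Y i) +
      336 * mul_nonneg (L.an i) R.gPK' + 525 * mul_nonneg L.gPK (R.aP i) +
      588 * mul_nonneg (ak X i) (R.an i) + 252 * mul_nonneg (L.an j) (kn Y i) +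
      378 * mul_nonneg (L.aP i) R.gPV' + 756 * mul_nonneg L.gPK (R.an i) +
      126 * mul_nonneg L.gPV' R.gPK' + 126 * mul_nonneg (ak X i) (R.aP i) +
      588 * mul_nonneg (vV X i) R.gPK' + 168 * mul_nonneg L.gPK (R.av i) +
      252 * mul_nonneg (L.an i) R.gPK + 224 * mul_nonneg s1 (vV Y i) +
      147 * mul_nonneg L.gPK (ak Y i) + 420 * mul_nonneg (L.aP i) (vV Y i) +
      252 * mul_nonneg s1 (R.av i) + 252 * mul_nonneg (kn X j) (R.aP i) +
      14 * mul_nonneg L.gPV' (vV Y i) + 252 * mul_nonneg s1 (vV Y j) +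
      198 * mul_nonneg L.gPV' (ak Y i) + 252 * mul_nonneg (vV X j) R.gPK' +
      252 * mul_nonneg (L.an i) (pP Y j) + 84 * mul_nonneg (ak X i) R.gPK +
      252 * mul_nonneg (L.aP j) (kn Y i) + 252 * mul_nonneg (kh X i) (R.hn j) +
      378 * mul_nonneg (L.aP i) R.gPK + 1008 * mul_nonneg (vV X i) (R.av i) +
      126 * mul_nonneg (ak X i) R.gPV' + 252 * mul_nonneg (L.hn j) (R.hn i) +
      252 * mul_nonneg (L.aP i) (kn Y j) + 252 * mul_nonneg (pP X j) (R.an i) +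
      588 * mul_nonneg s1 R.gPK' + 252 * mul_nonneg (vV X j) (vV Y i) +
      252 * mul_nonneg (ak X i) (vV Y j) + 90 * mul_nonneg (L.aP i) (ak Y i) +
      636 * mul_nonneg (L.an i) (ak Y i) + 252 * mul_nonneg (L.an j) R.gPK +
      378 * mul_nonneg L.gPV' (R.av i) + 492 * mul_nonneg s1 (ak Y i) +
      252 * mul_nonneg (vV X j) (ak Y i) + 252 * mul_nonneg (L.aP j) R.gPK +
      252 * mul_nonneg (vV X i) (vV Y j) + 1568 * mul_nonneg L.u0 (vV Y i)

theorem OE.bound_merge_OE (L : OE u X) (R : OE w Y) :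
    BoundEO (36 * (u * w)) (merge X Y) :=
  ⟨L.merge_OE_gP R, L.merge_OE_gPK R, L.merge_OE_gph R⟩

theorem OO.merge_EO (L : OO u X) (R : EO w Y) : OE (u * w) (merge X Y) where
  toOddP := L.toOddP.merge_even R.toEvenP
  toBoundOE := L.bound_merge_EO R
  u0 := by have := mul_nonneg L.u0 R.u0; linarith
  bneg := by rw [neg_merge]; exact L.neg.bound_merge_EO R.neg

theorem OO.merge_EE (L : OO u X) (R : EE w Y) : OO (6 * (u * w)) (merge X Y) where
  toOddP := L.toOddP.merge_even R.toEvenP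
  toBoundOO := L.bound_merge_EE R
  u0 := by have := mul_nonneg L.u0 R.u0; linarith
  bneg := by rw [neg_merge]; exact L.neg.bound_merge_EE R.neg

theorem OE.merge_EO (L : OE u X) (R : EO w Y) : OO (6 * (u * w)) (merge X Y) where
  toOddP := L.toOddP.merge_even R.toEvenP
  toBoundOO := L.bound_merge_EO R
  u0 := by have := mul_nonneg L.u0 R.u0; linarith
  bneg := by rw [neg_merge]; exact L.neg.bound_merge_EO R.neg

theorem OE.merge_EE (L : OE u X) (R : EE w Y) : OE (6 * (u * w)) (merge X Y) where
  toOddP := L.toOddP.merge_even R.toEvenP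
  toBoundOE := L.bound_merge_EE R
  u0 := by have := mul_nonneg L.u0 R.u0; linarith
  bneg := by rw [neg_merge]; exact L.neg.bound_merge_EE R.neg

theorem EO.merge_EO (L : EO u X) (R : EO w Y) : EE (u * w) (merge X Y) where
  toEvenP := L.toEvenP.merge_even R.toEvenP
  toBoundEE := L.bound_merge_EO R
  u0 := by have := mul_nonneg L.u0 R.u0; linarith
  bneg := by rw [neg_merge]; exact L.neg.bound_merge_EO R.neg

theorem EO.merge_EE (L : EO u X) (R : EE w Y) : EO (6 * (u * w)) (merge X Y) where
  toEvenP := L.toEvenP.merge_even R.toEvenP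
  toBoundEO := L.bound_merge_EE R
  u0 := by have := mul_nonneg L.u0 R.u0; linarith
  bneg := by rw [neg_merge]; exact L.neg.bound_merge_EE R.neg

theorem EE.merge_EE (L : EE u X) (R : EE w Y) : EE (6 * (u * w)) (merge X Y) where
  toEvenP := L.toEvenP.merge_even R.toEvenP
  toBoundEE := L.bound_merge_EE R
  u0 := by have := mul_nonneg L.u0 R.u0; linarith
  bneg := by rw [neg_merge]; exact L.neg.bound_merge_EE R.neg

theorem OO.merge_OO (L : OO u X) (R : OO w Y) : EO (6 * (u * w)) (merge X Y) where
  toEvenP := L.toOddP.merge_odd R.toOddP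
  toBoundEO := L.bound_merge_OO R
  u0 := by have := mul_nonneg L.u0 R.u0; linarith
  bneg := by rw [neg_merge]; exact L.neg.bound_merge_OO R.neg

theorem OO.merge_OE (L : OO u X) (R : OE w Y) : EE (6 * (u * w)) (merge X Y) where
  toEvenP := L.toOddP.merge_odd R.toOddP
  toBoundEE := L.bound_merge_OE R
  u0 := by have := mul_nonneg L.u0 R.u0; linarith
  bneg := by rw [neg_merge]; exact L.neg.bound_merge_OE R.neg

theorem OE.merge_OE (L : OE u X) (R : OE w Y) : EO (36 * (u * w)) (merge X Y) where
  toEvenP := L.toOddP.merge_odd R.toOddP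
  toBoundEO := L.bound_merge_OE R
  u0 := by have := mul_nonneg L.u0 R.u0; linarith
  bneg := by rw [neg_merge]; exact L.neg.bound_merge_OE R.neg

/-- Profile of a single leaf. -/
def leafP (c : ℤ) : Prof := ((true, c), (true, c)) ::ₘ ((false, c), (false, c)) ::ₘ 0

theorem tot_leafP (c : ℤ) (φ : End → End → ℤ) :
    tot (leafP c) φ = φ (true, c) (true, c) + φ (false, c) (false, c) := by
  simp [tot, leafP]

theorem oddP_leafP (c : ℤ) : OddP (leafP c) where
  tot_eq φ := by rw [tot_leafP, tot_leafP]
  odd := by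
    intro x hx
    simp only [leafP, Multiset.mem_cons, Multiset.notMem_zero, or_false] at hx
    rcases hx with rfl | rfl <;> rfl

theorem neg_leafP (c : ℤ) : neg (leafP c) = leafP (-c) := by
  simp only [neg, leafP, nege, Multiset.map_cons, Multiset.map_zero, Bool.not_true, Bool.not_false]
  exact Multiset.cons_swap _ _ _

/-- Peaks compatible with the cut at `s`. -/
def pcut (s : ℤ) (e : End) : Bool := pk e && cut s e

/-- Number of words with left end a valley and both ends compatible with given cuts. -/
def al (M : Prof) (s t : ℤ) : ℤ := cnt M (vcut s) (cut t)

/-- Number of words with left end a peak and both ends compatible with given cuts. -/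
def be (M : Prof) (s t : ℤ) : ℤ := cnt M (pcut s) (cut t)

theorem cnt_join_leafP (c : ℤ) (X : Prof) (A B : End → Bool) :
    cnt (join (leafP c) X) A B ≤ (if A (true, c) then cnt X (vcut (c - 1)) B else 0) +
      (if A (false, c) then cnt X (pcut (c - 1)) B else 0) := by
  have h1 : cnt (join (leafP c) X) A B =
      (if A (true, c) then cnt X (compat (true, c)) B else 0) +
      (if A (false, c) then cnt X (compat (false, c)) B else 0) := by
    unfold cnt
    rw [tot_join, tot_leafP]
    congr 1
    · cases A (true, c) <;> simp [ind, tot]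
    · cases A (false, c) <;> simp [ind, tot]
  rw [h1]
  have h2 : cnt X (compat (true, c)) B ≤ cnt X (vcut (c - 1)) B := cnt_le fun x _ => by
    rcases x with ⟨⟨_ | _, y⟩, z⟩ <;> simp +contextual [compat, vcut, vl, cut]
  have h3 : cnt X (compat (false, c)) B ≤ cnt X (pcut (c - 1)) B := cnt_le fun x _ => by
    rcases x with ⟨⟨_ | _, y⟩, z⟩ <;> simp +contextual [compat, pcut, pk, cut]
    omega
  split_ifs <;> linarith

theorem cnt_merge_leafP {X : Prof} (hX : Symm X) (c : ℤ) (A B : End → Bool) :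
    cnt (merge (leafP c) X) A B ≤ (if A (true, c) then cnt X (vcut (c - 1)) B else 0) +
      (if A (false, c) then cnt X (pcut (c - 1)) B else 0) +
      ((if B (true, c) then cnt X (vcut (c - 1)) A else 0) +
      (if B (false, c) then cnt X (pcut (c - 1)) A else 0)) := by
  rw [cnt_merge (oddP_leafP c).toSymm hX]
  exact add_le_add (cnt_join_leafP c X A B) (cnt_join_leafP c X B A)

theorem cut_true (c s : ℤ) : cut s (true, c) = decide (s ≤ c - 1) := by
  simp only [cut, cond_true, decide_eq_decide]; omega

theorem cut_false (c s : ℤ) : cut s (false, c) = !decide (s ≤ c - 1) := by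
  by_cases h : s ≤ c - 1
  · simp only [cut, cond_false, h, decide_true, Bool.not_true, decide_eq_false_iff_not]; omega
  · simp only [cut, cond_false, h, decide_false, Bool.not_false, decide_eq_true_eq]; omega

section

variable {X : Prof}

theorem al_add_be (X : Prof) (s t : ℤ) : al X s t + be X s t = cnt X (cut s) (cut t) := by
  refine le_antisymm (add_le_cnt fun x _ => ?_) (cnt_le_add fun x _ => ?_) <;>
  · cases h1 : pk x.1 <;> cases h2 : cut s x.1 <;> simp_all [vcut, pcut, vl, pk]

theorem cnt_diff_le (X : Prof) {A A' B : End → Bool} (hA : ∀ e, A e = true → A' e = true) :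
    cnt X A' B - cnt X A B ≤ cnt X A' any - cnt X A any := by
  have h1 : cnt X A any + cnt X (fun e => A' e && !A e) any ≤ cnt X A' any :=
    add_le_cnt fun x _ => by
      have := hA x.1
      cases h1 : A x.1 <;> cases h2 : A' x.1 <;> simp_all [any]
  have h2 : cnt X A' B ≤ cnt X A B + cnt X (fun e => A' e && !A e) any :=
    cnt_le_add fun x _ => by cases h1 : A x.1 <;> simp +contextual [any]
  linarith

theorem vcut_mono {i k : ℤ} (hik : i ≤ k) (e : End) (h : vcut i e = true) : vcut k e = true := by
  rcases e with ⟨_ | _, x⟩ <;> simp [vcut, vl, cut] at h ⊢; omega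

theorem pcut_anti {i k : ℤ} (hik : i ≤ k) (e : End) (h : pcut k e = true) : pcut i e = true := by
  rcases e with ⟨_ | _, x⟩ <;> simp [pcut, pk, cut] at h ⊢; omega

theorem al_le_al {i k : ℤ} (X : Prof) (hik : i ≤ k) (j : ℤ) : al X i j ≤ al X k j :=
  cnt_le fun x _ => by
    have := vcut_mono hik x.1
    cases h1 : vcut i x.1 <;> simp_all

namespace EvenP

theorem be_eq (hX : EvenP X) (s t : ℤ) : be X s t = al X t s := by
  rw [be, al, cnt_symm hX.toSymm]
  refine cnt_eq fun x hx => ?_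
  have := hX.fst_eq hx
  cases h1 : x.2.1 <;> simp_all [pcut, vcut, pk, vl]

theorem alp (hX : EvenP X) (i j : ℤ) : 0 ≤ p X i - al X i j := by
  rw [← hX.cnt_vl_cut i]; exact sub_nonneg.2 (cnt_le_any _ _ _)

theorem bev (hX : EvenP X) (i j : ℤ) : 0 ≤ v X i - be X i j := by
  rw [← hX.cnt_pk_cut i]; exact sub_nonneg.2 (cnt_le_any _ _ _)

theorem alv (hX : EvenP X) (i j : ℤ) : 0 ≤ v X j - al X i j := by
  rw [← hX.be_eq]; exact hX.bev j i

theorem hal (hX : EvenP X) (i j : ℤ) : 0 ≤ h X i - al X i j - al X j i := by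
  have := (h_spec X i).2 j
  rw [← al_add_be, hX.be_eq] at this
  linarith

theorem pm (hX : EvenP X) {i k : ℤ} (hik : i ≤ k) : 0 ≤ p X k - p X i := by
  rw [← hX.cnt_vl_cut, ← hX.cnt_vl_cut]
  refine sub_nonneg.2 (cnt_le fun x _ => ?_)
  have := vcut_mono hik x.1
  simp only [vcut] at this
  cases h1 : vl x.1 && cut i x.1 <;> simp_all

theorem vm (hX : EvenP X) {i k : ℤ} (hik : i ≤ k) : 0 ≤ v X i - v X k := by
  rw [← hX.cnt_pk_cut, ← hX.cnt_pk_cut]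
  refine sub_nonneg.2 (cnt_le fun x _ => ?_)
  have := pcut_anti hik x.1
  simp only [pcut] at this
  cases h1 : pk x.1 && cut k x.1 <;> simp_all

theorem alL (_ : EvenP X) {i k : ℤ} (hik : i ≤ k) (j : ℤ) : 0 ≤ al X k j - al X i j :=
  sub_nonneg.2 (al_le_al X hik j)

theorem leaf_P (hX : EvenP X) (c : ℤ) : P (merge (leafP c) X) ≤ 2 * p X (c - 1) := by
  have := cnt_merge_leafP hX.toSymm c pk any
  have e1 : cnt X (vcut (c - 1)) any = p X (c - 1) := hX.cnt_vl_cut _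
  have e2 : cnt X (vcut (c - 1)) pk ≤ cnt X (vcut (c - 1)) any := cnt_le_any _ _ _
  have e3 : cnt X (pcut (c - 1)) pk = 0 := cnt_eq_zero fun x hx => by
    simp +contextual [pcut, pk, hX.fst_eq hx]
  have e4 : pk (true, c) = true := rfl
  have e5 : pk (false, c) = false := rfl
  have e6 : any (true, c) = true := rfl
  have e7 : any (false, c) = true := rfl
  rw [e4, e5, e6, e7, if_pos rfl, if_neg Bool.false_ne_true, if_pos rfl, if_pos rfl] at this
  rw [P]
  linarith

theorem leaf_V (hX : EvenP X) (c : ℤ) : V (merge (leafP c) X) ≤ 2 * v X (c - 1) := by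
  have := cnt_merge_leafP hX.toSymm c vl any
  have e1 : cnt X (pcut (c - 1)) any = v X (c - 1) := hX.cnt_pk_cut _
  have e2 : cnt X (pcut (c - 1)) vl ≤ cnt X (pcut (c - 1)) any := cnt_le_any _ _ _
  have e3 : cnt X (vcut (c - 1)) vl = 0 := cnt_eq_zero fun x hx => by
    simp +contextual [vcut, vl, hX.fst_eq hx]
  have e4 : vl (true, c) = false := rfl
  have e5 : vl (false, c) = true := rfl
  have e6 : any (true, c) = true := rfl
  have e7 : any (false, c) = true := rfl
  rw [e4, e5, e6, e7, if_pos rfl, if_neg Bool.false_ne_true, if_pos rfl, if_pos rfl] at this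
  rw [V]
  linarith

theorem leaf_p (hX : EvenP X) (c s : ℤ) : p (merge (leafP c) X) s ≤
    al X (c - 1) s + if s ≤ c - 1 then p X (c - 1) else 0 := by
  have := cnt_merge_leafP hX.toSymm c pk (cut s)
  have e1 : cnt X (vcut (c - 1)) any = p X (c - 1) := hX.cnt_vl_cut _
  have e2 : cnt X (vcut (c - 1)) pk ≤ cnt X (vcut (c - 1)) any := cnt_le_any _ _ _
  have e3 : cnt X (pcut (c - 1)) pk = 0 := cnt_eq_zero fun x hx => by
    simp +contextual [pcut, pk, hX.fst_eq hx]
  have e4 : pk (true, c) = true := rfl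
  have e5 : pk (false, c) = false := rfl
  rw [e4, e5, cut_true, cut_false, if_pos rfl, if_neg Bool.false_ne_true] at this
  rw [p, al]
  split_ifs with hs <;> simp [hs] at this <;> linarith

theorem leaf_v (hX : EvenP X) (c s : ℤ) : v (merge (leafP c) X) s ≤
    al X s (c - 1) + if s ≤ c - 1 then 0 else v X (c - 1) := by
  have := cnt_merge_leafP hX.toSymm c vl (cut s)
  have e1 : cnt X (pcut (c - 1)) any = v X (c - 1) := hX.cnt_pk_cut _
  have e2 : cnt X (pcut (c - 1)) vl ≤ cnt X (pcut (c - 1)) any := cnt_le_any _ _ _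
  have e3 : cnt X (vcut (c - 1)) vl = 0 := cnt_eq_zero fun x hx => by
    simp +contextual [vcut, vl, hX.fst_eq hx]
  have e4 : vl (true, c) = false := rfl
  have e5 : vl (false, c) = true := rfl
  rw [e4, e5, cut_true, cut_false, if_pos rfl, if_neg Bool.false_ne_true] at this
  rw [v, ← hX.be_eq, be]
  split_ifs with hs <;> simp [hs] at this <;> linarith

theorem leaf_H (hX : EvenP X) (c s t : ℤ) : cnt (merge (leafP c) X) (cut s) (cut t) ≤
    (if s ≤ c - 1 then al X (c - 1) t else al X t (c - 1)) +
    if t ≤ c - 1 then al X (c - 1) s else al X s (c - 1) := by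
  have := cnt_merge_leafP hX.toSymm c (cut s) (cut t)
  rw [cut_true, cut_false, cut_true, cut_false] at this
  rw [← hX.be_eq (c - 1) t, ← hX.be_eq (c - 1) s]
  unfold al be
  split_ifs with hs ht ht <;> simp [hs, ht] at this <;> linarith

theorem leaf_B (hX : EvenP X) (c s t : ℤ) : B (merge (leafP c) X) s t ≤
    (if s ≤ c - 1 then 0 else al X t (c - 1)) +
    if t ≤ c - 1 then 0 else al X s (c - 1) := by
  have := cnt_merge_leafP hX.toSymm c (vcut s) (vcut t)
  have e1 : ∀ s, vcut s (true, c) = false := fun _ => rfl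
  have e2 : ∀ s, vcut s (false, c) = !decide (s ≤ c - 1) := fun s => by
    rw [← cut_false]; rfl
  have e3 : ∀ t, cnt X (pcut (c - 1)) (vcut t) ≤ be X (c - 1) t := fun t =>
    cnt_le fun x _ => by simp +contextual [vcut]
  have e4 := e3 s
  have e5 := e3 t
  rw [e1, e1, e2, e2] at this
  rw [B, ← hX.be_eq (c - 1) t, ← hX.be_eq (c - 1) s]
  split_ifs with hs ht ht <;> simp [hs, ht] at this <;> linarith

end EvenP

namespace OddP

theorem al_eq (hX : OddP X) (s t : ℤ) : al X s t = cnt X (vcut s) (vcut t) := by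
  refine cnt_eq fun x hx => ?_
  have := hX.odd x hx
  cases h1 : x.2.1 <;> simp_all [vcut, vl]

theorem be_eq (hX : OddP X) (s t : ℤ) : be X s t = cnt X (pcut s) (pcut t) := by
  refine cnt_eq fun x hx => ?_
  have := hX.odd x hx
  cases h1 : x.2.1 <;> simp_all [pcut, pk]

theorem al_comm (hX : OddP X) (s t : ℤ) : al X s t = al X t s := by
  rw [hX.al_eq, hX.al_eq, cnt_symm hX.toSymm]

theorem be_comm (hX : OddP X) (s t : ℤ) : be X s t = be X t s := by
  rw [hX.be_eq, hX.be_eq, cnt_symm hX.toSymm]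

theorem alv (hX : OddP X) (i j : ℤ) : 0 ≤ v X i - al X i j := by
  rw [← hX.cnt_vl_cut i]; exact sub_nonneg.2 (cnt_le_any _ _ _)

theorem bep (hX : OddP X) (i j : ℤ) : 0 ≤ p X i - be X i j := by
  rw [← hX.cnt_pk_cut i]; exact sub_nonneg.2 (cnt_le_any _ _ _)

theorem hab (_ : OddP X) (i j : ℤ) : 0 ≤ h X i - al X i j - be X i j := by
  have := (h_spec X i).2 j
  rw [← al_add_be] at this
  linarith

theorem beg (hX : OddP X) (i j : ℤ) : 0 ≤ P X - p X i - p X j + be X i j := by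
  have h1 : p X j ≤ be X i j + cnt X (fun e => pk e && ncut i e) any := cnt_le_add fun x _ => by
    cases h1 : cut i x.1 <;> simp +contextual [pcut, ncut, h1, any]
  have h2 := pk_cut_add X i
  rw [hX.cnt_pk_cut] at h2
  linarith

theorem pm (hX : OddP X) {i k : ℤ} (hik : i ≤ k) : 0 ≤ p X i - p X k := by
  rw [← hX.cnt_pk_cut, ← hX.cnt_pk_cut]
  refine sub_nonneg.2 (cnt_le fun x _ => ?_)
  have := pcut_anti hik x.1
  simp only [pcut] at this
  cases h1 : pk x.1 && cut k x.1 <;> simp_all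

theorem vm (hX : OddP X) {i k : ℤ} (hik : i ≤ k) : 0 ≤ v X k - v X i := by
  rw [← hX.cnt_vl_cut, ← hX.cnt_vl_cut]
  refine sub_nonneg.2 (cnt_le fun x _ => ?_)
  have := vcut_mono hik x.1
  simp only [vcut] at this
  cases h1 : vl x.1 && cut i x.1 <;> simp_all

theorem alL' (hX : OddP X) {i k : ℤ} (hik : i ≤ k) (j : ℤ) :
    0 ≤ v X k - v X i - al X k j + al X i j := by
  have : al X k j - al X i j ≤ _ := cnt_diff_le X (vcut_mono hik)
  have e1 : cnt X (vcut k) any = v X k := hX.cnt_vl_cut k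
  have e2 : cnt X (vcut i) any = v X i := hX.cnt_vl_cut i
  linarith

theorem beL' (hX : OddP X) {i k : ℤ} (hik : i ≤ k) (j : ℤ) :
    0 ≤ p X i - p X k - be X i j + be X k j := by
  have : be X i j - be X k j ≤ _ := cnt_diff_le X (pcut_anti hik)
  have e1 : cnt X (pcut k) any = p X k := hX.cnt_pk_cut k
  have e2 : cnt X (pcut i) any = p X i := hX.cnt_pk_cut i
  linarith

theorem leaf_P (hX : OddP X) (c : ℤ) :
    P (merge (leafP c) X) ≤ p X (c - 1) + v X (c - 1) := by
  have := cnt_merge_leafP hX.toSymm c pk any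
  have e1 : cnt X (vcut (c - 1)) any = v X (c - 1) := hX.cnt_vl_cut _
  have e0 : cnt X (pcut (c - 1)) any = p X (c - 1) := hX.cnt_pk_cut _
  have e2 : cnt X (pcut (c - 1)) pk ≤ cnt X (pcut (c - 1)) any := cnt_le_any _ _ _
  have e3 : cnt X (vcut (c - 1)) pk = 0 := cnt_eq_zero fun x hx => by
    have := hX.odd x hx
    cases h1 : x.2.1 <;> simp_all [vcut, vl, pk]
  have e4 : pk (true, c) = true := rfl
  have e5 : pk (false, c) = false := rfl
  have e6 : any (true, c) = true := rfl
  have e7 : any (false, c) = true := rfl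
  rw [e4, e5, e6, e7, if_pos rfl, if_neg Bool.false_ne_true, if_pos rfl, if_pos rfl] at this
  rw [P]
  linarith

theorem leaf_p (hX : OddP X) (c s : ℤ) : p (merge (leafP c) X) s ≤
    al X (c - 1) s + if s ≤ c - 1 then 0 else p X (c - 1) := by
  have := cnt_merge_leafP hX.toSymm c pk (cut s)
  have e1 : cnt X (pcut (c - 1)) any = p X (c - 1) := hX.cnt_pk_cut _
  have e2 : cnt X (pcut (c - 1)) pk ≤ cnt X (pcut (c - 1)) any := cnt_le_any _ _ _
  have e3 : cnt X (vcut (c - 1)) pk = 0 := cnt_eq_zero fun x hx => by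
    have := hX.odd x hx
    cases h1 : x.2.1 <;> simp_all [vcut, vl, pk]
  have e4 : pk (true, c) = true := rfl
  have e5 : pk (false, c) = false := rfl
  rw [e4, e5, cut_true, cut_false, if_pos rfl, if_neg Bool.false_ne_true] at this
  rw [p, al]
  split_ifs with hs <;> simp [hs] at this <;> linarith

theorem leaf_v (hX : OddP X) (c s : ℤ) : v (merge (leafP c) X) s ≤
    be X (c - 1) s + if s ≤ c - 1 then v X (c - 1) else 0 := by
  have := cnt_merge_leafP hX.toSymm c vl (cut s)
  have e1 : cnt X (vcut (c - 1)) any = v X (c - 1) := hX.cnt_vl_cut _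
  have e2 : cnt X (vcut (c - 1)) vl ≤ cnt X (vcut (c - 1)) any := cnt_le_any _ _ _
  have e3 : cnt X (pcut (c - 1)) vl = 0 := cnt_eq_zero fun x hx => by
    have := hX.odd x hx
    cases h1 : x.2.1 <;> simp_all [pcut, vl, pk]
  have e4 : vl (true, c) = false := rfl
  have e5 : vl (false, c) = true := rfl
  rw [e4, e5, cut_true, cut_false, if_pos rfl, if_neg Bool.false_ne_true] at this
  rw [v, be]
  split_ifs with hs <;> simp [hs] at this <;> linarith

theorem leaf_H (hX : OddP X) (c s t : ℤ) : cnt (merge (leafP c) X) (cut s) (cut t) ≤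
    (if s ≤ c - 1 then al X (c - 1) t else be X (c - 1) t) +
    if t ≤ c - 1 then al X (c - 1) s else be X (c - 1) s := by
  have := cnt_merge_leafP hX.toSymm c (cut s) (cut t)
  rw [cut_true, cut_false, cut_true, cut_false] at this
  unfold al be
  split_ifs with hs ht ht <;> simp [hs, ht] at this <;> linarith

end OddP

end

variable {w : ℤ} {X : Prof}

theorem OO.gpab (L : OO w X) {i j : ℤ} (hij : i ≤ j) :
    0 ≤ 7 * w - 2 * p X i - 2 * al X i j - be X i j := by
  have := L.gpHB i j hij
  rw [B, ← L.al_eq, ← al_add_be] at this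
  linarith

theorem OO.leaf_gP (R : OO w X) (c : ℤ) :
    0 ≤ 3 * w - P (merge (leafP c) X) := by
  have b1 := R.leaf_P c
  linarith [b1, kn X (c - 1), R.gK]

theorem OO.leaf_gpv (R : OO w X) (c : ℤ) (i : ℤ) :
    0 ≤ 7 * w - 2 * p (merge (leafP c) X) i - v (merge (leafP c) X) i := by
  have b1 := R.leaf_p c i
  have b2 := R.leaf_v c i
  rcases le_or_gt i (c - 1) with hi | hi
  · simp only [hi, if_true] at b1 b2
    linarith [b1, b2, vV X (c - 1), vV X i, R.gPH' (c - 1), R.hab (c - 1) i, R.alv i (c - 1),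
      R.al_comm i (c - 1)]
  · simp only [not_le.2 hi, if_false] at b1 b2
    linarith [b1, b2, R.gpab hi.le]

theorem OO.leaf_gPph (R : OO w X) (c : ℤ) (i : ℤ) :
    0 ≤ 12 * w - 2 * P (merge (leafP c) X) - p (merge (leafP c) X) i - h (merge (leafP c) X) i := by
  have b1 := R.leaf_P c
  have b2 := R.leaf_p c i
  obtain ⟨⟨j, ej⟩, -⟩ := h_spec (merge (leafP c) X) i
  have b3 := R.leaf_H c i j
  rcases le_or_gt i (c - 1) with hi | hi
  · simp only [hi, if_true] at b2 b3
    rcases le_or_gt j (c - 1) with hj | hj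
    · simp only [hj, if_true] at b3
      linarith [ej, b1, b2, b3, vV X (c - 1), R.hv (c - 1), kn X i, vV X i, kn X j,
        R.gPKH' (c - 1), R.alv i (c - 1), R.al_comm i (c - 1), R.alv j (c - 1),
        R.al_comm j (c - 1), R.pm hi, R.pm hj]
    · simp only [not_le.2 hj, if_false] at b3
      linarith [ej, b1, b2, b3, kn X (c - 1), vV X i, vV X j, R.gPKH' (c - 1),
        R.alv (c - 1) (c - 1), R.hab (c - 1) (c - 1), R.alv i (c - 1), R.al_comm i (c - 1),
        R.be_comm i (c - 1), R.al_comm j (c - 1), R.gpab hi, R.beL' hi (c - 1),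
        R.alL' hj.le (c - 1), R.u0]
  · simp only [not_le.2 hi, if_false] at b2 b3
    rcases le_or_gt j (c - 1) with hj | hj
    · simp only [hj, if_true] at b3
      linarith [ej, b1, b2, b3, kn X (c - 1), R.gK, R.alv (c - 1) i, R.bep (c - 1) j]
    · simp only [not_le.2 hj, if_false] at b3
      linarith [ej, b1, b2, b3, pP X (c - 1), kn X i, kn X j, R.gPKH (c - 1),
        R.hab (c - 1) (c - 1), R.beg (c - 1) (c - 1), R.bep i (c - 1), R.al_comm i (c - 1),
        R.be_comm i (c - 1), R.bep j (c - 1), R.be_comm j (c - 1), R.alL' hi.le (c - 1),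
        R.vm hj.le]

theorem OO.bound_leaf (R : OO w X) (c : ℤ) : BoundEE w (merge (leafP c) X) :=
  ⟨R.leaf_gP c, R.leaf_gpv c, R.leaf_gPph c⟩

theorem OO.merge_leaf (R : OO w X) (c : ℤ) : EE w (merge (leafP c) X) where
  toEvenP := (oddP_leafP c).merge_odd R.toOddP
  toBoundEE := R.bound_leaf c
  u0 := by linarith [R.u0]
  bneg := by rw [neg_merge, neg_leafP]; exact R.neg.bound_leaf _

theorem OE.leaf_gP (R : OE w X) (c : ℤ) :
    0 ≤ 7 * (6 * w) - 6 * P (merge (leafP c) X) := by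
  have b1 := R.leaf_P c
  linarith [b1, kn X (c - 1), R.gK]

theorem OE.leaf_gPK (R : OE w X) (c : ℤ) :
    0 ≤ 4 * (6 * w) - 2 * P (merge (leafP c) X) - K (merge (leafP c) X) := by
  have b1 := R.leaf_P c
  obtain ⟨⟨k, ek⟩, -⟩ := K_spec (merge (leafP c) X)
  rw [← p_add_v] at ek
  have b2 := R.leaf_p c k
  have b3 := R.leaf_v c k
  rcases le_or_gt k (c - 1) with hk | hk
  · simp only [hk, if_true] at b2 b3
    linarith [ek, b1, b2, b3, R.gpvh' (c - 1), R.hab (c - 1) k]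
  · simp only [not_le.2 hk, if_false] at b2 b3
    linarith [ek, b1, b2, b3, R.gpvh (c - 1), R.hab (c - 1) k]

theorem OE.leaf_gph (R : OE w X) (c : ℤ) (i : ℤ) :
    0 ≤ 6 * (6 * w) - 4 * p (merge (leafP c) X) i - h (merge (leafP c) X) i := by
  have b1 := R.leaf_p c i
  obtain ⟨⟨j, ej⟩, -⟩ := h_spec (merge (leafP c) X) i
  have b2 := R.leaf_H c i j
  rcases le_or_gt i (c - 1) with hi | hi
  · simp only [hi, if_true] at b1 b2
    rcases le_or_gt j (c - 1) with hj | hj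
    · simp only [hj, if_true] at b2
      linarith [ej, b1, b2, vV X (c - 1), vV X j, R.gP', R.alv (c - 1) i, R.alv j (c - 1),
        R.al_comm j (c - 1)]
    · simp only [not_le.2 hj, if_false] at b2
      linarith [ej, b1, b2, kn X (c - 1), vV X (c - 1), R.gP', R.gPK', R.alv (c - 1) i,
        R.bep (c - 1) i, R.alv (c - 1) j, R.u0]
  · simp only [not_le.2 hi, if_false] at b1 b2
    rcases le_or_gt j (c - 1) with hj | hj
    · simp only [hj, if_true] at b2
      linarith [ej, b1, b2, kn X (c - 1), R.gK, R.alv (c - 1) i, R.bep (c - 1) j, R.u0]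
    · simp only [not_le.2 hj, if_false] at b2
      linarith [ej, b1, b2, pP X (c - 1), kn X j, R.gPK, R.gpvh (c - 1), R.alv (c - 1) i,
        R.hab (c - 1) i, R.bep j (c - 1), R.be_comm j (c - 1), R.vm hj.le]

theorem OE.bound_leaf (R : OE w X) (c : ℤ) : BoundEO (6 * w) (merge (leafP c) X) :=
  ⟨R.leaf_gP c, R.leaf_gPK c, R.leaf_gph c⟩

theorem OE.merge_leaf (R : OE w X) (c : ℤ) : EO (6 * w) (merge (leafP c) X) where
  toEvenP := (oddP_leafP c).merge_odd R.toOddP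
  toBoundEO := R.bound_leaf c
  u0 := by linarith [R.u0]
  bneg := by rw [neg_merge, neg_leafP]; exact R.neg.bound_leaf _

theorem EO.leaf_gP (R : EO w X) (c : ℤ) :
    0 ≤ 7 * w - 3 * P (merge (leafP c) X) := by
  have b1 := R.leaf_P c
  linarith [b1, pP X (c - 1), R.gP]

theorem EO.leaf_gPV (R : EO w X) (c : ℤ) :
    0 ≤ 8 * w - 3 * P (merge (leafP c) X) - V (merge (leafP c) X) := by
  have b1 := R.leaf_P c
  have b2 := R.leaf_V c
  linarith [b1, b2, kn X (c - 1), pP X (c - 1), R.gPK]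

theorem EO.leaf_gK (R : EO w X) (c : ℤ) :
    0 ≤ 3 * w - K (merge (leafP c) X) := by
  obtain ⟨⟨k, ek⟩, -⟩ := K_spec (merge (leafP c) X)
  rw [← p_add_v] at ek
  have b1 := R.leaf_p c k
  have b2 := R.leaf_v c k
  rcases le_or_gt k (c - 1) with hk | hk
  · simp only [hk, if_true] at b1 b2
    linarith [ek, b1, b2, R.kT, pP X (c - 1), kh X (c - 1), R.gPK, R.hal (c - 1) k]
  · simp only [not_le.2 hk, if_false] at b1 b2
    linarith [ek, b1, b2, R.kT, R.vV (c - 1), kh X (c - 1), R.gPK, R.hal (c - 1) k]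

theorem EO.leaf_gPH (R : EO w X) (c : ℤ) (i : ℤ) :
    0 ≤ 7 * w - 2 * P (merge (leafP c) X) - h (merge (leafP c) X) i := by
  have b1 := R.leaf_P c
  obtain ⟨⟨j, ej⟩, -⟩ := h_spec (merge (leafP c) X) i
  have b2 := R.leaf_H c i j
  rcases le_or_gt i (c - 1) with hi | hi
  · simp only [hi, if_true] at b2
    rcases le_or_gt j (c - 1) with hj | hj
    · simp only [hj, if_true] at b2
      linarith [ej, b1, b2, pP X (c - 1), R.vV i, R.vV j, R.gP, R.alv (c - 1) i, R.alv (c - 1) j]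
    · simp only [not_le.2 hj, if_false] at b2
      linarith [ej, b1, b2, R.kT, kn X (c - 1), pP X (c - 1), kn X j, R.gPK, R.alv (c - 1) j,
        R.alv i (c - 1), R.pm hj.le, R.u0]
  · simp only [not_le.2 hi, if_false] at b2
    rcases le_or_gt j (c - 1) with hj | hj
    · simp only [hj, if_true] at b2
      linarith [ej, b1, b2, R.kT, kn X (c - 1), pP X (c - 1), kn X i, R.gPK, R.alv (c - 1) i,
        R.alv j (c - 1), R.pm hi.le, R.u0]
    · simp only [not_le.2 hj, if_false] at b2
      linarith [ej, b1, b2, R.kT, kn X (c - 1), pP X (c - 1), R.gPK, R.alv i (c - 1),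
        R.alv j (c - 1), R.u0]

theorem EO.leaf_gPKH (R : EO w X) (c : ℤ) (i : ℤ) :
    0 ≤ 12 * w - 2 * P (merge (leafP c) X) - 2 * K (merge (leafP c) X) - h (merge (leafP c) X) i :=
      by
  have b1 := R.leaf_P c
  obtain ⟨⟨k, ek⟩, -⟩ := K_spec (merge (leafP c) X)
  rw [← p_add_v] at ek
  have b2 := R.leaf_p c k
  have b3 := R.leaf_v c k
  obtain ⟨⟨j, ej⟩, -⟩ := h_spec (merge (leafP c) X) i
  have b4 := R.leaf_H c i j
  rcases le_or_gt k (c - 1) with hk | hk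
  · simp only [hk, if_true] at b2 b3
    rcases le_or_gt i (c - 1) with hi | hi
    · simp only [hi, if_true] at b4
      rcases le_or_gt j (c - 1) with hj | hj
      · simp only [hj, if_true] at b4
        linarith [ek, ej, b1, b2, b3, b4, R.gph (c - 1), R.hal (c - 1) k, R.alp (c - 1) i,
          R.alp (c - 1) j]
      · simp only [not_le.2 hj, if_false] at b4
        linarith [ek, ej, b1, b2, b3, b4, R.kT, kn X (c - 1), kh X (c - 1), kn X j, R.gPK,
          R.gph (c - 1), R.hal (c - 1) k, R.alv (c - 1) j, R.alv i (c - 1), R.pm hj.le]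
    · simp only [not_le.2 hi, if_false] at b4
      rcases le_or_gt j (c - 1) with hj | hj
      · simp only [hj, if_true] at b4
        linarith [ek, ej, b1, b2, b3, b4, R.kT, kn X (c - 1), kh X (c - 1), kn X i, R.gPK,
          R.gph (c - 1), R.hal (c - 1) k, R.alv (c - 1) i, R.alv j (c - 1), R.pm hi.le]
      · simp only [not_le.2 hj, if_false] at b4
        linarith [ek, ej, b1, b2, b3, b4, kn X (c - 1), kh X (c - 1), pP X i, pP X j, R.gPK,
          R.gph (c - 1), R.hal (c - 1) k, R.alp i (c - 1), R.alv i (c - 1), R.alp j (c - 1)]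
  · simp only [not_le.2 hk, if_false] at b2 b3
    rcases le_or_gt i (c - 1) with hi | hi
    · simp only [hi, if_true] at b4
      rcases le_or_gt j (c - 1) with hj | hj
      · simp only [hj, if_true] at b4
        linarith [ek, ej, b1, b2, b3, b4, R.kT, kn X (c - 1), pP X (c - 1), kh X (c - 1), R.gPK,
          R.hal (c - 1) k, R.alp (c - 1) i, R.alp (c - 1) j]
      · simp only [not_le.2 hj, if_false] at b4
        linarith [ek, ej, b1, b2, b3, b4, R.kT, kn X (c - 1), R.vV (c - 1), kn X k, kn X i,
          kn X j, R.gPK, R.alv (c - 1) k, R.alv (c - 1) j, R.alv k (c - 1), R.alp i (c - 1),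
          R.pm hk.le, R.vm hi, R.pm hj.le]
    · simp only [not_le.2 hi, if_false] at b4
      rcases le_or_gt j (c - 1) with hj | hj
      · simp only [hj, if_true] at b4
        linarith [ek, ej, b1, b2, b3, b4, R.kT, kn X (c - 1), R.vV (c - 1), kn X k, kn X i,
          kn X j, R.gPK, R.alv (c - 1) k, R.alv (c - 1) i, R.alv k (c - 1), R.alp j (c - 1),
          R.pm hk.le, R.pm hi.le, R.vm hj]
      · simp only [not_le.2 hj, if_false] at b4
        linarith [ek, ej, b1, b2, b3, b4, R.kT, kn X (c - 1), pP X (c - 1), kh X (c - 1), pP X i,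
          pP X j, R.gPK, R.hal (c - 1) k, R.alp i (c - 1), R.alp j (c - 1)]

theorem EO.leaf_gpHB (R : EO w X) (c : ℤ) {i j : ℤ} (hij : i ≤ j) :
    0 ≤ 7 * w - 2 * p (merge (leafP c) X) i - cnt (merge (leafP c) X) (cut i) (cut j) -
      B (merge (leafP c) X) i j := by
  have b1 := R.leaf_p c i
  have b2 := R.leaf_H c i j
  have b3 := R.leaf_B c i j
  rcases le_or_gt i (c - 1) with hi | hi
  · simp only [hi, if_true] at b1 b2 b3
    rcases le_or_gt j (c - 1) with hj | hj
    · simp only [hj, if_true] at b2 b3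
      linarith [b1, b2, b3, pP X (c - 1), R.vV j, R.gP, R.alp (c - 1) i, R.alv (c - 1) j]
    · simp only [not_le.2 hj, if_false] at b2 b3
      linarith [b1, b2, b3, R.kT, pP X (c - 1), kh X (c - 1), kn X j, R.gPK, R.hal (c - 1) i,
        R.alv (c - 1) j, R.pm hj.le]
  · simp only [not_le.2 hi, if_false] at b1 b2 b3
    rcases le_or_gt j (c - 1) with hj | hj
    · simp only [hj, if_true] at b2 b3
      linarith [b1, b2, b3, R.kT, R.vV (c - 1), kh X j, R.gPK, R.alv (c - 1) (c - 1),
        R.hal j (c - 1), R.vm hi.le, R.vm hj, R.u0]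
    · simp only [not_le.2 hj, if_false] at b2 b3
      linarith [b1, b2, b3, R.kT, kh X (c - 1), R.gPK, R.gph' (c - 1), R.hal (c - 1) i,
        R.alv j (c - 1), R.u0]

theorem EO.bound_leaf (R : EO w X) (c : ℤ) : BoundOO w (merge (leafP c) X) :=
  ⟨R.leaf_gP c, R.leaf_gPV c, R.leaf_gK c, R.leaf_gPH c,
    R.leaf_gPKH c, fun _ _ h => R.leaf_gpHB c h⟩

theorem EO.merge_leaf (R : EO w X) (c : ℤ) : OO w (merge (leafP c) X) where
  toOddP := (oddP_leafP c).merge_even R.toEvenP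
  toBoundOO := R.bound_leaf c
  u0 := by linarith [R.u0]
  bneg := by rw [neg_merge, neg_leafP]; exact R.neg.bound_leaf _

theorem EE.leaf_gP (R : EE w X) (c : ℤ) :
    0 ≤ 6 * w - P (merge (leafP c) X) := by
  have b1 := R.leaf_P c
  linarith [b1, pP X (c - 1), R.gP]

theorem EE.leaf_gPV (R : EE w X) (c : ℤ) :
    0 ≤ 14 * w - 2 * P (merge (leafP c) X) - V (merge (leafP c) X) := by
  have b1 := R.leaf_P c
  have b2 := R.leaf_V c
  linarith [b1, b2, R.gpv (c - 1)]

theorem EE.leaf_gK (R : EE w X) (c : ℤ) :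
    0 ≤ 7 * w - K (merge (leafP c) X) := by
  obtain ⟨⟨k, ek⟩, -⟩ := K_spec (merge (leafP c) X)
  rw [← p_add_v] at ek
  have b1 := R.leaf_p c k
  have b2 := R.leaf_v c k
  rcases le_or_gt k (c - 1) with hk | hk
  · simp only [hk, if_true] at b1 b2
    linarith [ek, b1, b2, R.hn (c - 1), R.gpv (c - 1), R.hal (c - 1) k]
  · simp only [not_le.2 hk, if_false] at b1 b2
    linarith [ek, b1, b2, R.hn (c - 1), R.gpv' (c - 1), R.hal (c - 1) k]

theorem EE.leaf_gPK (R : EE w X) (c : ℤ) :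
    0 ≤ 12 * w - P (merge (leafP c) X) - K (merge (leafP c) X) := by
  have b1 := R.leaf_P c
  obtain ⟨⟨k, ek⟩, -⟩ := K_spec (merge (leafP c) X)
  rw [← p_add_v] at ek
  have b2 := R.leaf_p c k
  have b3 := R.leaf_v c k
  rcases le_or_gt k (c - 1) with hk | hk
  · simp only [hk, if_true] at b2 b3
    linarith [ek, b1, b2, b3, pP X (c - 1), R.gPph (c - 1), R.hal (c - 1) k]
  · simp only [not_le.2 hk, if_false] at b2 b3
    linarith [ek, b1, b2, b3, R.hn (c - 1), R.gpv (c - 1), R.gpv' (c - 1), R.hal (c - 1) k, R.u0]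

theorem EE.leaf_gpvh (R : EE w X) (c : ℤ) (i : ℤ) :
    0 ≤ 24 * w - 3 * p (merge (leafP c) X) i - 2 * v (merge (leafP c) X) i -
      h (merge (leafP c) X) i := by
  have b1 := R.leaf_p c i
  have b2 := R.leaf_v c i
  obtain ⟨⟨j, ej⟩, -⟩ := h_spec (merge (leafP c) X) i
  have b3 := R.leaf_H c i j
  rcases le_or_gt i (c - 1) with hi | hi
  · simp only [hi, if_true] at b1 b2 b3
    rcases le_or_gt j (c - 1) with hj | hj
    · simp only [hj, if_true] at b3
      linarith [ej, b1, b2, b3, pP X (c - 1), R.vV j, R.gPph (c - 1), R.alp (c - 1) i,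
        R.hal (c - 1) i, R.alv (c - 1) j]
    · simp only [not_le.2 hj, if_false] at b3
      linarith [ej, b1, b2, b3, R.hn (c - 1), R.gpv (c - 1), R.gpv' j, R.hal (c - 1) i,
        R.alv (c - 1) j, R.alp j j, R.alL hj.le j, R.u0]
  · simp only [not_le.2 hi, if_false] at b1 b2 b3
    rcases le_or_gt j (c - 1) with hj | hj
    · simp only [hj, if_true] at b3
      linarith [ej, b1, b2, b3, R.hn (c - 1), R.gpv (c - 1), R.gpv' (c - 1), R.gpv j,
        R.alp (c - 1) i, R.hal (c - 1) i, R.alp j (c - 1), R.vm hj, R.u0]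
    · simp only [not_le.2 hj, if_false] at b3
      linarith [ej, b1, b2, b3, R.hn (c - 1), R.gpv' (c - 1), R.hal (c - 1) i, R.alv j (c - 1),
        R.u0]

theorem EE.bound_leaf (R : EE w X) (c : ℤ) : BoundOE w (merge (leafP c) X) :=
  ⟨R.leaf_gP c, R.leaf_gPV c, R.leaf_gK c, R.leaf_gPK c,
    R.leaf_gpvh c⟩

theorem EE.merge_leaf (R : EE w X) (c : ℤ) : OE w (merge (leafP c) X) where
  toOddP := (oddP_leafP c).merge_even R.toEvenP
  toBoundOE := R.bound_leaf c
  u0 := by linarith [R.u0]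
  bneg := by rw [neg_merge, neg_leafP]; exact R.neg.bound_leaf _

theorem P_merge_leafP_le (c d : ℤ) : P (merge (leafP c) (leafP d)) ≤ 1 := by
  have h1 := (oddP_leafP d).leaf_P c
  have h2 := p_add_v (leafP d) (c - 1)
  have h3 : cnt (leafP d) any (cut (c - 1)) = 1 := by
    rw [cnt, tot_leafP]
    by_cases h : c - 1 < d
    · simp [ind, any, cut, h, not_le.2 h]
    · simp [ind, any, cut, h, not_lt.1 h]
  linarith

theorem bound_merge_leafP (c d : ℤ) : BoundEO 1 (merge (leafP c) (leafP d)) := by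
  have hM : EvenP (merge (leafP c) (leafP d)) := (oddP_leafP c).merge_odd (oddP_leafP d)
  have h1 := P_merge_leafP_le c d
  have h2 := hM.kT
  refine ⟨by linarith, by linarith, fun s => ?_⟩
  linarith [pP (merge (leafP c) (leafP d)) s, kh (merge (leafP c) (leafP d)) s]

theorem merge_leafP (c d : ℤ) : EO 1 (merge (leafP c) (leafP d)) where
  toEvenP := (oddP_leafP c).merge_odd (oddP_leafP d)
  toBoundEO := bound_merge_leafP c d
  u0 := zero_le_one
  bneg := by rw [neg_merge, neg_leafP, neg_leafP]; exact bound_merge_leafP _ _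

/-- Profiles which obey the estimates for trees with `n` leaves. -/
inductive Good (n : ℕ) (M : Prof) : Prop
  | leaf (c : ℤ) (hn : n = 1) (hM : M = leafP c) : Good n M
  | eo (q : ℕ) (u : ℤ) (hn : n = 4 * q + 2) (hu : u = 6 ^ q) (hM : EO u M) : Good n M
  | oo (q : ℕ) (u : ℤ) (hn : n = 4 * q + 3) (hu : u = 6 ^ q) (hM : OO u M) : Good n M
  | ee (q : ℕ) (u : ℤ) (hn : n = 4 * q + 4) (hu : u = 6 ^ q) (hM : EE u M) : Good n M
  | oe (q : ℕ) (u : ℤ) (hn : n = 4 * q + 5) (hu : u = 6 ^ q) (hM : OE u M) : Good n M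

theorem Good.merge {m n : ℕ} {X Y : Prof} (hX : Good m X) (hY : Good n Y) :
    Good (m + n) (merge X Y) := by
  rcases hX with ⟨c, hm, rfl⟩ | ⟨r, w, hm, hw, L⟩ | ⟨r, w, hm, hw, L⟩ | ⟨r, w, hm, hw, L⟩ |
    ⟨r, w, hm, hw, L⟩ <;>
  rcases hY with ⟨d, hn, rfl⟩ | ⟨q, u, hn, hu, R⟩ | ⟨q, u, hn, hu, R⟩ | ⟨q, u, hn, hu, R⟩ |
    ⟨q, u, hn, hu, R⟩ <;> subst hm hn
  · exact .eo 0 1 rfl rfl (merge_leafP c d)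
  · exact .oo q _ (by ring) hu (R.merge_leaf c)
  · exact .ee q _ (by ring) hu (R.merge_leaf c)
  · exact .oe q _ (by ring) hu (R.merge_leaf c)
  · exact .eo (q + 1) _ (by ring) (by rw [hu]; ring) (R.merge_leaf c)
  · rw [merge_comm]; exact .oo r _ (by ring) hw (L.merge_leaf d)
  · exact .ee (r + q) _ (by ring) (by rw [hw, hu]; ring) (L.merge_EO R)
  · rw [merge_comm]; exact .oe (r + q) _ (by ring) (by rw [hw, hu]; ring) (R.merge_EO L)
  · exact .eo (r + q + 1) _ (by ring) (by rw [hw, hu]; ring) (L.merge_EE R)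
  · rw [merge_comm]; exact .oo (r + q + 1) _ (by ring) (by rw [hw, hu]; ring) (R.merge_EO L)
  · rw [merge_comm]; exact .ee r _ (by ring) hw (L.merge_leaf d)
  · exact .oe (r + q) _ (by ring) (by rw [hw, hu]; ring) (L.merge_EO R)
  · exact .eo (r + q + 1) _ (by ring) (by rw [hw, hu]; ring) (L.merge_OO R)
  · exact .oo (r + q + 1) _ (by ring) (by rw [hw, hu]; ring) (L.merge_EE R)
  · exact .ee (r + q + 1) _ (by ring) (by rw [hw, hu]; ring) (L.merge_OE R)
  · rw [merge_comm]; exact .oe r _ (by ring) hw (L.merge_leaf d)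
  · rw [merge_comm]; exact .eo (r + q + 1) _ (by ring) (by rw [hw, hu]; ring) (R.merge_EE L)
  · rw [merge_comm]; exact .oo (r + q + 1) _ (by ring) (by rw [hw, hu]; ring) (R.merge_EE L)
  · exact .ee (r + q + 1) _ (by ring) (by rw [hw, hu]; ring) (L.merge_EE R)
  · rw [merge_comm]; exact .oe (r + q + 1) _ (by ring) (by rw [hw, hu]; ring) (R.merge_EE L)
  · rw [merge_comm]; exact .eo (r + 1) _ (by ring) (by rw [hw]; ring) (L.merge_leaf d)
  · exact .oo (r + q + 1) _ (by ring) (by rw [hw, hu]; ring) (L.merge_EO R)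
  · rw [merge_comm]; exact .ee (r + q + 1) _ (by ring) (by rw [hw, hu]; ring) (R.merge_OE L)
  · exact .oe (r + q + 1) _ (by ring) (by rw [hw, hu]; ring) (L.merge_EE R)
  · exact .eo (r + q + 2) _ (by ring) (by rw [hw, hu]; ring) (L.merge_OE R)

/-- Profile of the typed alternating words in the expansion of a tree. -/
def prof : BTree → Prof
  | .leaf a => leafP a
  | .node l r => merge (prof l) (prof r)

theorem good_prof (t : BTree) : Good t.leaves.length (prof t) := by
  induction t with
  | leaf a => exact .leaf a rfl rfl
  | node l r hl hr =>
    rw [BTree.leaves, List.length_append]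
    exact hl.merge hr

/-- The word `w` with alternating types, starting with the type `b`. -/
def typed : Bool → List ℕ → List End
  | _, [] => []
  | b, x :: w => (b, (x : ℤ)) :: typed (!b) w

theorem typed_append (b : Bool) (u w : List ℕ) :
    ∃ c, typed b (u ++ w) = typed b u ++ typed c w := by
  induction u generalizing b with
  | nil => exact ⟨b, rfl⟩
  | cons x u ih =>
    obtain ⟨c, hc⟩ := ih (!b)
    exact ⟨c, by rw [List.cons_append, typed, hc, typed, List.cons_append]⟩

theorem typed_injective (b : Bool) : Function.Injective (typed b) := by
  intro u
  induction u generalizing b with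
  | nil => intro w h; cases w <;> simp_all [typed]
  | cons x u ih =>
    intro w h
    cases w with
    | nil => simp [typed] at h
    | cons y w =>
      simp only [typed, List.cons.injEq, Prod.mk.injEq, Nat.cast_inj, true_and] at h
      rw [h.1, ih _ h.2]

theorem isAlternating_cons_cons_cons (x y z : ℕ) (w : List ℕ) :
    IsAlternating (x :: y :: z :: w) ↔ (x ≠ y ∧ ¬ (x < y ∧ y < z) ∧ ¬ (z < y ∧ y < x)) ∧
      IsAlternating (y :: z :: w) := by
  constructor
  · rintro ⟨h1, h2⟩
    exact ⟨⟨h1 0 (by simp), h2 0 (by simp)⟩, fun i hi => h1 (i + 1) (by simpa using hi),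
      fun i hi => h2 (i + 1) (by simpa using hi)⟩
  · rintro ⟨⟨h1, h2⟩, h3, h4⟩
    refine ⟨fun i hi => ?_, fun i hi => ?_⟩
    · cases i with
      | zero => exact h1
      | succ i => exact h3 i (by simpa using hi)
    · cases i with
      | zero => exact h2
      | succ i => exact h4 i (by simpa using hi)

theorem isChain_typed {b : Bool} {x y : ℕ} {w : List ℕ} (h : IsAlternating (x :: y :: w))
    (hb : if b then y < x else x < y) :
    (typed b (x :: y :: w)).IsChain fun e f => compat e f = true := by
  induction w generalizing b x y with
  | nil => cases b <;> simpa [typed, compat] using hb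
  | cons z w ih =>
    obtain ⟨⟨h1, h2, h3⟩, h4⟩ := (isAlternating_cons_cons_cons x y z w).1 h
    have h5 : y ≠ z := h4.1 0 (by simp)
    rw [typed, typed, List.isChain_cons_cons, ← typed]
    constructor
    · cases b <;> simpa [compat] using hb
    · refine ih h4 ?_
      cases b <;> simp only [Bool.not_true, Bool.not_false, if_true, Bool.false_eq_true, if_false]
        at hb ⊢ <;> omega

theorem isAlternating_of_isChain {b : Bool} {x y : ℕ} {w : List ℕ}
    (h : (typed b (x :: y :: w)).IsChain fun e f => compat e f = true) :
    IsAlternating (x :: y :: w) ∧ if b then y < x else x < y := by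
  induction w generalizing b x y with
  | nil =>
    have hb : if b then y < x else x < y := by cases b <;> simpa [typed, compat] using h
    refine ⟨⟨fun i hi => ?_, fun i hi => by simp at hi⟩, hb⟩
    obtain rfl : i = 0 := by simpa using hi
    cases b
    · exact (show x < y by simpa using hb).ne
    · exact (show y < x by simpa using hb).ne'
  | cons z w ih =>
    rw [typed, typed, List.isChain_cons_cons, ← typed] at h
    obtain ⟨h4, h5⟩ := ih h.2
    have hb : if b then y < x else x < y := by cases b <;> simpa [compat] using h.1
    refine ⟨(isAlternating_cons_cons_cons x y z w).2 ⟨?_, h4⟩, hb⟩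
    cases b <;> simp only [Bool.not_true, Bool.not_false, if_true, Bool.false_eq_true, if_false]
      at hb h5 <;> omega

theorem isForwardAlternating_iff {w : List ℕ} (hw : 2 ≤ w.length) :
    IsForwardAlternating w ↔ (typed true w).IsChain fun e f => compat e f = true := by
  match w, hw with
  | x :: y :: w, _ =>
    constructor
    · rintro ⟨h1, h2⟩
      refine isChain_typed h1 ?_
      simpa using h2
    · intro h
      obtain ⟨h1, h2⟩ := isAlternating_of_isChain h
      exact ⟨h1, Or.inr (by simpa using h2)⟩

/-- First and last letter of a word. -/
def ends (x : List End) : End × End := (x.headD (true, 0), x.getLastD (true, 0))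

/-- Typed alternating words obtained by concatenation of words from `X` and `Y`. -/
noncomputable def cat (X Y : Multiset (List End)) : Multiset (List End) :=
  X.bind fun x =>
    (Y.filter fun y => (x ++ y).IsChain fun e f => compat e f = true).map fun y => x ++ y

theorem mem_cat {X Y : Multiset (List End)} {z : List End} :
    z ∈ cat X Y ↔ ∃ x ∈ X, ∃ y ∈ Y,
      ((x ++ y).IsChain fun e f => compat e f = true) ∧ z = x ++ y := by
  simp only [cat, Multiset.mem_bind, Multiset.mem_map, Multiset.mem_filter]
  constructor
  · rintro ⟨x, hx, y, ⟨hy, h⟩, rfl⟩; exact ⟨x, hx, y, hy, h, rfl⟩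
  · rintro ⟨x, hx, y, hy, h, rfl⟩; exact ⟨x, hx, y, ⟨hy, h⟩, rfl⟩

/-- The typed alternating words in the expansion of a tree. -/
noncomputable def typedWords : BTree → Multiset (List End)
  | .leaf a => [(true, (a : ℤ))] ::ₘ [(false, (a : ℤ))] ::ₘ 0
  | .node l r => cat (typedWords l) (typedWords r) + cat (typedWords r) (typedWords l)

/-- The labels of a typed word. -/
def labels (x : List End) : List ℕ := x.map fun e => e.2.toNat

/-- Typed alternating words with labels in a given set of words. -/
structure IsTyped (W : Finset (List ℕ)) (x : List End) : Prop where
  ne_nil : x ≠ []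
  chain : x.IsChain fun e f => compat e f = true
  nonneg : ∀ e ∈ x, 0 ≤ e.2
  labels_mem : labels x ∈ W

theorem mem_words_append {l r : BTree} {u w : List ℕ} (hu : u ∈ l.words) (hw : w ∈ r.words) :
    u ++ w ∈ (BTree.node l r).words :=
  Finset.mem_union_left _ (Finset.mem_image.2 ⟨(u, w), Finset.mem_product.2 ⟨hu, hw⟩, rfl⟩)

theorem mem_words_append' {l r : BTree} {u w : List ℕ} (hu : u ∈ l.words) (hw : w ∈ r.words) :
    w ++ u ∈ (BTree.node l r).words :=
  Finset.mem_union_right _ (Finset.mem_image.2 ⟨(u, w), Finset.mem_product.2 ⟨hu, hw⟩, rfl⟩)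

theorem IsTyped.append {U W Z : Finset (List ℕ)} {x y : List End} (hx : IsTyped U x)
    (hy : IsTyped W y) (h : (x ++ y).IsChain fun e f => compat e f = true)
    (hZ : ∀ u ∈ U, ∀ w ∈ W, u ++ w ∈ Z) : IsTyped Z (x ++ y) where
  ne_nil := List.append_ne_nil_of_left_ne_nil hx.ne_nil y
  chain := h
  nonneg e he := (List.mem_append.1 he).elim (hx.nonneg e) (hy.nonneg e)
  labels_mem := by
    rw [labels, List.map_append]; exact hZ _ hx.labels_mem _ hy.labels_mem

theorem isTyped_of_mem {t : BTree} {x : List End} (hx : x ∈ typedWords t) : IsTyped t.words x := by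
  induction t generalizing x with
  | leaf a =>
    simp only [typedWords, Multiset.mem_cons, Multiset.notMem_zero, or_false] at hx
    rcases hx with rfl | rfl <;> constructor <;> simp [labels, BTree.words]
  | node l r hl hr =>
    rcases Multiset.mem_add.1 hx with hx | hx
    · obtain ⟨x, h1, y, h2, h, rfl⟩ := mem_cat.1 hx
      exact (hl h1).append (hr h2) h fun u hu w hw => mem_words_append hu hw
    · obtain ⟨x, h1, y, h2, h, rfl⟩ := mem_cat.1 hx
      exact (hr h1).append (hl h2) h fun u hu w hw => mem_words_append' hw hu

theorem ends_append {x y : List End} (hx : x ≠ []) (hy : y ≠ []) :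
    ends (x ++ y) = ((ends x).1, (ends y).2) := by
  obtain ⟨a, x, rfl⟩ := List.exists_cons_of_ne_nil hx
  obtain ⟨y, b, rfl⟩ := (List.eq_nil_or_concat y).resolve_left hy
  simp [ends, List.getLastD_eq_getLast?, List.getLast?_cons, List.getLast?_append]

theorem isChain_append_iff {x y : List End} (hx : x ≠ []) (hy : y ≠ [])
    (h1 : x.IsChain fun e f => compat e f = true) (h2 : y.IsChain fun e f => compat e f = true) :
    ((x ++ y).IsChain fun e f => compat e f = true) ↔
      compat (ends x).2 (ends y).1 = true := by
  obtain ⟨x, a, rfl⟩ := (List.eq_nil_or_concat x).resolve_left hx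
  obtain ⟨b, y, rfl⟩ := List.exists_cons_of_ne_nil hy
  rw [List.isChain_append]
  simp [ends, h2, List.getLastD_eq_getLast?, List.getLast?_append] at h1 ⊢
  tauto

theorem map_ends_cat {U W : Finset (List ℕ)} {X Y : Multiset (List End)}
    (hX : ∀ x ∈ X, IsTyped U x) (hY : ∀ y ∈ Y, IsTyped W y) :
    (cat X Y).map ends = join (X.map ends) (Y.map ends) := by
  rw [cat, join, Multiset.map_bind, Multiset.bind_map]
  refine Multiset.bind_congr fun x hx => ?_
  rw [Multiset.map_map, Multiset.filter_map, Multiset.map_map]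
  have : (Y.filter fun y => (x ++ y).IsChain fun e f => compat e f = true) =
      Y.filter ((fun y => compat (ends x).2 y.1 = true) ∘ ends) :=
    Multiset.filter_congr fun y hy => isChain_append_iff (hX x hx).ne_nil (hY y hy).ne_nil
      (hX x hx).chain (hY y hy).chain
  rw [this]
  refine Multiset.map_congr rfl fun y hy => ?_
  exact ends_append (hX x hx).ne_nil (hY y (Multiset.mem_filter.1 hy).1).ne_nil

theorem map_ends_typedWords (t : BTree) : (typedWords t).map ends = prof t := by
  induction t with
  | leaf a => simp [typedWords, prof, leafP, ends]
  | node l r hl hr =>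
    rw [typedWords, Multiset.map_add,
      map_ends_cat (fun _ => isTyped_of_mem) fun _ => isTyped_of_mem,
      map_ends_cat (fun _ => isTyped_of_mem) fun _ => isTyped_of_mem, hl, hr, prof, merge]

theorem typed_mem_typedWords {t : BTree} {w : List ℕ} (hw : w ∈ t.words) {b : Bool}
    (h : (typed b w).IsChain fun e f => compat e f = true) : typed b w ∈ typedWords t := by
  induction t generalizing w b with
  | leaf a =>
    obtain rfl := Finset.mem_singleton.1 hw
    cases b <;> simp [typed, typedWords]
  | node l r hl hr =>
    rw [typedWords, Multiset.mem_add, mem_cat, mem_cat]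
    rcases Finset.mem_union.1 hw with hw | hw
    all_goals
      obtain ⟨⟨u, w⟩, hm, rfl⟩ := Finset.mem_image.1 hw
      obtain ⟨hu, hw⟩ := Finset.mem_product.1 hm
      dsimp only at hu hw h ⊢
    · obtain ⟨c, hc⟩ := typed_append b u w
      rw [hc] at h ⊢
      have h' := List.isChain_append.1 h
      exact Or.inl ⟨_, hl hu h'.1, _, hr hw h'.2.1, h, rfl⟩
    · obtain ⟨c, hc⟩ := typed_append b w u
      rw [hc] at h ⊢
      have h' := List.isChain_append.1 h
      exact Or.inr ⟨_, hr hw h'.1, _, hl hu h'.2.1, h, rfl⟩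

theorem perm_of_mem_words {t : BTree} {w : List ℕ} (hw : w ∈ t.words) : w.Perm t.leaves := by
  induction t generalizing w with
  | leaf a => obtain rfl := Finset.mem_singleton.1 hw; exact List.Perm.refl _
  | node l r hl hr =>
    rcases Finset.mem_union.1 hw with hw | hw
    all_goals
      obtain ⟨⟨u, w⟩, hm, rfl⟩ := Finset.mem_image.1 hw
      obtain ⟨hu, hw⟩ := Finset.mem_product.1 hm
    · exact (hl hu).append (hr hw)
    · exact List.perm_append_comm.trans ((hl hu).append (hr hw))

theorem IsTyped.perm {t : BTree} {x : List End} (hx : IsTyped t.words x) :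
    (labels x).Perm t.leaves := perm_of_mem_words hx.labels_mem

theorem nodup_cat {l : BTree} {X Y : Multiset (List End)} (hX : ∀ x ∈ X, IsTyped l.words x)
    (h1 : X.Nodup) (h2 : Y.Nodup) : (cat X Y).Nodup := by
  refine Multiset.nodup_bind.2 ⟨fun x _ => ?_, h1.pairwise fun x hx x' hx' hne => ?_⟩
  · exact (h2.filter _).map fun _ _ h => List.append_cancel_left h
  · refine Multiset.disjoint_left.2 @fun z hz hz' => hne ?_
    obtain ⟨y, -, rfl⟩ := Multiset.mem_map.1 hz
    obtain ⟨y', -, h⟩ := Multiset.mem_map.1 hz'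
    refine (List.append_inj h ?_).1.symm
    have e1 := (hX x hx).perm.length_eq
    have e2 := (hX x' hx').perm.length_eq
    simp only [labels, List.length_map] at e1 e2
    rw [e1, e2]

theorem nodup_typedWords {t : BTree} (ht : t.leaves.Nodup) : (typedWords t).Nodup := by
  induction t with
  | leaf a => simp [typedWords]
  | node l r hl hr =>
    rw [BTree.leaves, List.nodup_append] at ht
    obtain ⟨h1, h2, h3⟩ := ht
    refine Multiset.nodup_add.2 ⟨nodup_cat (fun _ => isTyped_of_mem) (hl h1) (hr h2),
      nodup_cat (fun _ => isTyped_of_mem) (hr h2) (hl h1), ?_⟩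
    refine Multiset.disjoint_left.2 @fun z hz hz' => ?_
    obtain ⟨x, hx, y, -, -, rfl⟩ := mem_cat.1 hz
    obtain ⟨x', hx', y', -, -, h⟩ := mem_cat.1 hz'
    have hx := isTyped_of_mem hx
    have hx' := isTyped_of_mem hx'
    obtain ⟨a, x, rfl⟩ := List.exists_cons_of_ne_nil hx.ne_nil
    obtain ⟨b, x', rfl⟩ := List.exists_cons_of_ne_nil hx'.ne_nil
    obtain rfl : a = b := (List.cons.inj h).1
    exact h3 a.2.toNat (hx.perm.subset (by simp [labels])) _ (hx'.perm.subset (by simp [labels]))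
      rfl

theorem P_prof (t : BTree) :
    P (prof t) = ((typedWords t).filter fun x => pk (ends x).1 = true).card := by
  rw [← map_ends_typedWords, P, cnt, tot, Multiset.map_map]
  induction typedWords t using Multiset.induction_on with
  | empty => rfl
  | cons x X ih =>
    rw [Multiset.map_cons, Multiset.sum_cons, ih]
    by_cases h : pk (ends x).1 = true
    · simp [ind, h, any, add_comm]
    · simp [ind, h]

theorem typed_labels {x : List End} (h : x.IsChain fun e f => compat e f = true)
    (h0 : ∀ e ∈ x, 0 ≤ e.2) : x = typed (pk (ends x).1) (labels x) := by
  induction x with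
  | nil => rfl
  | cons a x ih =>
    have e1 : a = (pk (ends (a :: x)).1, (a.2.toNat : ℤ)) := by
      rw [Int.toNat_of_nonneg (h0 a (by simp))]; rfl
    rw [labels, List.map_cons, typed, ← e1]
    congr 1
    cases x with
    | nil => rfl
    | cons b x =>
      rw [List.isChain_cons_cons] at h
      have e2 := ih h.2 fun e he => h0 e (List.mem_cons_of_mem _ he)
      have e3 : pk (ends (b :: x)).1 = !pk (ends (a :: b :: x)).1 := by
        have := compat_ne h.1
        simp only [ends, List.headD_cons, pk]
        revert this; cases a.1 <;> cases b.1 <;> simp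
      rw [e3] at e2
      exact e2

theorem faltCount_le (t : BTree) (ht : 2 ≤ t.leaves.length) : (faltCount t : ℤ) ≤ P (prof t) := by
  rw [P_prof, Nat.cast_le, faltCount, ← Finset.card_image_of_injective _ (typed_injective true)]
  refine (Finset.card_le_card (t := Multiset.toFinset _) ?_).trans (Multiset.toFinset_card_le _)
  intro x hx
  obtain ⟨w, hw, rfl⟩ := Finset.mem_image.1 hx
  obtain ⟨hw, h⟩ := Finset.mem_filter.1 hw
  have hl : 2 ≤ w.length := by rwa [(perm_of_mem_words hw).length_eq]
  rw [Multiset.mem_toFinset, Multiset.mem_filter]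
  refine ⟨typed_mem_typedWords hw ((isForwardAlternating_iff hl).1 h), ?_⟩
  match w, hl with
  | x :: w, _ => rfl

theorem le_faltCount (t : BTree) (ht : 2 ≤ t.leaves.length) (hn : t.leaves.Nodup) :
    P (prof t) ≤ faltCount t := by
  rw [P_prof, Nat.cast_le, faltCount, ← Finset.card_image_of_injective _ (typed_injective true),
    ← Multiset.toFinset_card_of_nodup ((nodup_typedWords hn).filter _)]
  refine Finset.card_le_card fun x hx => ?_
  obtain ⟨hx, h⟩ := Multiset.mem_filter.1 (Multiset.mem_toFinset.1 hx)
  have hx := isTyped_of_mem hx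
  have e := typed_labels hx.chain hx.nonneg
  rw [h] at e
  refine Finset.mem_image.2 ⟨labels x, Finset.mem_filter.2 ⟨hx.labels_mem, ?_⟩, e.symm⟩
  rw [isForwardAlternating_iff (by rwa [hx.perm.length_eq]), ← e]
  exact hx.chain

theorem compat_true (c : ℤ) (e : End) : compat (true, c) e = vcut (c - 1) e := by
  rcases e with ⟨_ | _, y⟩ <;> simp [compat, vcut, vl, cut]

theorem compat_false (c : ℤ) (e : End) : compat (false, c) e = pcut c e := by
  rcases e with ⟨_ | _, y⟩ <;> simp [compat, pcut, pk, cut]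

theorem cnt_join_leafP_eq (c : ℤ) (X : Prof) (A B : End → Bool) :
    cnt (join (leafP c) X) A B = ind (A (true, c)) * cnt X (vcut (c - 1)) B +
      ind (A (false, c)) * cnt X (pcut c) B := by
  unfold cnt
  rw [tot_join, tot_leafP, ← tot_mul_left, ← tot_mul_left]
  simp only [compat_true, compat_false]
  congr 1 <;> exact tot_congr fun x _ => by ring

theorem cnt_merge_leafP_eq {X : Prof} (hX : Symm X) (c : ℤ) (A B : End → Bool) :
    cnt (merge (leafP c) X) A B = ind (A (true, c)) * cnt X (vcut (c - 1)) B +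
      ind (A (false, c)) * cnt X (pcut c) B + (ind (B (true, c)) * cnt X (vcut (c - 1)) A +
      ind (B (false, c)) * cnt X (pcut c) A) := by
  rw [cnt_merge (oddP_leafP c).toSymm hX, cnt_join_leafP_eq, cnt_join_leafP_eq]

theorem le_cnt_merge_pk {X : Prof} (hX : Symm X) {c : ℤ} {A B : End → Bool}
    (hA : A (true, c) = true) :
    cnt X (vcut (c - 1)) B + ind (B (true, c)) * cnt X (vcut (c - 1)) A ≤
      cnt (merge (leafP c) X) A B := by
  have h1 : ind true = 1 := rfl
  rw [cnt_merge_leafP_eq hX, hA, h1, one_mul]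
  linarith [mul_nonneg (ind_nonneg (A (false, c))) (cnt_nonneg X (pcut c) B),
    mul_nonneg (ind_nonneg (B (false, c))) (cnt_nonneg X (pcut c) A)]

theorem le_cnt_merge_vl {X : Prof} (hX : Symm X) {c : ℤ} {A B : End → Bool}
    (hA : A (false, c) = true) :
    cnt X (pcut c) B + ind (B (false, c)) * cnt X (pcut c) A ≤
      cnt (merge (leafP c) X) A B := by
  have h1 : ind true = 1 := rfl
  rw [cnt_merge_leafP_eq hX, hA, h1, one_mul]
  linarith [mul_nonneg (ind_nonneg (A (true, c))) (cnt_nonneg X (vcut (c - 1)) B),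
    mul_nonneg (ind_nonneg (B (true, c))) (cnt_nonneg X (vcut (c - 1)) A)]

theorem bounds_prof {t : BTree} {a b : ℤ} (h : ∀ m ∈ t.leaves, a ≤ (m : ℤ) ∧ (m : ℤ) < b) :
    ∀ x ∈ prof t, (a ≤ x.1.2 ∧ x.1.2 < b) ∧ (a ≤ x.2.2 ∧ x.2.2 < b) := by
  induction t with
  | leaf m =>
    have := h m (by simp [BTree.leaves])
    simp [prof, leafP, this]
  | node l r hl hr =>
    have h1 := hl fun m hm => h m (List.mem_append_left _ hm)
    have h2 := hr fun m hm => h m (List.mem_append_right _ hm)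
    intro z hz
    rcases Multiset.mem_add.1 hz with hz | hz
    · obtain ⟨x, hx, y, hy, -, rfl⟩ := mem_join.1 hz
      exact ⟨(h1 x hx).1, (h2 y hy).2⟩
    · obtain ⟨x, hx, y, hy, -, rfl⟩ := mem_join.1 hz
      exact ⟨(h2 x hx).1, (h1 y hy).2⟩

/-- Joining a leaf which is larger than all other labels doubles the count. -/
theorem two_mul_P_le {t : BTree} (ht : EvenP (prof t)) {c : ℕ} (h : ∀ m ∈ t.leaves, m < c) :
    2 * P (prof t) ≤ P (prof (.node (.leaf c) t)) := by
  have h1 := bounds_prof (t := t) (a := 0) (b := c)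
    fun m hm => ⟨Int.natCast_nonneg m, by exact_mod_cast h m hm⟩
  have h2 := le_cnt_merge_pk ht.toSymm (c := c) (A := pk) (B := any) rfl
  have h3 : cnt (prof t) vl any ≤ cnt (prof t) (vcut (c - 1)) any := cnt_le fun x hx => by
    have := (h1 x hx).1.2
    rcases x with ⟨⟨_ | _, y⟩, z⟩ <;> simp [vl, vcut, any, cut] at *
    omega
  have h4 : cnt (prof t) vl any ≤ cnt (prof t) (vcut (c - 1)) pk := cnt_le fun x hx => by
    have := (h1 x hx).1.2
    have h5 := ht.fst_eq hx
    rcases x with ⟨⟨_ | _, y⟩, ⟨_ | _, z⟩⟩ <;> simp [vl, vcut, any, cut, pk] at *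
    omega
  have h5 : cnt (prof t) vl any = P (prof t) := ht.vP
  have h6 : ind (any (true, (c : ℤ))) = 1 := rfl
  rw [h6] at h2
  change 2 * P (prof t) ≤ cnt _ _ _
  rw [prof, prof]
  linarith

/-- Joining two leaves which separate valleys and peaks triples the count. -/
theorem three_mul_le {T : Prof} (hT : Symm T) {f : ℤ} {d : ℤ}
    (h : f ≤ cnt T (pcut (d + 1)) (vcut (d - 1))) :
    3 * f ≤ P (merge (leafP d) (merge (leafP (d + 1)) T)) := by
  have hZ := symm_merge (oddP_leafP (d + 1)).toSymm hT
  set Z := merge (leafP (d + 1)) T with hZ'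
  have h1 := le_cnt_merge_pk hZ (c := d) (A := pk) (B := any) rfl
  have h1' := cnt_merge_leafP_eq hZ d pk any
  have h2 := le_cnt_merge_pk hT (c := d + 1) (A := pcut d) (B := pk) (by simp [pcut, pk, cut])
  have h3 := le_cnt_merge_vl hT (c := d + 1) (A := vl) (B := vcut (d - 1)) rfl
  rw [← hZ'] at h2 h3
  have h4 : cnt T (pcut (d + 1)) (vcut (d - 1)) ≤ cnt T (vcut (d + 1 - 1)) pk := by
    rw [cnt_symm hT]
    refine cnt_le fun x _ => ?_
    rcases x with ⟨⟨_ | _, y⟩, ⟨_ | _, z⟩⟩ <;> simp [vl, vcut, pcut, cut, pk]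
    omega
  have h5 : cnt T (pcut (d + 1)) (vcut (d - 1)) ≤ cnt T (vcut (d + 1 - 1)) (pcut d) := by
    rw [cnt_symm hT]
    refine cnt_le fun x _ => ?_
    rcases x with ⟨⟨_ | _, y⟩, ⟨_ | _, z⟩⟩ <;> simp [vl, vcut, pcut, cut, pk]
    omega
  have h6 : cnt Z vl (vcut (d - 1)) ≤ cnt Z (vcut (d - 1)) any := by
    rw [cnt_symm hZ]
    refine cnt_le fun x _ => ?_
    rcases x with ⟨⟨_ | _, y⟩, ⟨_ | _, z⟩⟩ <;> simp [vl, vcut, cut, any]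
  have e1 : ind (pk (true, d)) = 1 := rfl
  have e2 : ind (pk (true, d + 1)) = 1 := rfl
  have e3 : ind (pk (false, d)) = 0 := rfl
  have e4 : ind (any (true, d)) = 1 := rfl
  have e5 : ind (any (false, d)) = 1 := rfl
  have e6 := mul_nonneg (ind_nonneg (vcut (d - 1) (false, d + 1)))
    (cnt_nonneg T (pcut (d + 1)) vl)
  have e7 := cnt_nonneg Z (vcut (d - 1)) pk
  rw [e2] at h2
  rw [e1, e3, e4, e5] at h1'
  change 3 * f ≤ cnt _ _ _
  linarith

/-- Joining four leaves to a tree with all labels in `(a, d)` multiplies the count by six. -/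
theorem six_mul_P_le {t : BTree} (ht : EvenP (prof t)) {a d : ℕ} (had : a < d)
    (h : ∀ m ∈ t.leaves, a < m ∧ m < d) :
    6 * P (prof t) ≤ P (prof (.node (.leaf d) (.node (.leaf (d + 1)) (.node (.leaf (d + 2))
      (.node (.leaf a) t))))) := by
  have h1 := bounds_prof (t := t) (a := a + 1) (b := d) fun m hm => by have := h m hm; omega
  have hW := symm_merge (oddP_leafP a).toSymm ht.toSymm
  have hT := symm_merge (oddP_leafP (d + 2)).toSymm hW
  have h2 : cnt (prof t) pk any ≤ cnt (prof t) (pcut a) (vcut (d - 1)) := cnt_le fun x hx => by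
    have h2 := h1 x hx
    have h3 := ht.even x hx
    rcases x with ⟨⟨_ | _, y⟩, ⟨_ | _, z⟩⟩ <;> simp [vl, vcut, any, cut, pk, pcut] at *
    omega
  have h3 := le_cnt_merge_vl ht.toSymm (c := a) (A := vcut (d - 1)) (B := vcut (d - 1))
    (by simp [vcut, vl, cut]; omega)
  have h4 : ind (vcut ((d : ℤ) - 1) (false, (a : ℤ))) = 1 := by
    rw [show vcut ((d : ℤ) - 1) (false, (a : ℤ)) = true by simp [vcut, vl, cut]; omega]
    rfl
  have h5 : cnt (merge (leafP a) (prof t)) (vcut (d - 1)) (vcut (d - 1)) ≤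
      cnt (merge (leafP a) (prof t)) (vcut (d + 2 - 1)) (vcut (d - 1)) := cnt_le fun x _ => by
    rcases x with ⟨⟨_ | _, y⟩, ⟨_ | _, z⟩⟩ <;> simp [vl, vcut, cut]
    omega
  have h6 := le_cnt_merge_pk hW (c := d + 2) (A := pcut (d + 1)) (B := vcut (d - 1))
    (by simp [pcut, pk, cut])
  have h7 : ind (vcut ((d : ℤ) - 1) (true, (d : ℤ) + 2)) = 0 := rfl
  rw [h4] at h3
  rw [h7] at h6
  have h8 : 2 * P (prof t) ≤ cnt (merge (leafP (d + 2)) (merge (leafP a) (prof t)))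
      (pcut (d + 1)) (vcut (d - 1)) := by
    unfold P
    linarith
  have h9 := three_mul_le hT h8
  simp only [prof]
  push_cast
  linarith

theorem EvenP.four_leaves {M : Prof} (hM : EvenP M) (a b c d : ℤ) :
    EvenP (merge (leafP a) (merge (leafP b) (merge (leafP c) (merge (leafP d) M)))) :=
  (oddP_leafP a).merge_odd ((oddP_leafP b).merge_even ((oddP_leafP c).merge_odd
    ((oddP_leafP d).merge_even hM)))

/-- For all sets of `n` consecutive labels there is a tree with at least `e` words, `n` even. -/
def Attains (n : ℕ) (e : ℤ) : Prop :=
  ∀ s, ∃ t : BTree, t.leaves.Perm (List.range' s n) ∧ EvenP (prof t) ∧ e ≤ P (prof t)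

theorem tot_merge_leafP_of_lt {a b : ℤ} (h : a < b) (φ : End → End → ℤ) :
    tot (merge (leafP a) (leafP b)) φ = φ (false, a) (true, b) + φ (true, b) (false, a) := by
  rw [tot_merge (oddP_leafP a).toSymm (oddP_leafP b).toSymm]
  simp [tot_join, tot_leafP, compat, ind, h, h.not_gt]

theorem tot_cherry {a b c : ℤ} (h : a < c) (h' : c < b) (φ : End → End → ℤ) :
    tot (merge (leafP c) (merge (leafP a) (leafP b))) φ = φ (true, c) (true, b) +
      φ (true, b) (true, c) + φ (false, a) (false, c) + φ (false, c) (false, a) := by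
  rw [tot_merge (oddP_leafP c).toSymm
    (symm_merge (oddP_leafP a).toSymm (oddP_leafP b).toSymm)]
  simp [tot_join, tot_leafP, tot_merge_leafP_of_lt (h.trans h'), compat, ind, h, h']
  ring

theorem attains_two : Attains 2 1 := fun s => by
  refine ⟨.node (.leaf s) (.leaf (s + 1)), .refl _, (oddP_leafP _).merge_odd (oddP_leafP _), ?_⟩
  rw [prof, prof, prof, P, cnt, tot_merge_leafP_of_lt (by omega)]
  exact le_rfl

theorem attains_four : Attains 4 3 := fun s => by
  refine ⟨.node (.leaf (s + 1)) (.node (.leaf (s + 2)) (.node (.leaf s) (.leaf (s + 3)))), ?_,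
    (oddP_leafP _).merge_odd ((oddP_leafP _).merge_even ((oddP_leafP _).merge_odd (oddP_leafP _))),
    ?_⟩
  · exact (by decide : [1, 2, 0, 3].Perm (List.range' 0 4)).map (s + ·)
  · have h1 := symm_merge (oddP_leafP s).toSymm (oddP_leafP (s + 3)).toSymm
    have h2 := three_mul_le h1 (f := 1) (d := s + 1) (by
      rw [cnt, tot_merge_leafP_of_lt (by omega)]
      simp [pcut, pk, vcut, vl, cut, ind, show (s : ℤ) + 1 + 1 < s + 3 by omega])
    simp only [prof]
    push_cast
    rw [add_assoc] at h2
    exact h2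

theorem attains_six : Attains 6 7 := fun s => by
  refine ⟨.node (.node (.leaf (s + 3)) (.node (.leaf s) (.leaf (s + 4))))
    (.node (.leaf (s + 2)) (.node (.leaf (s + 1)) (.leaf (s + 5)))), ?_,
    ((oddP_leafP _).merge_even ((oddP_leafP _).merge_odd (oddP_leafP _))).merge_odd
      ((oddP_leafP _).merge_even ((oddP_leafP _).merge_odd (oddP_leafP _))), ?_⟩
  · exact (by decide : [3, 0, 4, 2, 1, 5].Perm (List.range' 0 6)).map (s + ·)
  · simp only [prof]
    push_cast
    rw [P, cnt, merge, tot_union, tot_join, tot_join]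
    rw [tot_cherry (by omega) (by omega)]
    simp only [tot_cherry (show (s : ℤ) + 1 < s + 2 by omega) (show (s : ℤ) + 2 < s + 5 by omega),
      tot_cherry (show (s : ℤ) < s + 3 by omega) (show (s : ℤ) + 3 < s + 4 by omega)]
    simp [pk, any, ind, compat]

theorem Attains.add_four {n : ℕ} {e : ℤ} (h : Attains n e) : Attains (n + 4) (6 * e) := fun s => by
  obtain ⟨t, h1, h2, h3⟩ := h (s + 1)
  refine ⟨_, ?_, ?_, (mul_le_mul_of_nonneg_left h3 (by norm_num)).trans
    (six_mul_P_le h2 (a := s) (d := s + n + 1) (by omega) fun m hm => ?_)⟩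
  · rw [List.range'_succ, ← List.range'_append_1, show s + 1 + n = s + n + 1 by ring]
    refine .trans ?_ ((h1.append_right _).cons _)
    exact List.perm_append_comm (l₁ := [s + n + 1, s + n + 1 + 1, s + n + 1 + 2])
      (l₂ := s :: t.leaves)
  · simp only [prof]
    exact h2.four_leaves _ _ _ _
  · have := List.mem_range'_1.1 (h1.mem_iff.1 hm)
    omega

theorem Attains.add_mul_four {n : ℕ} {e : ℤ} (h : Attains n e) (k : ℕ) :
    Attains (n + 4 * k) (e * 6 ^ k) := by
  induction k with
  | zero => simpa using h
  | succ k ih =>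
    have := ih.add_four
    rwa [show n + 4 * k + 4 = n + 4 * (k + 1) by ring,
      show 6 * (e * 6 ^ k) = e * 6 ^ (k + 1) by ring] at this

theorem rFAlt_eq {n N : ℕ} (hn : 2 ≤ n) (h : ∀ M, Good n M → P M ≤ N)
    (h' : ∃ t : BTree, t.leaves.Perm (List.range' 1 n) ∧ N ≤ P (prof t)) : rFAlt n = N := by
  have hl : ∀ t : BTree, t.leaves.Perm (List.range' 1 n) → t.leaves.length = n := fun t ht => by
    rw [ht.length_eq, List.length_range']
  have h1 : ∀ t : BTree, t.leaves.Perm (List.range' 1 n) → faltCount t ≤ N := fun t ht => by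
    have := faltCount_le t (by rwa [hl t ht])
    have := h _ (hl t ht ▸ good_prof t)
    omega
  obtain ⟨t, ht, hN⟩ := h'
  have h2 := le_faltCount t (by rwa [hl t ht]) (ht.nodup_iff.2 List.nodup_range')
  refine IsGreatest.csSup_eq ⟨⟨t, ht, ?_⟩, ?_⟩
  · have := h1 t ht
    omega
  · rintro m ⟨t, ht, rfl⟩
    exact h1 t ht

theorem Attains.exists_even {n : ℕ} {e : ℤ} (h : Attains n e) :
    ∃ t : BTree, t.leaves.Perm (List.range' 1 n) ∧ e ≤ P (prof t) := by
  obtain ⟨t, h1, -, h3⟩ := h 1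
  exact ⟨t, h1, h3⟩

theorem Attains.exists_odd {n : ℕ} {e : ℤ} (h : Attains n e) :
    ∃ t : BTree, t.leaves.Perm (List.range' 1 (n + 1)) ∧ 2 * e ≤ P (prof t) := by
  obtain ⟨t, h1, h2, h3⟩ := h 1
  refine ⟨.node (.leaf (n + 1)) t, ?_, (mul_le_mul_of_nonneg_left h3 (by norm_num)).trans
    (two_mul_P_le h2 fun m hm => ?_)⟩
  · rw [BTree.leaves, BTree.leaves, List.singleton_append, List.range'_1_concat, add_comm 1 n]
    exact (h1.cons _).trans (List.perm_append_singleton _ _).symm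
  · have := List.mem_range'_1.1 (h1.mem_iff.1 hm)
    omega

theorem Good.P_two {M : Prof} (h : Good 2 M) : P M ≤ 1 := by
  rcases h with ⟨c, hm, -⟩ | ⟨q, u, hm, rfl, L⟩ | ⟨q, u, hm, -, -⟩ | ⟨q, u, hm, -, -⟩ |
    ⟨q, u, hm, -, -⟩ <;> try omega
  obtain rfl : q = 0 := by omega
  have := L.gP
  omega

theorem Good.P_three {M : Prof} (h : Good 3 M) : P M ≤ 2 := by
  rcases h with ⟨c, hm, -⟩ | ⟨q, u, hm, -, -⟩ | ⟨q, u, hm, rfl, L⟩ | ⟨q, u, hm, -, -⟩ |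
    ⟨q, u, hm, -, -⟩ <;> try omega
  obtain rfl : q = 0 := by omega
  have := L.gP
  omega

theorem Good.P_four {k : ℕ} {M : Prof} (h : Good (4 + 4 * k) M) : P M ≤ 3 * 6 ^ k := by
  rcases h with ⟨c, hm, -⟩ | ⟨q, u, hm, -, -⟩ | ⟨q, u, hm, -, -⟩ | ⟨q, u, hm, rfl, L⟩ |
    ⟨q, u, hm, -, -⟩ <;> try omega
  obtain rfl : q = k := by omega
  linarith [L.gP]

theorem Good.P_five {k : ℕ} {M : Prof} (h : Good (5 + 4 * k) M) : P M ≤ 6 * 6 ^ k := by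
  rcases h with ⟨c, hm, -⟩ | ⟨q, u, hm, -, -⟩ | ⟨q, u, hm, -, -⟩ | ⟨q, u, hm, -, -⟩ |
    ⟨q, u, hm, rfl, L⟩ <;> try omega
  obtain rfl : q = k := by omega
  linarith [L.gP]

theorem Good.P_six {k : ℕ} {M : Prof} (h : Good (6 + 4 * k) M) : P M ≤ 7 * 6 ^ k := by
  rcases h with ⟨c, hm, -⟩ | ⟨q, u, hm, rfl, L⟩ | ⟨q, u, hm, -, -⟩ | ⟨q, u, hm, -, -⟩ |
    ⟨q, u, hm, -, -⟩ <;> try omega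
  obtain rfl : q = k + 1 := by omega
  have := L.gP
  rw [pow_succ] at this
  linarith

theorem Good.P_seven {k : ℕ} {M : Prof} (h : Good (7 + 4 * k) M) : P M ≤ 14 * 6 ^ k := by
  rcases h with ⟨c, hm, -⟩ | ⟨q, u, hm, -, -⟩ | ⟨q, u, hm, rfl, L⟩ | ⟨q, u, hm, -, -⟩ |
    ⟨q, u, hm, -, -⟩ <;> try omega
  obtain rfl : q = k + 1 := by omega
  have := L.gP
  rw [pow_succ] at this
  linarith

theorem rFAlt_one : rFAlt 1 = 1 := by
  have h (a : ℕ) : faltCount (.leaf a) = 1 := by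
    rw [faltCount, BTree.words, Finset.filter_singleton, if_pos, Finset.card_singleton]
    refine ⟨⟨fun i hi => ?_, fun i hi => ?_⟩, .inl le_rfl⟩ <;> simp at hi
  refine IsGreatest.csSup_eq ⟨⟨.leaf 1, .refl _, (h 1).symm⟩, ?_⟩
  rintro m ⟨t, ht, rfl⟩
  cases t with
  | leaf a => exact (h a).le
  | node l r =>
    have h1 (t : BTree) : 0 < t.leaves.length := by
      induction t with
      | leaf a => exact one_pos
      | node l r hl hr => rw [BTree.leaves, List.length_append]; omega
    have h2 := ht.length_eq
    rw [BTree.leaves, List.length_append, List.length_range'] at h2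
    have := h1 l
    have := h1 r
    omega

end Profile

/-- Theorem 2 (values of `r_n^forw`). -/
theorem rFAlt_values :
    rFAlt 1 = 1 ∧ rFAlt 2 = 1 ∧ rFAlt 3 = 2 ∧
    ∀ k : ℕ,
      rFAlt (4 + 4 * k) = 3 * 6 ^ k ∧
      rFAlt (5 + 4 * k) = 6 * 6 ^ k ∧
      rFAlt (6 + 4 * k) = 7 * 6 ^ k ∧
      rFAlt (7 + 4 * k) = 14 * 6 ^ k := by
  have h4 := Profile.attains_four.add_mul_four
  have h6 := Profile.attains_six.add_mul_four
  refine ⟨Profile.rFAlt_one, Profile.rFAlt_eq le_rfl (fun M h => h.P_two)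
      Profile.attains_two.exists_even,
    Profile.rFAlt_eq (by omega) (fun M h => h.P_three) Profile.attains_two.exists_odd, fun k =>
    ⟨Profile.rFAlt_eq (by omega) (fun M h => ?_) ?_,
      Profile.rFAlt_eq (by omega) (fun M h => ?_) ?_,
      Profile.rFAlt_eq (by omega) (fun M h => ?_) ?_,
      Profile.rFAlt_eq (by omega) (fun M h => ?_) ?_⟩⟩
  · exact_mod_cast h.P_four
  · exact_mod_cast (h4 k).exists_even
  · exact_mod_cast h.P_five
  · have := (h4 k).exists_odd
    rw [← mul_assoc, add_right_comm] at this
    exact_mod_cast this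
  · exact_mod_cast h.P_six
  · exact_mod_cast (h6 k).exists_even
  · exact_mod_cast h.P_seven
  · have := (h6 k).exists_odd
    rw [← mul_assoc, add_right_comm] at this
    exact_mod_cast this
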